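/- arXiv:2506.07602 — 9 statements merged into one kernel-verified Lean document; each statement's English description precedes it below -/
import Mathlib

section
/- For every integer m ≥ 1 and every real s > 1 there exists a constant C = C(m,s) > 0 such that for all nonnegative reals a₁,…,a_m one has 0 ≤ (a₁+⋯+a_m)^s − (a₁^s+⋯+a_m^s) ≤ C ∑_{i≠j} ((a_i+a_j)^s − a_i^s − a_j^s), and moreover ∑_{i≠j} ((a_i+a_j)^s − a_i^s − a_j^s) ≤ C ∑_{i≠j} a_i^{s−1} a_j if s > 2, while ∑_{i≠j} ((a_i+a_j)^s − a_i^s − a_j^s) ≤ C ∑_{i≠j} min{a_i^{s−1} a_j, a_i a_j^{s−1}} if 1 < s ≤ 2. -/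
/-- The graph of `y ↦ y ^ s` lies above its tangent lines on the nonnegative half line. -/
lemma rpow_add_mul_sub_le_rpow {s x y : ℝ} (hs : 1 < s) (hx : 0 ≤ x) (hy : 0 ≤ y) :
    x ^ s + s * x ^ (s - 1) * (y - x) ≤ y ^ s := by
  rcases hx.eq_or_lt with rfl | hx
  · rw [Real.zero_rpow (by linarith), Real.zero_rpow (by linarith)]
    simpa using Real.rpow_nonneg hy s
  · have hb := one_add_mul_self_le_rpow_one_add (s := y / x - 1) (p := s)
      (by linarith [div_nonneg hy hx.le]) hs.le
    rw [add_sub_cancel, Real.div_rpow hy hx.le, le_div_iff₀ (Real.rpow_pos_of_pos hx s)] at hb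
    refine le_trans (le_of_eq ?_) hb
    rw [Real.rpow_sub_one hx.ne']
    field_simp

lemma rpow_eq_rpow_sub_one_mul {s x : ℝ} (hs : 1 < s) (hx : 0 ≤ x) :
    x ^ s = x ^ (s - 1) * x := by
  conv_rhs => rw [← Real.rpow_add_one' hx (by linarith), sub_add_cancel]

lemma mul_rpow_sub_one_mul_le_add_rpow_sub {s x y : ℝ} (hs : 1 < s) (hy : 0 ≤ y) (hyx : y ≤ x) :
    (s - 1) * (x ^ (s - 1) * y) ≤ (x + y) ^ s - x ^ s - y ^ s := by
  have hx := hy.trans hyx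
  have ht := rpow_add_mul_sub_le_rpow hs hx (add_nonneg hx hy)
  have hm : y ^ (s - 1) * y ≤ x ^ (s - 1) * y :=
    mul_le_mul_of_nonneg_right (Real.rpow_le_rpow hy hyx (by linarith)) hy
  rw [← rpow_eq_rpow_sub_one_mul hs hy] at hm
  linarith

lemma add_rpow_sub_nonneg {s x y : ℝ} (hs : 1 < s) (hx : 0 ≤ x) (hy : 0 ≤ y) :
    0 ≤ (x + y) ^ s - x ^ s - y ^ s := by
  wlog hyx : y ≤ x generalizing x y
  · have := this hy hx (le_of_not_ge hyx)
    rw [add_comm y x] at this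
    linarith
  · have h1 := mul_rpow_sub_one_mul_le_add_rpow_sub hs hy hyx
    have h2 : 0 ≤ (s - 1) * (x ^ (s - 1) * y) :=
      mul_nonneg (by linarith) (mul_nonneg (Real.rpow_nonneg hx _) hy)
    linarith

lemma add_rpow_sub_le {s x y : ℝ} (hs : 1 < s) (hy : 0 ≤ y) (hyx : y ≤ x) :
    (x + y) ^ s - x ^ s - y ^ s ≤ s * 2 ^ (s - 1) * (x ^ (s - 1) * y) := by
  have hx := hy.trans hyx
  have ht := rpow_add_mul_sub_le_rpow hs (add_nonneg hx hy) hx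
  have hm : (x + y) ^ (s - 1) ≤ 2 ^ (s - 1) * x ^ (s - 1) := by
    rw [← Real.mul_rpow zero_le_two hx]
    exact Real.rpow_le_rpow (by linarith) (by linarith) (by linarith)
  have := mul_le_mul_of_nonneg_left hm (mul_nonneg (by linarith : 0 ≤ s) hy)
  have := Real.rpow_nonneg hy s
  linarith

lemma add_rpow_sub_le_add {s x y : ℝ} (hs : 1 < s) (hx : 0 ≤ x) (hy : 0 ≤ y) :
    (x + y) ^ s - x ^ s - y ^ s
      ≤ s * 2 ^ (s - 1) * (x ^ (s - 1) * y + y ^ (s - 1) * x) := by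
  wlog hyx : y ≤ x generalizing x y
  · have := this hy hx (le_of_not_ge hyx)
    rw [add_comm y x] at this
    linarith
  · have h1 := add_rpow_sub_le hs hy hyx
    have h2 : 0 ≤ s * 2 ^ (s - 1) * (y ^ (s - 1) * x) := by positivity
    linarith

lemma add_rpow_sub_le_min {s x y : ℝ} (hs : 1 < s) (hs2 : s ≤ 2) (hx : 0 ≤ x) (hy : 0 ≤ y) :
    (x + y) ^ s - x ^ s - y ^ s
      ≤ s * 2 ^ (s - 1) * min (x ^ (s - 1) * y) (x * y ^ (s - 1)) := by
  wlog hyx : y ≤ x generalizing x y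
  · have := this hy hx (le_of_not_ge hyx)
    rw [add_comm y x, min_comm, mul_comm y, mul_comm _ x] at this
    linarith
  · have hmin : x ^ (s - 1) * y ≤ x * y ^ (s - 1) := by
      rcases hy.eq_or_lt with rfl | hy
      · rw [Real.zero_rpow (by linarith)]; simp
      · have hx' := hy.trans_le hyx
        have hp : y ^ (2 - s) ≤ x ^ (2 - s) := Real.rpow_le_rpow hy.le hyx (by linarith)
        have ex : x = x ^ (s - 1) * x ^ (2 - s) := by
          rw [← Real.rpow_add hx']; norm_num
        have ey : y = y ^ (s - 1) * y ^ (2 - s) := by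
          rw [← Real.rpow_add hy]; norm_num
        calc x ^ (s - 1) * y = x ^ (s - 1) * y ^ (s - 1) * y ^ (2 - s) := by
              rw [mul_assoc, ← ey]
          _ ≤ x ^ (s - 1) * y ^ (s - 1) * x ^ (2 - s) := by gcongr
          _ = x ^ (s - 1) * x ^ (2 - s) * y ^ (s - 1) := by ring
          _ = x * y ^ (s - 1) := by rw [← ex]
    rw [min_eq_left hmin]
    exact add_rpow_sub_le hs hy hyx

lemma sum_rpow_le_rpow_sum {ι : Type*} [Fintype ι] {s : ℝ} (hs : 1 < s) {a : ι → ℝ}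
    (ha : ∀ i, 0 ≤ a i) : ∑ i, a i ^ s ≤ (∑ i, a i) ^ s := by
  rw [rpow_eq_rpow_sub_one_mul hs (Finset.sum_nonneg fun i _ => ha i), Finset.mul_sum]
  refine Finset.sum_le_sum fun i _ => ?_
  rw [rpow_eq_rpow_sub_one_mul hs (ha i)]
  exact mul_le_mul_of_nonneg_right (Real.rpow_le_rpow (ha i)
    (Finset.single_le_sum (fun j _ => ha j) (Finset.mem_univ i)) (by linarith)) (ha i)

lemma sum_erase_le_sum_offDiag {ι : Type*} [Fintype ι] [DecidableEq ι] {f : ι × ι → ℝ}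
    (hf : ∀ q, 0 ≤ f q) (k : ι) :
    ∑ j ∈ Finset.univ.erase k, f (k, j) ≤ ∑ q ∈ Finset.univ.offDiag, f q := by
  rw [← Finset.sum_image (s := Finset.univ.erase k) (g := fun j => (k, j)) (f := f)
    (fun x _ y _ h => (Prod.ext_iff.mp h).2)]
  refine Finset.sum_le_sum_of_subset_of_nonneg ?_ fun q _ _ => hf q
  intro q hq
  obtain ⟨j, hj, rfl⟩ := Finset.mem_image.mp hq
  simpa [eq_comm] using hj

lemma rpow_sum_sub_sum_rpow_le {ι : Type*} [Fintype ι] [Nonempty ι] [DecidableEq ι] {s : ℝ}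
    (hs : 1 < s) {a : ι → ℝ} (ha : ∀ i, 0 ≤ a i) :
    (∑ i, a i) ^ s - ∑ i, a i ^ s
      ≤ s * (Fintype.card ι : ℝ) ^ (s - 1) / (s - 1) * ∑ q ∈ Finset.univ.offDiag,
          ((a q.1 + a q.2) ^ s - a q.1 ^ s - a q.2 ^ s) := by
  obtain ⟨k, hk⟩ := Finite.exists_max a
  have hs1 : 0 < s - 1 := by linarith
  have hs0 : 0 < s := by linarith
  have hS : 0 ≤ ∑ i, a i := Finset.sum_nonneg fun i _ => ha i
  have hle : ∑ i, a i ≤ Fintype.card ι * a k := by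
    simpa using Finset.sum_le_card_nsmul Finset.univ a (a k) fun i _ => hk i
  have hsplit : ∑ j ∈ Finset.univ.erase k, a j = ∑ i, a i - a k := by
    rw [← Finset.add_sum_erase _ a (Finset.mem_univ k)]; ring
  have hR : 0 ≤ ∑ j ∈ Finset.univ.erase k, a j := Finset.sum_nonneg fun i _ => ha i
  have hpow : (∑ i, a i) ^ (s - 1) ≤ (Fintype.card ι : ℝ) ^ (s - 1) * a k ^ (s - 1) := by
    rw [← Real.mul_rpow (Nat.cast_nonneg _) (ha k)]
    exact Real.rpow_le_rpow hS hle hs1.le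
  have hsingle : a k ^ s ≤ ∑ i, a i ^ s :=
    Finset.single_le_sum (f := fun i => a i ^ s) (fun i _ => Real.rpow_nonneg (ha i) s)
      (Finset.mem_univ k)
  have ht := rpow_add_mul_sub_le_rpow hs hS (ha k)
  calc (∑ i, a i) ^ s - ∑ i, a i ^ s
      ≤ s * (∑ i, a i) ^ (s - 1) * ∑ j ∈ Finset.univ.erase k, a j := by
        rw [hsplit]; linarith
    _ ≤ s * ((Fintype.card ι : ℝ) ^ (s - 1) * a k ^ (s - 1))
          * ∑ j ∈ Finset.univ.erase k, a j := by gcongr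
    _ = s * (Fintype.card ι : ℝ) ^ (s - 1) / (s - 1)
          * ∑ j ∈ Finset.univ.erase k, (s - 1) * (a k ^ (s - 1) * a j) := by
        rw [← Finset.mul_sum, ← Finset.mul_sum]; field_simp
    _ ≤ s * (Fintype.card ι : ℝ) ^ (s - 1) / (s - 1)
          * ∑ j ∈ Finset.univ.erase k, ((a k + a j) ^ s - a k ^ s - a j ^ s) := by
        refine mul_le_mul_of_nonneg_left (Finset.sum_le_sum fun j _ =>
          mul_rpow_sub_one_mul_le_add_rpow_sub hs (ha j) (hk j)) (by positivity)
    _ ≤ _ := by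
        refine mul_le_mul_of_nonneg_left (sum_erase_le_sum_offDiag
          (f := fun q => (a q.1 + a q.2) ^ s - a q.1 ^ s - a q.2 ^ s)
          (fun q => add_rpow_sub_nonneg hs (ha _) (ha _)) k) (by positivity)

lemma sum_offDiag_swap {ι : Type*} [Fintype ι] [DecidableEq ι] (f : ι × ι → ℝ) :
    ∑ q ∈ Finset.univ.offDiag, f q.swap = ∑ q ∈ Finset.univ.offDiag, f q :=
  Finset.sum_equiv (Equiv.prodComm ι ι) (by simp [eq_comm]) (by simp)

/-- For every `m ≥ 1` and `s > 1` there is `C = C(m,s) > 0` such that for all nonnegative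
`a₁,…,a_m`:
`0 ≤ (∑ aᵢ)^s − ∑ aᵢ^s ≤ C ∑_{i≠j} ((aᵢ+aⱼ)^s − aᵢ^s − aⱼ^s)`, and moreover the double sum is
bounded by `C ∑_{i≠j} aᵢ^{s−1} aⱼ` if `s > 2`, and by
`C ∑_{i≠j} min{aᵢ^{s−1} aⱼ, aᵢ aⱼ^{s−1}}` if `1 < s ≤ 2`. -/
theorem superadditivity_estimate (m : ℕ) (hm : 1 ≤ m) (s : ℝ) (hs : 1 < s) :
    ∃ C : ℝ, 0 < C ∧ ∀ a : Fin m → ℝ, (∀ i, 0 ≤ a i) →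
      (0 ≤ (∑ i, a i) ^ s - ∑ i, a i ^ s) ∧
      ((∑ i, a i) ^ s - ∑ i, a i ^ s
        ≤ C * ∑ q ∈ Finset.univ.offDiag,
            ((a q.1 + a q.2) ^ s - a q.1 ^ s - a q.2 ^ s)) ∧
      (2 < s →
        ∑ q ∈ Finset.univ.offDiag, ((a q.1 + a q.2) ^ s - a q.1 ^ s - a q.2 ^ s)
          ≤ C * ∑ q ∈ Finset.univ.offDiag, a q.1 ^ (s - 1) * a q.2) ∧
      (s ≤ 2 →
        ∑ q ∈ Finset.univ.offDiag, ((a q.1 + a q.2) ^ s - a q.1 ^ s - a q.2 ^ s)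
          ≤ C * ∑ q ∈ Finset.univ.offDiag,
              min (a q.1 ^ (s - 1) * a q.2) (a q.1 * a q.2 ^ (s - 1))) := by
  have hs0 : 0 < s := by linarith
  have hs1 : 0 < s - 1 := by linarith
  have : Nonempty (Fin m) := ⟨⟨0, hm⟩⟩
  set K : ℝ := s * (m : ℝ) ^ (s - 1) / (s - 1) with hK
  set L : ℝ := s * 2 ^ (s - 1) with hL
  have hK0 : 0 ≤ K := by positivity
  have hL0 : 0 < L := by positivity
  refine ⟨K + 2 * L, by positivity, fun a ha =>
    ⟨sub_nonneg.mpr (sum_rpow_le_rpow_sum hs ha), ?_, fun _ => ?_, fun hs2 => ?_⟩⟩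
  · have h := rpow_sum_sub_sum_rpow_le hs ha
    rw [Fintype.card_fin, ← hK] at h
    exact h.trans (mul_le_mul_of_nonneg_right (by linarith)
      (Finset.sum_nonneg fun q _ => add_rpow_sub_nonneg hs (ha _) (ha _)))
  · have hswap := sum_offDiag_swap fun q : Fin m × Fin m => a q.1 ^ (s - 1) * a q.2
    simp only [Prod.fst_swap, Prod.snd_swap] at hswap
    have hnn : 0 ≤ ∑ q ∈ Finset.univ.offDiag, a q.1 ^ (s - 1) * a q.2 :=
      Finset.sum_nonneg fun q _ => mul_nonneg (Real.rpow_nonneg (ha _) _) (ha _)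
    refine (Finset.sum_le_sum fun q _ => add_rpow_sub_le_add hs (ha q.1) (ha q.2)).trans ?_
    rw [← Finset.mul_sum, Finset.sum_add_distrib, hswap, ← hL]
    linarith [mul_nonneg hK0 hnn]
  · refine (Finset.sum_le_sum fun q _ =>
      add_rpow_sub_le_min hs hs2 (ha q.1) (ha q.2)).trans ?_
    rw [← Finset.mul_sum, ← hL]
    exact mul_le_mul_of_nonneg_right (by linarith) (Finset.sum_nonneg fun q _ =>
      le_min (mul_nonneg (Real.rpow_nonneg (ha _) _) (ha _))
        (mul_nonneg (ha _) (Real.rpow_nonneg (ha _) _)))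
end

section
/- Let n ≥ 3 be an integer, Ω ⊂ ℝⁿ a bounded open set, and s > 0 a real number. Then there exists a constant C = C(n, s, Ω) > 0 such that for every δ ∈ (0, 1/2] and every ξ ∈ Ω: ∫_Ω U_{δ,ξ}(x)^s dx ≤ C δ^{(n−2)s/2} if 0 < s < n/(n−2); ∫_Ω U_{δ,ξ}(x)^s dx ≤ C δ^{n/2} |log δ| if s = n/(n−2); and ∫_Ω U_{δ,ξ}(x)^s dx ≤ C δ^{n − (n−2)s/2} if s > n/(n−2). -/
open MeasureTheory

/-- The Aubin–Talenti bubble `U_{δ,ξ}` on `ℝⁿ`. -/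
noncomputable def bubble (n : ℕ) (δ : ℝ) (ξ x : EuclideanSpace ℝ (Fin n)) : ℝ :=
  ((n : ℝ) * ((n : ℝ) - 2)) ^ (((n : ℝ) - 2) / 4) *
    (δ / (δ ^ 2 + ‖x - ξ‖ ^ 2)) ^ (((n : ℝ) - 2) / 2)

open Set in
/-- Splitting at `y = δ` bounds the radial integral of the bubble profile. -/
lemma radial_profile_integral_le {n : ℕ} (hn : 1 ≤ n) {p δ R : ℝ} (hp : 0 < p) (hδ : 0 < δ)
    (hR : δ ≤ R) :
    ∫ y in (0 : ℝ)..R, y ^ (n - 1) * (δ / (δ ^ 2 + y ^ 2)) ^ p ≤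
      δ ^ ((n : ℝ) - p) / n + δ ^ p * ∫ y in δ..R, y ^ ((n : ℝ) - 1 - 2 * p) := by
  have hcont : Continuous fun y : ℝ => y ^ (n - 1) * (δ / (δ ^ 2 + y ^ 2)) ^ p := by
    refine (continuous_id.pow _).mul (Continuous.rpow_const ?_ fun _ => Or.inr hp.le)
    exact continuous_const.div (by fun_prop) fun y => by positivity
  rw [← intervalIntegral.integral_add_adjacent_intervals
    (hcont.intervalIntegrable 0 δ) (hcont.intervalIntegrable δ R)]
  refine add_le_add ?_ ?_
  · calc ∫ y in (0 : ℝ)..δ, y ^ (n - 1) * (δ / (δ ^ 2 + y ^ 2)) ^ p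
        ≤ ∫ y in (0 : ℝ)..δ, y ^ (n - 1) * δ ^ (-p) := by
          refine intervalIntegral.integral_mono_on hδ.le (hcont.intervalIntegrable _ _)
            (Continuous.intervalIntegrable (by fun_prop) _ _) fun y hy => ?_
          rw [Real.rpow_neg hδ.le, ← Real.inv_rpow hδ.le]
          refine mul_le_mul_of_nonneg_left (Real.rpow_le_rpow (by positivity) ?_ hp.le)
            (pow_nonneg hy.1 _)
          rw [div_le_iff₀ (by positivity)]
          field_simp
          nlinarith [sq_nonneg y]
      _ = δ ^ ((n : ℝ) - p) / n := by
          rw [intervalIntegral.integral_mul_const, integral_pow, Nat.sub_add_cancel hn,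
            zero_pow (by omega), Nat.cast_sub hn, sub_eq_add_neg (n : ℝ) p, Real.rpow_add hδ,
            Real.rpow_natCast]
          push_cast
          ring
  · rw [← intervalIntegral.integral_const_mul]
    refine intervalIntegral.integral_mono_on hR (hcont.intervalIntegrable _ _)
      (ContinuousOn.intervalIntegrable ?_) fun y hy => ?_
    · rw [uIcc_of_le hR]
      exact continuousOn_const.mul
        (continuousOn_id.rpow_const fun y hy => Or.inl (hδ.trans_le hy.1).ne')
    · have hy0 : 0 < y := hδ.trans_le hy.1
      have hsplit : y ^ ((n : ℝ) - 1 - 2 * p) = y ^ (n - 1) * (y ^ 2) ^ (-p) := by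
        rw [← Real.rpow_natCast y 2, ← Real.rpow_mul hy0.le, ← Real.rpow_natCast y (n - 1),
          ← Real.rpow_add hy0, Nat.cast_sub hn]
        push_cast
        ring_nf
      rw [hsplit, mul_left_comm, Real.rpow_neg (by positivity), ← div_eq_mul_inv,
        ← Real.div_rpow hδ.le (by positivity)]
      gcongr
      nlinarith [sq_nonneg δ]

open Set Metric in
/-- The integral of the bubble profile over a subset of `ball ξ R` is at most the corresponding
radial integral. -/
lemma setIntegral_profile_le_radial {n : ℕ} (hn : 1 ≤ n) {Ω : Set (EuclideanSpace ℝ (Fin n))}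
    {ξ : EuclideanSpace ℝ (Fin n)} {p δ R : ℝ} (hp : 0 < p) (hδ : 0 < δ) (hR : 0 ≤ R)
    (hΩ : Ω ⊆ ball ξ R) :
    ∫ x in Ω, (δ / (δ ^ 2 + ‖x - ξ‖ ^ 2)) ^ p ≤
      (n * volume.real (ball (0 : EuclideanSpace ℝ (Fin n)) 1)) *
        ∫ y in (0 : ℝ)..R, y ^ (n - 1) * (δ / (δ ^ 2 + y ^ 2)) ^ p := by
  have : Nonempty (Fin n) := ⟨⟨0, hn⟩⟩
  set g : ℝ → ℝ := fun y => (δ / (δ ^ 2 + y ^ 2)) ^ p with hg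
  have hcont : Continuous g := by
    refine Continuous.rpow_const ?_ fun _ => Or.inr hp.le
    exact continuous_const.div (by fun_prop) fun y => by positivity
  calc ∫ x in Ω, g ‖x - ξ‖
      ≤ ∫ x in ball ξ R, g ‖x - ξ‖ := by
        refine setIntegral_mono_set ?_ (.of_forall fun x => by positivity) hΩ.eventuallyLE
        exact ((by fun_prop : Continuous fun x => g ‖x - ξ‖).continuousOn.integrableOn_compact
          (isCompact_closedBall ξ R)).mono_set ball_subset_closedBall
    _ = ∫ x : EuclideanSpace ℝ (Fin n), (Iio R).indicator g ‖x‖ := by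
        rw [← integral_indicator measurableSet_ball,
          ← integral_sub_right_eq_self (fun x => (Iio R).indicator g ‖x‖) ξ]
        congr 1
    _ = _ := by
        rw [integral_fun_norm_addHaar volume, finrank_euclideanSpace_fin,
          intervalIntegral.integral_of_le hR, integral_Ioc_eq_integral_Ioo, nsmul_eq_mul,
          smul_eq_mul, mul_assoc]
        congr 2
        rw [← Ioi_inter_Iio, ← setIntegral_indicator measurableSet_Iio]
        congr 1 with y
        by_cases hy : y < R <;> simp [hy, hg]

lemma bubble_rpow {n : ℕ} (hn : 3 ≤ n) {δ : ℝ} (hδ : 0 < δ) (ξ x : EuclideanSpace ℝ (Fin n))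
    (s : ℝ) :
    bubble n δ ξ x ^ s = (((n : ℝ) * ((n : ℝ) - 2)) ^ (((n : ℝ) - 2) / 4)) ^ s *
      (δ / (δ ^ 2 + ‖x - ξ‖ ^ 2)) ^ (((n : ℝ) - 2) * s / 2) := by
  have h3 : (3 : ℝ) ≤ n := by exact_mod_cast hn
  have h2 : (0 : ℝ) ≤ (n : ℝ) - 2 := by linarith
  rw [bubble, Real.mul_rpow (by positivity) (by positivity),
    ← Real.rpow_mul (x := δ / _) (by positivity), div_mul_eq_mul_div]

/-- `L^s`-norm estimates of the Aubin–Talenti bubble on a bounded open set `Ω ⊂ ℝⁿ`. -/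
theorem bubble_power_integral_estimate (n : ℕ) (hn : 3 ≤ n)
    (Ω : Set (EuclideanSpace ℝ (Fin n))) (hΩo : IsOpen Ω) (hΩb : Bornology.IsBounded Ω)
    (s : ℝ) (hs : 0 < s) :
    ∃ C : ℝ, 0 < C ∧ ∀ δ : ℝ, 0 < δ → δ ≤ 1 / 2 → ∀ ξ ∈ Ω,
      (s < (n : ℝ) / ((n : ℝ) - 2) →
        ∫ x in Ω, bubble n δ ξ x ^ s ≤ C * δ ^ (((n : ℝ) - 2) * s / 2)) ∧
      (s = (n : ℝ) / ((n : ℝ) - 2) →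
        ∫ x in Ω, bubble n δ ξ x ^ s ≤ C * δ ^ ((n : ℝ) / 2) * |Real.log δ|) ∧
      ((n : ℝ) / ((n : ℝ) - 2) < s →
        ∫ x in Ω, bubble n δ ξ x ^ s ≤ C * δ ^ ((n : ℝ) - ((n : ℝ) - 2) * s / 2)) := by
  have h3 : (3 : ℝ) ≤ n := by exact_mod_cast hn
  have h2 : (0 : ℝ) < (n : ℝ) - 2 := by linarith
  have hn0 : (0 : ℝ) < n := by linarith
  set p : ℝ := ((n : ℝ) - 2) * s / 2 with hp_def
  have hp : 0 < p := by positivity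
  set R : ℝ := Metric.diam Ω + 1 with hR_def
  have hR : 1 ≤ R := by linarith [Metric.diam_nonneg (s := Ω)]
  set K : ℝ := (((n : ℝ) * ((n : ℝ) - 2)) ^ (((n : ℝ) - 2) / 4)) ^ s *
    (n * volume.real (Metric.ball (0 : EuclideanSpace ℝ (Fin n)) 1)) with hK_def
  have hball : 0 < volume.real (Metric.ball (0 : EuclideanSpace ℝ (Fin n)) 1) :=
    ENNReal.toReal_pos (Metric.measure_ball_pos _ _ one_pos).ne' measure_ball_lt_top.ne
  have hK : 0 < K := by positivity
  have key : ∀ δ : ℝ, 0 < δ → δ ≤ 1 / 2 → ∀ ξ ∈ Ω, ∫ x in Ω, bubble n δ ξ x ^ s ≤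
      K * (δ ^ ((n : ℝ) - p) / n + δ ^ p * ∫ y in δ..R, y ^ ((n : ℝ) - 1 - 2 * p)) := by
    intro δ hδ hδ' ξ hξ
    have hsub : Ω ⊆ Metric.ball ξ R := fun x hx => by
      have := Metric.dist_le_diam_of_mem hΩb hx hξ
      rw [Metric.mem_ball]
      linarith
    simp_rw [bubble_rpow hn hδ, integral_const_mul, hK_def, mul_assoc]
    refine mul_le_mul_of_nonneg_left ?_ (by positivity)
    rw [← mul_assoc]
    refine (setIntegral_profile_le_radial (by omega) hp hδ (by linarith) hsub).trans ?_
    exact mul_le_mul_of_nonneg_left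
      (radial_profile_integral_le (by omega) hp hδ (by linarith)) (by positivity)
  have hint : ∀ δ : ℝ, 0 < δ → δ ≤ 1 / 2 → 2 * p ≠ n →
      ∫ y in δ..R, y ^ ((n : ℝ) - 1 - 2 * p) =
        (R ^ ((n : ℝ) - 2 * p) - δ ^ ((n : ℝ) - 2 * p)) / ((n : ℝ) - 2 * p) := by
    intro δ hδ hδ' hne
    rw [integral_rpow (Or.inr ⟨fun h => hne (by linarith), ?_⟩)]
    · ring_nf
    · rw [Set.uIcc_of_le (by linarith)]
      exact fun h => absurd h.1 (by linarith)
  rcases lt_trichotomy s ((n : ℝ) / ((n : ℝ) - 2)) with h | h | h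
  · have hpn : 0 < (n : ℝ) - 2 * p := by
      rw [lt_div_iff₀ h2] at h
      rw [hp_def]
      linarith
    refine ⟨K * (1 / n + R ^ ((n : ℝ) - 2 * p) / ((n : ℝ) - 2 * p)), by positivity,
      fun δ hδ hδ' ξ hξ => ⟨fun _ => ?_, fun h' => absurd h' h.ne, fun h' => absurd h' h.not_gt⟩⟩
    refine (key δ hδ hδ' ξ hξ).trans ?_
    rw [hint δ hδ hδ' (by linarith)]
    have e1 : δ ^ ((n : ℝ) - p) ≤ δ ^ p :=
      Real.rpow_le_rpow_of_exponent_ge hδ (by linarith) (by linarith)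
    have e2 : R ^ ((n : ℝ) - 2 * p) - δ ^ ((n : ℝ) - 2 * p) ≤ R ^ ((n : ℝ) - 2 * p) :=
      sub_le_self _ (by positivity)
    calc _ ≤ K * (δ ^ p / n + δ ^ p * (R ^ ((n : ℝ) - 2 * p) / ((n : ℝ) - 2 * p))) := by gcongr
      _ = _ := by ring
  · have hpn : 2 * p = n := by
      rw [eq_div_iff h2.ne'] at h
      rw [hp_def]
      linarith
    have hlog2 : 0 < Real.log 2 := Real.log_pos (by norm_num)
    have hlogR : 0 ≤ Real.log R := Real.log_nonneg hR
    refine ⟨K * ((1 / n + Real.log R) / Real.log 2 + 1), by positivity,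
      fun δ hδ hδ' ξ hξ => ⟨fun h' => absurd h h'.ne, fun _ => ?_, fun h' => absurd h h'.ne'⟩⟩
    refine (key δ hδ hδ' ξ hξ).trans ?_
    have hlogδ : Real.log δ ≤ -Real.log 2 := by
      rw [← Real.log_inv]
      exact Real.log_le_log hδ (by linarith)
    have hpow : ∀ y : ℝ, y ^ ((n : ℝ) - 1 - 2 * p) = y⁻¹ := fun y => by
      rw [hpn, show (n : ℝ) - 1 - n = -1 by ring, Real.rpow_neg_one]
    simp_rw [hpow]
    rw [integral_inv_of_pos hδ (by linarith), Real.log_div (by linarith) hδ.ne',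
      abs_of_neg (by linarith), show (n : ℝ) - p = n / 2 by linarith,
      show p = (n : ℝ) / 2 by linarith]
    have e : 1 / n + Real.log R ≤ (1 / n + Real.log R) / Real.log 2 * -Real.log δ := by
      rw [div_mul_eq_mul_div, le_div_iff₀ hlog2]
      gcongr
      linarith
    calc _ = K * δ ^ ((n : ℝ) / 2) * ((1 / n + Real.log R) + -Real.log δ) := by ring
      _ ≤ K * δ ^ ((n : ℝ) / 2) *
          ((1 / n + Real.log R) / Real.log 2 * -Real.log δ + -Real.log δ) := by gcongr
      _ = _ := by ring
  · have hpn : 0 < 2 * p - n := by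
      rw [div_lt_iff₀ h2] at h
      rw [hp_def]
      linarith
    refine ⟨K * (1 / n + 1 / (2 * p - n)), by positivity,
      fun δ hδ hδ' ξ hξ => ⟨fun h' => absurd h' h.not_gt, fun h' => absurd h' h.ne', fun _ => ?_⟩⟩
    refine (key δ hδ hδ' ξ hξ).trans ?_
    rw [hint δ hδ hδ' (by linarith), ← neg_div_neg_eq (R ^ _ - _), neg_sub, neg_sub]
    have e1 : δ ^ p * δ ^ ((n : ℝ) - 2 * p) = δ ^ ((n : ℝ) - p) := by
      rw [← Real.rpow_add hδ]
      ring_nf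
    have e2 : δ ^ ((n : ℝ) - 2 * p) - R ^ ((n : ℝ) - 2 * p) ≤ δ ^ ((n : ℝ) - 2 * p) :=
      sub_le_self _ (by positivity)
    calc _ ≤ K * (δ ^ ((n : ℝ) - p) / n +
          δ ^ p * (δ ^ ((n : ℝ) - 2 * p) / (2 * p - n))) := by gcongr
      _ = _ := by rw [← mul_div_assoc, e1]; ring
end

section
/- Let n ≥ 3 be an integer, let s, t ≥ 0 be reals with s + t = 2n/(n−2), and let τ > 0. Then there are constants C > 0 and ε₀ > 0, depending only on n, s, t, τ, such that for all δ_i, δ_j > 0 and ξ_i, ξ_j ∈ ℝⁿ with q_{ij} ≤ ε₀ the following hold: if |s − t| ≥ τ then ∫_{ℝⁿ} U_{δ_i,ξ_i}(x)^s U_{δ_j,ξ_j}(x)^t dx ≤ C q_{ij}^{min(s,t)}, and if s = t then ∫_{ℝⁿ} U_{δ_i,ξ_i}(x)^s U_{δ_j,ξ_j}(x)^t dx ≤ C q_{ij}^{n/(n−2)} |log q_{ij}|. -/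
open MeasureTheory

/-- The interaction quantity `q_{ij}` of two bubbles. -/
noncomputable def bubbleQ (n : ℕ) (δi δj : ℝ) (ξi ξj : EuclideanSpace ℝ (Fin n)) : ℝ :=
  (δi / δj + δj / δi + ‖ξi - ξj‖ ^ 2 / (δi * δj)) ^ (-(((n : ℝ) - 2) / 2))

/-- The area of the unit sphere in `ℝⁿ`, written as `n` times the volume of the unit ball. -/
noncomputable def sphereArea (n : ℕ) : ℝ :=
  n * (volume : Measure (EuclideanSpace ℝ (Fin n))).real (Metric.ball 0 1)

lemma sphereArea_nonneg (n : ℕ) : 0 ≤ sphereArea n := by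
  unfold sphereArea
  positivity

/-- A function of the distance to `ξ` is integrated in polar coordinates. -/
lemma integrable_and_integral_radial {n : ℕ} (hn : 1 ≤ n) (ξ : EuclideanSpace ℝ (Fin n))
    {f g : ℝ → ℝ} (hg : IntegrableOn g (Set.Ioi 0))
    (hfg : ∀ r : ℝ, 0 < r → r ^ (n - 1) * f r = g r) :
    Integrable (fun x : EuclideanSpace ℝ (Fin n) => f ‖x - ξ‖) ∧
      ∫ x : EuclideanSpace ℝ (Fin n), f ‖x - ξ‖ = sphereArea n * ∫ r in Set.Ioi 0, g r := by
  have : Nonempty (Fin n) := ⟨⟨0, hn⟩⟩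
  constructor
  · refine Integrable.comp_sub_right (f := fun x : EuclideanSpace ℝ (Fin n) => f ‖x‖) ?_ ξ
    rw [integrable_fun_norm_addHaar]
    refine hg.congr_fun (fun r hr => ?_) measurableSet_Ioi
    simp only [finrank_euclideanSpace, Fintype.card_fin, smul_eq_mul]
    exact (hfg r hr).symm
  · rw [integral_sub_right_eq_self (fun x : EuclideanSpace ℝ (Fin n) => f ‖x‖) ξ,
      integral_fun_norm_addHaar]
    simp only [finrank_euclideanSpace, Fintype.card_fin, smul_eq_mul, nsmul_eq_mul]
    rw [setIntegral_congr_fun measurableSet_Ioi (g := g) fun r hr => hfg r hr, sphereArea,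
      mul_assoc]

lemma natPow_mul_rpow {n : ℕ} (hn : 1 ≤ n) (p : ℝ) {r : ℝ} (hr : 0 < r) :
    r ^ (n - 1) * r ^ p = r ^ ((n : ℝ) + p - 1) := by
  rw [← Real.rpow_natCast, ← Real.rpow_add hr]
  push_cast [Nat.cast_sub hn]
  ring_nf

lemma integrable_and_integral_rpow_inside {n : ℕ} (hn : 1 ≤ n) (ξ : EuclideanSpace ℝ (Fin n))
    {p R : ℝ} (hp : 0 < n + p) (hR : 0 < R) :
    Integrable (fun x => (Set.Iic R).indicator (fun r : ℝ => r ^ p) ‖x - ξ‖) ∧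
      ∫ x, (Set.Iic R).indicator (fun r : ℝ => r ^ p) ‖x - ξ‖
        = sphereArea n * (R ^ (n + p) / (n + p)) := by
  have hint : IntegrableOn (fun r : ℝ => r ^ ((n : ℝ) + p - 1)) (Set.Ioc 0 R) := by
    rw [← intervalIntegrable_iff_integrableOn_Ioc_of_le hR.le]
    exact intervalIntegral.intervalIntegrable_rpow' (by linarith)
  have hset : Set.Ioi (0 : ℝ) ∩ Set.Iic R = Set.Ioc 0 R := Set.Ioi_inter_Iic
  have key := integrable_and_integral_radial hn ξ
    (f := (Set.Iic R).indicator fun r : ℝ => r ^ p)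
    (g := (Set.Iic R).indicator fun r : ℝ => r ^ ((n : ℝ) + p - 1))
    (by
      rw [IntegrableOn, integrable_indicator_iff measurableSet_Iic, IntegrableOn,
        Measure.restrict_restrict measurableSet_Iic, Set.inter_comm, hset]
      exact hint)
    (fun r hr => by
      by_cases h : r ≤ R <;> simp [h, natPow_mul_rpow hn p hr])
  refine ⟨key.1, key.2.trans ?_⟩
  rw [setIntegral_indicator measurableSet_Iic, hset, ← intervalIntegral.integral_of_le hR.le,
    integral_rpow (Or.inl (by linarith)), sub_add_cancel, Real.zero_rpow hp.ne', sub_zero]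

lemma integrable_and_integral_rpow_outside {n : ℕ} (hn : 1 ≤ n) (ξ : EuclideanSpace ℝ (Fin n))
    {p R : ℝ} (hp : n + p < 0) (hR : 0 < R) :
    Integrable (fun x => (Set.Ioi R).indicator (fun r : ℝ => r ^ p) ‖x - ξ‖) ∧
      ∫ x, (Set.Ioi R).indicator (fun r : ℝ => r ^ p) ‖x - ξ‖
        = sphereArea n * (-R ^ (n + p) / (n + p)) := by
  have hset : Set.Ioi (0 : ℝ) ∩ Set.Ioi R = Set.Ioi R := by
    rw [Set.Ioi_inter_Ioi, sup_eq_right.2 hR.le]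
  have key := integrable_and_integral_radial hn ξ
    (f := (Set.Ioi R).indicator fun r : ℝ => r ^ p)
    (g := (Set.Ioi R).indicator fun r : ℝ => r ^ ((n : ℝ) + p - 1))
    (by
      rw [IntegrableOn, integrable_indicator_iff measurableSet_Ioi, IntegrableOn,
        Measure.restrict_restrict measurableSet_Ioi, Set.inter_comm, hset]
      exact integrableOn_Ioi_rpow_of_lt (by linarith) hR)
    (fun r hr => by
      by_cases h : R < r <;> simp [h, natPow_mul_rpow hn p hr])
  refine ⟨key.1, key.2.trans ?_⟩
  rw [setIntegral_indicator measurableSet_Ioi, hset, integral_Ioi_rpow_of_lt (by linarith) hR,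
    sub_add_cancel]

lemma rpow_neg_two_mul (γ : ℝ) {a : ℝ} (ha : 0 < a) :
    a ^ (-(2 * γ)) = (a ^ 2) ^ (-γ) := by
  rw [← Real.rpow_natCast, ← Real.rpow_mul ha.le]
  congr 1
  push_cast
  ring

/-- `(μ² + r²)^(-β)` is at most `μ^(-2β)` for `r ≤ μ` and at most `r^(-2β)` for `r > μ`. -/
lemma sq_add_sq_rpow_neg_le {μ r β : ℝ} (hμ : 0 < μ) (hβ : 0 ≤ β) :
    (μ ^ 2 + r ^ 2) ^ (-β) ≤
      μ ^ (-(2 * β)) * (Set.Iic μ).indicator (fun r : ℝ => r ^ (0 : ℝ)) r +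
        (Set.Ioi μ).indicator (fun r : ℝ => r ^ (-(2 * β))) r := by
  rcases le_or_gt r μ with h | h
  · simp only [Set.indicator, Set.mem_Iic, Set.mem_Ioi, h, h.not_gt, if_true, if_false,
      Real.rpow_zero, mul_one, add_zero]
    rw [rpow_neg_two_mul β hμ]
    exact Real.rpow_le_rpow_of_nonpos (by positivity) (by nlinarith [sq_nonneg r]) (by linarith)
  · have hr : 0 < r := hμ.trans h
    simp only [Set.indicator, Set.mem_Iic, Set.mem_Ioi, h, h.not_ge, if_true, if_false,
      mul_zero, zero_add]
    rw [rpow_neg_two_mul β hr]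
    exact Real.rpow_le_rpow_of_nonpos (by positivity) (by nlinarith [sq_nonneg μ]) (by linarith)

/-- Near the centre of one profile the other one is small: the product of the two decay factors
is dominated by the sum of two radial functions. -/
lemma mul_rpow_neg_le {E : Type*} [NormedAddCommGroup E] {α β L M R : ℝ} (x ξ η : E)
    (hL : 0 < L) (hM : 0 < M) (hR : 0 < R) (hα : 0 ≤ α) (hβ : 0 ≤ β)
    (hRdef : R ^ 2 = L ^ 2 + M ^ 2 + ‖ξ - η‖ ^ 2) (hx : x ≠ ξ) :
    (L ^ 2 + ‖x - ξ‖ ^ 2) ^ (-α) * (M ^ 2 + ‖x - η‖ ^ 2) ^ (-β) ≤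
      4 ^ α * R ^ (-(2 * α)) * (M ^ 2 + ‖x - η‖ ^ 2) ^ (-β) +
      4 ^ β * R ^ (-(2 * β)) *
        (Set.Iic R).indicator (fun r : ℝ => r ^ (-(2 * α))) ‖x - ξ‖ := by
  have hquarter : ∀ γ : ℝ, (4 : ℝ) ^ γ * R ^ (-(2 * γ)) = (R ^ 2 / 4) ^ (-γ) := fun γ => by
    rw [rpow_neg_two_mul γ hR, Real.div_rpow (by positivity) (by norm_num), Real.rpow_neg (x := 4)
      (by norm_num)]
    field_simp
  have hxn : 0 < ‖x - ξ‖ := norm_pos_iff.2 (sub_ne_zero.2 hx)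
  have hM' : 0 < M ^ 2 + ‖x - η‖ ^ 2 := by positivity
  have hL' : 0 < L ^ 2 + ‖x - ξ‖ ^ 2 := by positivity
  rw [hquarter, hquarter]
  rcases le_or_gt (R ^ 2 / 4) (L ^ 2 + ‖x - ξ‖ ^ 2) with h | h
  · have h1 : (L ^ 2 + ‖x - ξ‖ ^ 2) ^ (-α) ≤ (R ^ 2 / 4) ^ (-α) :=
      Real.rpow_le_rpow_of_nonpos (by positivity) h (by linarith)
    have h2 : 0 ≤ (Set.Iic R).indicator (fun r : ℝ => r ^ (-(2 * α))) ‖x - ξ‖ :=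
      Set.indicator_apply_nonneg fun _ => by positivity
    have h3 := mul_le_mul_of_nonneg_right h1 (Real.rpow_nonneg hM'.le (-β))
    have h4 : 0 ≤ (R ^ 2 / 4) ^ (-β) := by positivity
    linarith [mul_nonneg h4 h2]
  · have hmem : ‖x - ξ‖ ≤ R := by
      by_contra! h'
      nlinarith [sq_nonneg L]
    have htri : ‖ξ - η‖ ≤ ‖x - ξ‖ + ‖x - η‖ := by
      rw [norm_sub_rev x ξ]
      exact norm_sub_le_norm_sub_add_norm_sub ξ x η
    have hfar : R ^ 2 / 4 ≤ M ^ 2 + ‖x - η‖ ^ 2 := by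
      have : ‖ξ - η‖ ^ 2 ≤ 2 * ‖x - ξ‖ ^ 2 + 2 * ‖x - η‖ ^ 2 := by
        nlinarith [sq_nonneg (‖x - ξ‖ - ‖x - η‖), norm_nonneg (ξ - η)]
      nlinarith [sq_nonneg L, sq_nonneg M]
    have h1 : (M ^ 2 + ‖x - η‖ ^ 2) ^ (-β) ≤ (R ^ 2 / 4) ^ (-β) :=
      Real.rpow_le_rpow_of_nonpos (by positivity) hfar (by linarith)
    have h2 : (L ^ 2 + ‖x - ξ‖ ^ 2) ^ (-α) ≤ ‖x - ξ‖ ^ (-(2 * α)) := by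
      rw [rpow_neg_two_mul α hxn]
      exact Real.rpow_le_rpow_of_nonpos (by positivity) (by nlinarith [sq_nonneg L]) (by linarith)
    rw [Set.indicator_of_mem (Set.mem_Iic.2 hmem)]
    have h3 := mul_le_mul h2 h1 (by positivity) (by positivity)
    have h4 : 0 ≤ (R ^ 2 / 4) ^ (-α) * (M ^ 2 + ‖x - η‖ ^ 2) ^ (-β) := by positivity
    linarith [mul_comm (‖x - ξ‖ ^ (-(2 * α))) ((R ^ 2 / 4) ^ (-β))]

/-- The constant in the interaction estimate with exponents `n/2 ∓ ε` is
`interactionConst n / ε`. -/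
noncomputable def interactionConst (n : ℕ) : ℝ := 2 * 4 ^ n * sphereArea n

/-- The interaction of two profiles with exponents `n/2 - ε` and `n/2 + ε` has an integrable
majorant, whose integral blows up at most like `1/ε`. -/
lemma exists_integrable_majorant {n : ℕ} (hn : 1 ≤ n) {ε L M : ℝ} (hε : 0 < ε)
    (hεn : ε ≤ n / 2) (hL : 0 < L) (hM : 0 < M) (ξ η : EuclideanSpace ℝ (Fin n)) :
    ∃ g : EuclideanSpace ℝ (Fin n) → ℝ, Integrable g ∧
      (∀ᵐ x, (L / (L ^ 2 + ‖x - ξ‖ ^ 2)) ^ ((n : ℝ) / 2 - ε) *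
        (M / (M ^ 2 + ‖x - η‖ ^ 2)) ^ ((n : ℝ) / 2 + ε) ≤ g x) ∧
      ∫ x, g x ≤ interactionConst n / ε *
        (L / M + M / L + ‖ξ - η‖ ^ 2 / (L * M)) ^ (-((n : ℝ) / 2 - ε)) := by
  have : Nonempty (Fin n) := ⟨⟨0, hn⟩⟩
  have hn0 : (1 : ℝ) ≤ n := by exact_mod_cast hn
  obtain ⟨α, hα⟩ : ∃ α, α = (n : ℝ) / 2 - ε := ⟨_, rfl⟩
  obtain ⟨β, hβ⟩ : ∃ β, β = (n : ℝ) / 2 + ε := ⟨_, rfl⟩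
  rw [← hα, ← hβ]
  have hα0 : 0 ≤ α := by linarith
  have hβ0 : 0 ≤ β := by linarith
  obtain ⟨R, hR, hRdef⟩ : ∃ R : ℝ, 0 < R ∧ R ^ 2 = L ^ 2 + M ^ 2 + ‖ξ - η‖ ^ 2 :=
    ⟨√(L ^ 2 + M ^ 2 + ‖ξ - η‖ ^ 2), by positivity, Real.sq_sqrt (by positivity)⟩
  have hMR : M ≤ R := by
    by_contra! h
    nlinarith [sq_nonneg L, sq_nonneg ‖ξ - η‖]
  obtain ⟨hi1, he1⟩ := integrable_and_integral_rpow_inside hn η (p := 0) (R := M)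
    (by linarith) hM
  obtain ⟨hi2, he2⟩ := integrable_and_integral_rpow_outside hn η (p := -(2 * β)) (R := M)
    (by linarith) hM
  obtain ⟨hi3, he3⟩ := integrable_and_integral_rpow_inside hn ξ (p := -(2 * α)) (R := R)
    (by linarith) hR
  refine ⟨fun x => L ^ α * M ^ β * (4 ^ α * R ^ (-(2 * α)) *
      (M ^ (-(2 * β)) * (Set.Iic M).indicator (fun r : ℝ => r ^ (0 : ℝ)) ‖x - η‖ +
        (Set.Ioi M).indicator (fun r : ℝ => r ^ (-(2 * β))) ‖x - η‖) +
      4 ^ β * R ^ (-(2 * β)) *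
        (Set.Iic R).indicator (fun r : ℝ => r ^ (-(2 * α))) ‖x - ξ‖), ?_, ?_, ?_⟩
  · exact ((((hi1.const_mul _).add hi2).const_mul _).add (hi3.const_mul _)).const_mul _
  · filter_upwards [Measure.ae_ne volume ξ] with x hx
    rw [Real.div_rpow hL.le (by positivity), Real.div_rpow hM.le (by positivity),
      div_eq_mul_inv, div_eq_mul_inv, ← Real.rpow_neg (by positivity),
      ← Real.rpow_neg (by positivity), mul_mul_mul_comm]
    refine mul_le_mul_of_nonneg_left ?_ (by positivity)
    refine (mul_rpow_neg_le x ξ η hL hM hR hα0 hβ0 hRdef hx).trans ?_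
    gcongr
    exact sq_add_sq_rpow_neg_le hM hβ0
  · rw [integral_const_mul, integral_add, integral_const_mul, integral_add, integral_const_mul,
      integral_const_mul, he1, he2, he3]
    rotate_left
    · exact hi1.const_mul _
    · exact hi2
    · exact ((hi1.const_mul _).add hi2).const_mul _
    · exact hi3.const_mul _
    have hA := sphereArea_nonneg n
    have hQ : (L / M + M / L + ‖ξ - η‖ ^ 2 / (L * M)) ^ (-α) =
        L ^ α * M ^ α * R ^ (-(2 * α)) := by
      have : L / M + M / L + ‖ξ - η‖ ^ 2 / (L * M) = R ^ 2 / (L * M) := by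
        rw [hRdef]
        field_simp
      rw [this, Real.div_rpow (by positivity) (by positivity), Real.rpow_neg (x := L * M)
        (by positivity), Real.mul_rpow hL.le hM.le, ← Real.rpow_natCast,
        ← Real.rpow_mul hR.le, div_inv_eq_mul, mul_comm]
      congr 2
      push_cast
      ring
    rw [hQ]
    have h4 : ∀ γ : ℝ, γ ≤ n → (4 : ℝ) ^ γ ≤ 4 ^ n := fun γ hγ => by
      rw [← Real.rpow_natCast]
      exact Real.rpow_le_rpow_of_exponent_le (by norm_num) hγ
    have hM1 : M ^ β * (M ^ (-(2 * β)) * M ^ ((n : ℝ) + 0)) = M ^ α := by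
      rw [← Real.rpow_add hM, ← Real.rpow_add hM]
      congr 1
      linarith
    have hM2 : M ^ β * M ^ ((n : ℝ) + -(2 * β)) = M ^ α := by
      rw [← Real.rpow_add hM]
      congr 1
      linarith
    have hMR' : M ^ β * (R ^ (-(2 * β)) * R ^ ((n : ℝ) + -(2 * α))) ≤
        M ^ α * R ^ (-(2 * α)) := by
      have e1 : M ^ β = M ^ α * M ^ (2 * ε) := by
        rw [← Real.rpow_add hM]
        congr 1
        linarith
      have e2 : R ^ (-(2 * β)) * R ^ ((n : ℝ) + -(2 * α)) = R ^ (-(2 * α)) * R ^ (-(2 * ε)) := by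
        rw [← Real.rpow_add hR, ← Real.rpow_add hR]
        congr 1
        linarith
      have e3 : M ^ (2 * ε) * R ^ (-(2 * ε)) ≤ 1 := by
        rw [Real.rpow_neg hR.le, ← div_eq_mul_inv]
        exact div_le_one_of_le₀ (Real.rpow_le_rpow hM.le hMR (by linarith)) (by positivity)
      rw [e1, e2, mul_mul_mul_comm]
      exact mul_le_of_le_one_right (by positivity) e3
    have c1 : (1 : ℝ) / n ≤ 1 / (2 * ε) := by
      apply one_div_le_one_div_of_le <;> linarith
    have d2 : (n : ℝ) + -(2 * β) = -(2 * ε) := by linarith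
    have d3 : (n : ℝ) + -(2 * α) = 2 * ε := by linarith
    calc _ = L ^ α * sphereArea n * (4 ^ α * R ^ (-(2 * α)) *
          ((M ^ β * (M ^ (-(2 * β)) * M ^ ((n : ℝ) + 0))) * (1 / n) +
            (M ^ β * M ^ ((n : ℝ) + -(2 * β))) * (1 / (2 * ε))) +
          4 ^ β * (M ^ β * (R ^ (-(2 * β)) * R ^ ((n : ℝ) + -(2 * α)))) * (1 / (2 * ε))) := by
          rw [d2, d3, add_zero, neg_div_neg_eq]
          ring
      _ ≤ L ^ α * sphereArea n * (4 ^ n * R ^ (-(2 * α)) *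
          (M ^ α * (1 / (2 * ε)) + M ^ α * (1 / (2 * ε))) +
          4 ^ n * (M ^ α * R ^ (-(2 * α))) * (1 / (2 * ε))) := by
          rw [hM1, hM2]
          gcongr
          · exact h4 α (by linarith)
          · exact h4 β (by linarith)
      _ = (3 / 4) * (interactionConst n / ε * (L ^ α * M ^ α * R ^ (-(2 * α)))) := by
          unfold interactionConst
          field_simp
          ring
      _ ≤ _ := by
          have : 0 ≤ interactionConst n / ε * (L ^ α * M ^ α * R ^ (-(2 * α))) := by
            unfold interactionConst
            positivity
          linarith

lemma interactionConst_nonneg (n : ℕ) : 0 ≤ interactionConst n := by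
  have := sphereArea_nonneg n
  unfold interactionConst
  positivity

lemma integral_mul_rpow_le {n : ℕ} (hn : 1 ≤ n) {ε L M : ℝ} (hε : 0 < ε)
    (hεn : ε ≤ n / 2) (hL : 0 < L) (hM : 0 < M) (ξ η : EuclideanSpace ℝ (Fin n)) :
    ∫ x, (L / (L ^ 2 + ‖x - ξ‖ ^ 2)) ^ ((n : ℝ) / 2 - ε) *
        (M / (M ^ 2 + ‖x - η‖ ^ 2)) ^ ((n : ℝ) / 2 + ε) ≤
      interactionConst n / ε *
        (L / M + M / L + ‖ξ - η‖ ^ 2 / (L * M)) ^ (-((n : ℝ) / 2 - ε)) := by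
  obtain ⟨g, hg, hle, hint⟩ := exists_integrable_majorant hn hε hεn hL hM ξ η
  exact (integral_mono_of_nonneg (.of_forall fun x => by positivity) hg hle).trans hint

lemma interaction_ratio_symm {E : Type*} [NormedAddCommGroup E] (L M : ℝ) (ξ η : E) :
    M / L + L / M + ‖η - ξ‖ ^ 2 / (M * L) = L / M + M / L + ‖ξ - η‖ ^ 2 / (L * M) := by
  rw [norm_sub_rev η ξ, mul_comm M L, add_comm (M / L)]

lemma rpow_mul_rpow_le_half_add {a b : ℝ} (ha : 0 < a) (hb : 0 < b) (p ε : ℝ) :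
    a ^ p * b ^ p ≤ (1 / 2) * (a ^ (p - ε) * b ^ (p + ε) + b ^ (p - ε) * a ^ (p + ε)) := by
  have h : (a ^ (p - ε) * b ^ (p + ε)) * (b ^ (p - ε) * a ^ (p + ε)) = (a ^ p * b ^ p) ^ 2 := by
    simp only [Real.rpow_sub ha, Real.rpow_sub hb, Real.rpow_add ha, Real.rpow_add hb]
    field_simp
  have h1 : 0 < a ^ (p - ε) * b ^ (p + ε) := by positivity
  have h2 : 0 < b ^ (p - ε) * a ^ (p + ε) := by positivity
  have h3 : 0 < a ^ p * b ^ p := by positivity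
  nlinarith [sq_nonneg (a ^ (p - ε) * b ^ (p + ε) - b ^ (p - ε) * a ^ (p + ε))]

/-- The borderline case of equal exponents, obtained by averaging the estimates with exponents
`n/2 ∓ ε` at `ε = 1 / log Q`. -/
lemma integral_mul_rpow_half_le {n : ℕ} (hn : 2 ≤ n) {L M Q : ℝ}
    (hL : 0 < L) (hM : 0 < M) (ξ η : EuclideanSpace ℝ (Fin n))
    (hQ : Q = L / M + M / L + ‖ξ - η‖ ^ 2 / (L * M)) (hlog : 1 ≤ Real.log Q) :
    ∫ x, (L / (L ^ 2 + ‖x - ξ‖ ^ 2)) ^ ((n : ℝ) / 2) *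
        (M / (M ^ 2 + ‖x - η‖ ^ 2)) ^ ((n : ℝ) / 2) ≤
      interactionConst n * Real.exp 1 * (Q ^ (-((n : ℝ) / 2)) * Real.log Q) := by
  have hQ0 : 0 < Q := by rw [hQ]; positivity
  have hn2 : (2 : ℝ) ≤ n := by exact_mod_cast hn
  have hlog0 : 0 < Real.log Q := by linarith
  obtain ⟨ε, hε⟩ : ∃ ε, ε = 1 / Real.log Q := ⟨_, rfl⟩
  have hε0 : 0 < ε := by rw [hε]; positivity
  have hε1 : ε ≤ n / 2 := by
    have : ε ≤ 1 := by rw [hε]; exact div_le_one_of_le₀ hlog hlog0.le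
    linarith
  obtain ⟨g, hg, hgle, hgint⟩ := exists_integrable_majorant (by omega) hε0 hε1 hL hM ξ η
  obtain ⟨h, hh, hhle, hhint⟩ := exists_integrable_majorant (by omega) hε0 hε1 hM hL η ξ
  rw [← hQ] at hgint
  rw [interaction_ratio_symm L M ξ η, ← hQ] at hhint
  have hpow : Q ^ (-((n : ℝ) / 2 - ε)) = Q ^ (-((n : ℝ) / 2)) * Real.exp 1 := by
    rw [neg_sub, sub_eq_neg_add, Real.rpow_add hQ0]
    congr 1
    rw [Real.rpow_def_of_pos hQ0, hε, mul_one_div_cancel hlog0.ne']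
  have hdiv : interactionConst n / ε = interactionConst n * Real.log Q := by
    rw [hε, div_div_eq_mul_div, div_one]
  rw [hpow, hdiv] at hgint hhint
  calc _ ≤ ∫ x, (1 / 2) * (g x + h x) := by
        refine integral_mono_of_nonneg (.of_forall fun x => by positivity)
          ((hg.add hh).const_mul _) ?_
        filter_upwards [hgle, hhle] with x hx1 hx2
        have := rpow_mul_rpow_le_half_add (a := L / (L ^ 2 + ‖x - ξ‖ ^ 2))
          (b := M / (M ^ 2 + ‖x - η‖ ^ 2)) (by positivity) (by positivity) (n / 2) ε
        linarith
    _ = (1 / 2) * ((∫ x, g x) + ∫ x, h x) := by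
        rw [integral_const_mul, integral_add hg hh]
    _ ≤ _ := by linarith

lemma integral_bubble_mul_bubble {n : ℕ} (hn : 2 ≤ n) {L M : ℝ} (hL : 0 < L) (hM : 0 < M)
    (ξ η : EuclideanSpace ℝ (Fin n)) (s t : ℝ) :
    ∫ x, bubble n L ξ x ^ s * bubble n M η x ^ t =
      (((n : ℝ) * ((n : ℝ) - 2)) ^ (((n : ℝ) - 2) / 4)) ^ s *
        (((n : ℝ) * ((n : ℝ) - 2)) ^ (((n : ℝ) - 2) / 4)) ^ t *
        ∫ x, (L / (L ^ 2 + ‖x - ξ‖ ^ 2)) ^ (((n : ℝ) - 2) / 2 * s) *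
          (M / (M ^ 2 + ‖x - η‖ ^ 2)) ^ (((n : ℝ) - 2) / 2 * t) := by
  have hn2 : (0 : ℝ) ≤ n - 2 := sub_nonneg.2 (by exact_mod_cast hn)
  rw [← integral_const_mul]
  congr 1
  ext x
  have h1 : 0 < L / (L ^ 2 + ‖x - ξ‖ ^ 2) := by positivity
  have h2 : 0 < M / (M ^ 2 + ‖x - η‖ ^ 2) := by positivity
  have h0 : 0 ≤ ((n : ℝ) * ((n : ℝ) - 2)) ^ (((n : ℝ) - 2) / 4) := by positivity
  rw [bubble, bubble, Real.mul_rpow h0 (by positivity), Real.mul_rpow h0 (by positivity), Real.rpow_mul h1.le, Real.rpow_mul h2.le,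
    mul_mul_mul_comm]

/-- Interaction estimates between two bubbles with exponents `s + t = 2n/(n−2)`. -/
theorem bubble_interaction_estimate (n : ℕ) (hn : 3 ≤ n) (s t : ℝ) (hs : 0 ≤ s) (ht : 0 ≤ t)
    (hst : s + t = 2 * (n : ℝ) / ((n : ℝ) - 2)) (τ : ℝ) (hτ : 0 < τ) :
    ∃ C : ℝ, 0 < C ∧ ∃ ε₀ : ℝ, 0 < ε₀ ∧
      ∀ (δi δj : ℝ) (ξi ξj : EuclideanSpace ℝ (Fin n)), 0 < δi → 0 < δj →
        bubbleQ n δi δj ξi ξj ≤ ε₀ →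
        (τ ≤ |s - t| →
          ∫ x, bubble n δi ξi x ^ s * bubble n δj ξj x ^ t
            ≤ C * bubbleQ n δi δj ξi ξj ^ min s t) ∧
        (s = t →
          ∫ x, bubble n δi ξi x ^ s * bubble n δj ξj x ^ t
            ≤ C * bubbleQ n δi δj ξi ξj ^ ((n : ℝ) / ((n : ℝ) - 2)) *
                |Real.log (bubbleQ n δi δj ξi ξj)|) := by
  have hn3 : (3 : ℝ) ≤ n := by exact_mod_cast hn
  have hn2 : 2 ≤ n := by omega
  have hn1 : 1 ≤ n := by omega
  have hm0 : (0 : ℝ) < n - 2 := by linarith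
  obtain ⟨m, hm⟩ : ∃ m, m = ((n : ℝ) - 2) / 2 := ⟨_, rfl⟩
  have hmpos : 0 < m := by rw [hm]; linarith
  obtain ⟨a, ha⟩ : ∃ a, a = (((n : ℝ) * ((n : ℝ) - 2)) ^ (((n : ℝ) - 2) / 4)) ^ s *
    (((n : ℝ) * ((n : ℝ) - 2)) ^ (((n : ℝ) - 2) / 4)) ^ t := ⟨_, rfl⟩
  have ha0 : 0 < a := by rw [ha]; positivity
  have hK := interactionConst_nonneg n
  have hsum : m * s + m * t = n := by
    rw [← mul_add, hst, hm]
    field_simp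
  obtain ⟨C₁, hC₁⟩ : ∃ C₁, C₁ = a * (interactionConst n / (m * |s - t| / 2)) := ⟨_, rfl⟩
  obtain ⟨C₂, hC₂⟩ : ∃ C₂, C₂ = a * (interactionConst n * Real.exp 1) / m := ⟨_, rfl⟩
  have hC₁0 : 0 ≤ C₁ := by rw [hC₁]; positivity
  have hC₂0 : 0 ≤ C₂ := by rw [hC₂]; positivity
  refine ⟨C₁ + C₂ + 1, by positivity, Real.exp (-m), Real.exp_pos _, ?_⟩
  intro L M ξ η hL hM hq
  obtain ⟨Q, hQ⟩ : ∃ Q, Q = L / M + M / L + ‖ξ - η‖ ^ 2 / (L * M) := ⟨_, rfl⟩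
  have hQ0 : 0 < Q := by rw [hQ]; positivity
  have hqQ : bubbleQ n L M ξ η = Q ^ (-m) := by rw [bubbleQ, hQ, hm]
  have hlogq : Real.log (Q ^ (-m)) = -m * Real.log Q := Real.log_rpow hQ0 _
  rw [integral_bubble_mul_bubble hn2 hL hM, ← ha, ← hm, hqQ]
  rw [hqQ] at hq
  refine ⟨fun hτst => ?_, fun heq => ?_⟩
  · have hpow : (Q ^ (-m)) ^ min s t = Q ^ (-(m * min s t)) := by
      rw [← Real.rpow_mul hQ0.le, neg_mul]
    have hne : 0 < |s - t| := hτ.trans_le hτst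
    have key : ∫ x, (L / (L ^ 2 + ‖x - ξ‖ ^ 2)) ^ (m * s) * (M / (M ^ 2 + ‖x - η‖ ^ 2)) ^ (m * t)
        ≤ interactionConst n / (m * |s - t| / 2) * Q ^ (-(m * min s t)) := by
      have hε : 0 < m * |s - t| / 2 := by positivity
      rcases le_total s t with h | h
      · have e : |s - t| = t - s := by rw [abs_sub_comm, abs_of_nonneg (by linarith)]
        have hα : (n : ℝ) / 2 - m * |s - t| / 2 = m * s := by rw [e]; linarith
        have hβ : (n : ℝ) / 2 + m * |s - t| / 2 = m * t := by rw [e]; linarith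
        have := integral_mul_rpow_le hn1 hε (by nlinarith) hL hM ξ η
        rw [← hQ, hα, hβ] at this
        rwa [min_eq_left h]
      · have e : |s - t| = s - t := abs_of_nonneg (by linarith)
        have hα : (n : ℝ) / 2 - m * |s - t| / 2 = m * t := by rw [e]; linarith
        have hβ : (n : ℝ) / 2 + m * |s - t| / 2 = m * s := by rw [e]; linarith
        have := integral_mul_rpow_le hn1 hε (by nlinarith) hM hL η ξ
        rw [interaction_ratio_symm L M ξ η, ← hQ, hα, hβ] at this
        rw [min_eq_right h]
        simpa only [mul_comm] using this
    rw [hpow]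
    calc _ ≤ a * (interactionConst n / (m * |s - t| / 2) * Q ^ (-(m * min s t))) := by gcongr
      _ = C₁ * Q ^ (-(m * min s t)) := by rw [hC₁]; ring
      _ ≤ _ := by gcongr; linarith
  · subst heq
    have hms : m * s = n / 2 := by linarith
    have hlog : 1 ≤ Real.log Q := by
      have := Real.log_le_log (by positivity) hq
      rw [hlogq, Real.log_exp] at this
      nlinarith
    have hpow : (Q ^ (-m)) ^ ((n : ℝ) / (n - 2)) = Q ^ (-((n : ℝ) / 2)) := by
      rw [← Real.rpow_mul hQ0.le]
      congr 1
      rw [hm]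
      field_simp
    have habs : |Real.log (Q ^ (-m))| = m * Real.log Q := by
      rw [hlogq, neg_mul, abs_neg, abs_of_nonneg (by positivity)]
    rw [hms, hpow, habs]
    calc _ ≤ a * (interactionConst n * Real.exp 1 * (Q ^ (-((n : ℝ) / 2)) * Real.log Q)) := by
          gcongr
          exact integral_mul_rpow_half_le hn2 hL hM ξ η hQ hlog
      _ = C₂ * Q ^ (-((n : ℝ) / 2)) * (m * Real.log Q) := by rw [hC₂]; field_simp
      _ ≤ _ := by gcongr; linarith
end

section
/- Let n ≥ 3 be an integer, α > 0 a real number, and Ω ⊂ ℝⁿ a bounded open set. Then there exists a constant C = C(n, α, Ω) > 0 such that for every δ ∈ (0, 1], every ξ ∈ Ω and every x ∈ ℝⁿ (with x ≠ ξ in the case α = 2), the integral ∫_Ω |x−z|^{−(n−2)} (δ/(δ² + |z−ξ|²))^{α/2} dz is bounded by: C δ^{α/2} if 0 < α < 2; C δ (1 + |log |x−ξ||) if α = 2; C δ^{α/2} (δ² + |x−ξ|²)^{−(α−2)/2} if 2 < α < n; C δ^{n/2} (δ² + |x−ξ|²)^{−(n−2)/2} log(2 + |x−ξ| δ^{−1})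 if α = n; and C δ^{n−α/2} (δ² + |x−ξ|²)^{−(n−2)/2} if α > n. -/
open MeasureTheory

lemma lintegral_ofReal_deriv_le {f f' : ℝ → ℝ} {a b M : ℝ}
    (hf : ContinuousOn f (Set.Icc a b)) (hd : ∀ t ∈ Set.Ioo a b, HasDerivAt f (f' t) t)
    (hpos : ∀ t ∈ Set.Ioo a b, 0 ≤ f' t) (h : a ≤ b → f b - f a ≤ M) :
    ∫⁻ t in Set.Ioc a b, ENNReal.ofReal (f' t) ≤ ENNReal.ofReal M := by
  rcases lt_or_ge b a with hab | hab
  · simp [Set.Ioc_eq_empty_of_le hab.le]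
  have hint : IntegrableOn f' (Set.Ioc a b) :=
    intervalIntegral.integrableOn_deriv_of_nonneg hf hd hpos
  have hnn : 0 ≤ᵐ[volume.restrict (Set.Ioc a b)] f' := by
    rw [← restrict_Ioo_eq_restrict_Ioc]
    exact (ae_restrict_iff' measurableSet_Ioo).2 (Filter.Eventually.of_forall hpos)
  rw [← ofReal_integral_eq_lintegral_ofReal hint hnn, ← intervalIntegral.integral_of_le hab,
    intervalIntegral.integral_eq_sub_of_hasDerivAt_of_le hab hf hd
      ((intervalIntegrable_iff_integrableOn_Ioc_of_le hab).2 hint)]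
  exact ENNReal.ofReal_le_ofReal (h hab)

lemma lintegral_ball_mul_radial_le {n : ℕ} (hn : 0 < n) (ξ : EuclideanSpace ℝ (Fin n)) (R : ℝ)
    {W : EuclideanSpace ℝ (Fin n) → ENNReal} (hW : Measurable W) {g : ℝ → ℝ} {K : ℝ} (hK : 0 ≤ K)
    (hgm : Measurable g) (hg0 : ∀ s, 0 < s → 0 ≤ g s) (hg : AntitoneOn g (Set.Ioi 0))
    (hg2 : ∀ s, 0 < s → g s ≤ K * g (2 * s)) :
    ∫⁻ z in Metric.ball ξ R, W z * ENNReal.ofReal (g ‖z - ξ‖) ≤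
      ENNReal.ofReal (2 * K) * ∫⁻ t in Set.Ioc 0 (2 * R), ENNReal.ofReal (g t / t) *
        ∫⁻ z in Metric.closedBall ξ t, W z := by
  have : Nonempty (Fin n) := ⟨⟨0, hn⟩⟩
  have key : ∀ s, 0 < s → ENNReal.ofReal (g s) ≤
      ENNReal.ofReal (2 * K) * ∫⁻ t in Set.Ioc s (2 * s), ENNReal.ofReal (g t / t) := by
    intro s hs
    have h1 : ENNReal.ofReal (g (2 * s) / (2 * s)) * volume (Set.Ioc s (2 * s)) ≤
        ∫⁻ t in Set.Ioc s (2 * s), ENNReal.ofReal (g t / t) := by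
      rw [← setLIntegral_const]
      refine setLIntegral_mono' measurableSet_Ioc fun t ht => ENNReal.ofReal_le_ofReal ?_
      have ht0 : 0 < t := hs.trans ht.1
      have := hg (Set.mem_Ioi.2 ht0) (Set.mem_Ioi.2 (by positivity : 0 < 2 * s)) ht.2
      exact div_le_div₀ (hg0 t ht0) this ht0 ht.2
    calc ENNReal.ofReal (g s) ≤ ENNReal.ofReal (2 * K) *
          (ENNReal.ofReal (g (2 * s) / (2 * s)) * volume (Set.Ioc s (2 * s))) := by
          rw [Real.volume_Ioc, ← ENNReal.ofReal_mul (div_nonneg (hg0 _ (by positivity))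
            (by positivity)), ← ENNReal.ofReal_mul (by positivity)]
          refine ENNReal.ofReal_le_ofReal ((hg2 s hs).trans_eq ?_)
          field_simp
          ring
      _ ≤ _ := by gcongr
  set H : ℝ → ENNReal := (Set.Ioc 0 (2 * R)).indicator fun t => ENNReal.ofReal (g t / t) with hH
  have hHm : Measurable H :=
    ((hgm.div measurable_id).ennreal_ofReal).indicator measurableSet_Ioc
  have hae : ∀ᵐ z ∂(volume.restrict (Metric.ball ξ R)), W z * ENNReal.ofReal (g ‖z - ξ‖) ≤
      ENNReal.ofReal (2 * K) * ∫⁻ t, (Metric.closedBall ξ t).indicator W z * H t := by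
    rw [ae_restrict_iff' measurableSet_ball]
    have hne : ∀ᵐ z ∂(volume : Measure (EuclideanSpace ℝ (Fin n))), z ≠ ξ := by
      simp [ae_iff]
    filter_upwards [hne] with z hz hzR
    have hs : 0 < ‖z - ξ‖ := norm_pos_iff.2 (sub_ne_zero.2 hz)
    have hsR : ‖z - ξ‖ < R := by simpa [dist_eq_norm] using hzR
    calc W z * ENNReal.ofReal (g ‖z - ξ‖) ≤ W z * (ENNReal.ofReal (2 * K) *
          ∫⁻ t in Set.Ioc ‖z - ξ‖ (2 * ‖z - ξ‖), ENNReal.ofReal (g t / t)) := by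
          gcongr; exact key _ hs
      _ = ENNReal.ofReal (2 * K) *
          ∫⁻ t in Set.Ioc ‖z - ξ‖ (2 * ‖z - ξ‖), W z * ENNReal.ofReal (g t / t) := by
          rw [lintegral_const_mul _ (by fun_prop)]; ring
      _ ≤ _ := by
          refine mul_le_mul_right ?_ _
          rw [← lintegral_indicator measurableSet_Ioc]
          refine lintegral_mono fun t => ?_
          by_cases ht : t ∈ Set.Ioc ‖z - ξ‖ (2 * ‖z - ξ‖)
          · have h1 : t ∈ Set.Ioc 0 (2 * R) := ⟨hs.trans ht.1, ht.2.trans (by linarith)⟩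
            have h2 : z ∈ Metric.closedBall ξ t := by
              simpa [dist_eq_norm] using ht.1.le
            simp [hH, ht, h1, h2]
          · simp [ht]
  have hjoint : Measurable fun p : EuclideanSpace ℝ (Fin n) × ℝ =>
      (Metric.closedBall ξ p.2).indicator W p.1 * H p.2 := by
    refine Measurable.mul ?_ (hHm.comp measurable_snd)
    have hset : MeasurableSet {p : EuclideanSpace ℝ (Fin n) × ℝ | dist p.1 ξ ≤ p.2} :=
      measurableSet_le (by fun_prop) (by fun_prop)
    exact (hW.comp measurable_fst).indicator hset
  calc _ ≤ ∫⁻ z in Metric.ball ξ R, ENNReal.ofReal (2 * K) *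
          ∫⁻ t, (Metric.closedBall ξ t).indicator W z * H t := lintegral_mono_ae hae
    _ ≤ ∫⁻ z, ENNReal.ofReal (2 * K) * ∫⁻ t, (Metric.closedBall ξ t).indicator W z * H t :=
        setLIntegral_le_lintegral _ _
    _ = ENNReal.ofReal (2 * K) * ∫⁻ t, ∫⁻ z, (Metric.closedBall ξ t).indicator W z * H t := by
        rw [lintegral_const_mul _ hjoint.lintegral_prod_right',
          lintegral_lintegral_swap hjoint.aemeasurable]
    _ = _ := by
        rw [← lintegral_indicator measurableSet_Ioc]
        congr 2
        ext t
        rw [lintegral_mul_const _ (hW.indicator measurableSet_closedBall),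
          lintegral_indicator measurableSet_closedBall, mul_comm, hH]
        by_cases ht : t ∈ Set.Ioc 0 (2 * R) <;> simp [ht]

lemma antitoneOn_and_doubling_rpow {p : ℝ} (hp : 0 ≤ p) {a : ℝ} (ha : 0 ≤ a) :
    (∀ s : ℝ, 0 < s → 0 ≤ (a + s ^ 2) ^ (-p)) ∧
    AntitoneOn (fun s : ℝ => (a + s ^ 2) ^ (-p)) (Set.Ioi 0) ∧
    ∀ s : ℝ, 0 < s → (a + s ^ 2) ^ (-p) ≤ 4 ^ p * (a + (2 * s) ^ 2) ^ (-p) := by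
  refine ⟨fun s hs => by positivity, fun s hs t ht hst => ?_, fun s hs => ?_⟩
  · have hs : 0 < s := hs
    refine Real.rpow_le_rpow_of_nonpos (by positivity) (by gcongr) (by linarith)
  · have : (4 : ℝ) ^ p = (4⁻¹ : ℝ) ^ (-p) := by
      rw [Real.inv_rpow (by norm_num), Real.rpow_neg (by norm_num), inv_inv]
    rw [this, ← Real.mul_rpow (by norm_num) (by positivity)]
    exact Real.rpow_le_rpow_of_nonpos (by positivity) (by nlinarith) (by linarith)

lemma lintegral_ball_riesz_le {n : ℕ} (hn : 3 ≤ n) :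
    ∃ K : ℝ, 0 < K ∧ ∀ (x : EuclideanSpace ℝ (Fin n)) (ρ : ℝ), 0 < ρ →
      ∫⁻ z in Metric.ball x ρ, ENNReal.ofReal (‖x - z‖ ^ (-((n : ℝ) - 2))) ≤
        ENNReal.ofReal (K * ρ ^ 2) := by
  have hn' : (3 : ℝ) ≤ n := by exact_mod_cast hn
  have : Nonempty (Fin n) := ⟨⟨0, by omega⟩⟩
  set v := (volume (Metric.ball (0 : EuclideanSpace ℝ (Fin n)) 1)).toReal with hv
  have hvpos : 0 < v :=
    ENNReal.toReal_pos (Metric.measure_ball_pos _ _ one_pos).ne' measure_ball_lt_top.ne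
  have hve : volume (Metric.ball (0 : EuclideanSpace ℝ (Fin n)) 1) = ENNReal.ofReal v :=
    (ENNReal.ofReal_toReal measure_ball_lt_top.ne).symm
  refine ⟨2 * 4 ^ (((n : ℝ) - 2) / 2) * (v * 2), by positivity, fun x ρ hρ => ?_⟩
  obtain ⟨h0, h1, h2⟩ := antitoneOn_and_doubling_rpow (p := ((n : ℝ) - 2) / 2) (by linarith)
    (le_refl (0 : ℝ))
  have heq : ∀ s : ℝ, 0 ≤ s → (0 + s ^ 2) ^ (-(((n : ℝ) - 2) / 2)) = s ^ (-((n : ℝ) - 2)) := by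
    intro s hs
    rw [zero_add, ← Real.rpow_natCast, ← Real.rpow_mul hs]; congr 1; push_cast; ring
  have := lintegral_ball_mul_radial_le (by omega) x ρ (W := fun _ => 1) measurable_const
    (g := fun s => (0 + s ^ 2) ^ (-(((n : ℝ) - 2) / 2))) (K := 4 ^ (((n : ℝ) - 2) / 2))
    (by positivity) (by fun_prop) h0 h1 h2
  calc _ = ∫⁻ z in Metric.ball x ρ, 1 *
        ENNReal.ofReal ((0 + ‖z - x‖ ^ 2) ^ (-(((n : ℝ) - 2) / 2))) := by
        simp_rw [heq _ (norm_nonneg _), one_mul, norm_sub_rev]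
    _ ≤ _ := this
    _ ≤ ENNReal.ofReal (2 * 4 ^ (((n : ℝ) - 2) / 2)) *
        ∫⁻ t in Set.Ioc 0 (2 * ρ), ENNReal.ofReal (v * t) := by
        refine mul_le_mul_right ?_ _
        refine setLIntegral_mono' measurableSet_Ioc fun t ht => ?_
        have ht0 : 0 < t := ht.1
        rw [setLIntegral_one, Measure.addHaar_closedBall _ _ ht0.le, hve,
          ← ENNReal.ofReal_mul (by positivity), ← ENNReal.ofReal_mul (by positivity)]
        refine ENNReal.ofReal_le_ofReal (le_of_eq ?_)
        rw [heq t ht0.le, finrank_euclideanSpace, Fintype.card_fin]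
        have : t ^ (-((n : ℝ) - 2)) * t ^ n = t ^ 2 := by
          rw [← Real.rpow_natCast, ← Real.rpow_natCast, ← Real.rpow_add ht0]
          congr 1; push_cast; ring
        field_simp
        linear_combination this
    _ ≤ ENNReal.ofReal (2 * 4 ^ (((n : ℝ) - 2) / 2)) * ENNReal.ofReal (v * 2 * ρ ^ 2) := by
        gcongr
        refine lintegral_ofReal_deriv_le (f := fun t => v * t ^ 2 / 2)
          (by fun_prop) (fun t _ => ?_) (fun t ht => by have := ht.1; positivity) fun _ => ?_
        · exact (((hasDerivAt_pow 2 t).const_mul v).div_const 2).congr_deriv (by push_cast; ring)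
        · apply le_of_eq; ring
    _ = _ := by rw [← ENNReal.ofReal_mul (by positivity)]; congr 1; ring

lemma lintegral_closedBall_riesz_le {n : ℕ} (hn : 3 ≤ n) :
    ∃ K : ℝ, 0 < K ∧ ∀ (x ξ : EuclideanSpace ℝ (Fin n)) (t : ℝ), 0 < t →
      ∫⁻ z in Metric.closedBall ξ t, ENNReal.ofReal (‖x - z‖ ^ (-((n : ℝ) - 2))) ≤
        ENNReal.ofReal (K * (t ^ n * max ‖x - ξ‖ t ^ (-((n : ℝ) - 2)))) := by
  have hn' : (3 : ℝ) ≤ n := by exact_mod_cast hn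
  have : Nonempty (Fin n) := ⟨⟨0, by omega⟩⟩
  obtain ⟨K, hK, h⟩ := lintegral_ball_riesz_le hn
  set v := (volume (Metric.ball (0 : EuclideanSpace ℝ (Fin n)) 1)).toReal with hv
  have hvpos : 0 < v :=
    ENNReal.toReal_pos (Metric.measure_ball_pos _ _ one_pos).ne' measure_ball_lt_top.ne
  have hve : volume (Metric.ball (0 : EuclideanSpace ℝ (Fin n)) 1) = ENNReal.ofReal v :=
    (ENNReal.ofReal_toReal measure_ball_lt_top.ne).symm
  have h2 : (2 : ℝ) ^ ((n : ℝ) - 2) = (2⁻¹ : ℝ) ^ (-((n : ℝ) - 2)) := by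
    rw [Real.inv_rpow (by norm_num), Real.rpow_neg (by norm_num), inv_inv]
  refine ⟨(16 * K + v) * 2 ^ ((n : ℝ) - 2), by positivity, fun x ξ t ht => ?_⟩
  set m := max ‖x - ξ‖ t with hm
  have hmpos : 0 < m := lt_max_of_lt_right ht
  have hcomb : 2 ^ ((n : ℝ) - 2) * m ^ (-((n : ℝ) - 2)) = (m / 2) ^ (-((n : ℝ) - 2)) := by
    rw [h2, ← Real.mul_rpow (by norm_num) hmpos.le]; congr 1; ring
  rcases le_or_gt ‖x - ξ‖ (2 * t) with hxt | hxt
  · have hsub : Metric.closedBall ξ t ⊆ Metric.ball x (4 * t) := by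
      intro z hz
      rw [Metric.mem_closedBall] at hz
      rw [Metric.mem_ball]
      rw [← dist_eq_norm] at hxt
      linarith [dist_triangle z ξ x, dist_comm x ξ]
    refine (lintegral_mono_set hsub).trans ((h x (4 * t) (by positivity)).trans
      (ENNReal.ofReal_le_ofReal ?_))
    have hmt : m / 2 ≤ t := by rw [div_le_iff₀ two_pos]; exact max_le (by linarith) (by linarith)
    have e1 : t ^ (-((n : ℝ) - 2)) ≤ (m / 2) ^ (-((n : ℝ) - 2)) :=
      Real.rpow_le_rpow_of_nonpos (by positivity) hmt (by linarith)
    have e2 : t ^ (-((n : ℝ) - 2)) * t ^ n = t ^ 2 := by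
      rw [← Real.rpow_natCast, ← Real.rpow_natCast, ← Real.rpow_add ht]
      congr 1; push_cast; ring
    calc K * (4 * t) ^ 2 = 16 * K * (t ^ n * t ^ (-((n : ℝ) - 2))) := by
          rw [mul_comm (t ^ n), e2]; ring
      _ ≤ (16 * K + v) * (t ^ n * (m / 2) ^ (-((n : ℝ) - 2))) := by gcongr; linarith
      _ = _ := by rw [← hcomb]; ring
  · have hmx : m = ‖x - ξ‖ := max_eq_left (by linarith)
    calc _ ≤ ∫⁻ z in Metric.closedBall ξ t, ENNReal.ofReal ((m / 2) ^ (-((n : ℝ) - 2))) := by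
          refine setLIntegral_mono' measurableSet_closedBall fun z hz =>
            ENNReal.ofReal_le_ofReal ?_
          refine Real.rpow_le_rpow_of_nonpos (by positivity) ?_ (by linarith)
          rw [Metric.mem_closedBall] at hz
          rw [hmx]
          rw [← dist_eq_norm] at hxt ⊢
          rw [← dist_eq_norm]
          linarith [dist_triangle x z ξ]
      _ ≤ _ := by
          rw [setLIntegral_const, Measure.addHaar_closedBall _ _ ht.le, hve,
            ← ENNReal.ofReal_mul (by positivity), ← ENNReal.ofReal_mul (by positivity)]
          refine ENNReal.ofReal_le_ofReal ?_
          rw [finrank_euclideanSpace, Fintype.card_fin]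
          calc _ = v * (t ^ n * (m / 2) ^ (-((n : ℝ) - 2))) := by ring
            _ ≤ (16 * K + v) * (t ^ n * (m / 2) ^ (-((n : ℝ) - 2))) := by gcongr; linarith
            _ = _ := by rw [← hcomb]; ring

/-- The radial majorant of the Riesz potential of a bubble. -/
noncomputable def bubbleKernel (n : ℕ) (α δ r t : ℝ) : ℝ :=
  t ^ ((n : ℝ) - 1) * max r t ^ (-((n : ℝ) - 2)) * (δ ^ 2 + t ^ 2) ^ (-(α / 2))

lemma setIntegral_bubble_le {n : ℕ} (hn : 3 ≤ n) {α : ℝ} (hα : 0 < α)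
    {Ω : Set (EuclideanSpace ℝ (Fin n))} (hΩb : Bornology.IsBounded Ω) :
    ∃ B : ℝ, 0 < B ∧ ∃ K : ℝ, 0 < K ∧ ∀ δ : ℝ, 0 < δ → ∀ ξ ∈ Ω,
      ∀ x : EuclideanSpace ℝ (Fin n), ∀ M : ℝ, 0 ≤ M →
      ∫⁻ t in Set.Ioc 0 B, ENNReal.ofReal (bubbleKernel n α δ ‖x - ξ‖ t) ≤ ENNReal.ofReal M →
        ∫ z in Ω, ‖x - z‖ ^ (-((n : ℝ) - 2)) * (δ / (δ ^ 2 + ‖z - ξ‖ ^ 2)) ^ (α / 2)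
          ≤ K * δ ^ (α / 2) * M := by
  obtain ⟨K, hK, h⟩ := lintegral_closedBall_riesz_le hn
  refine ⟨2 * (Metric.diam Ω + 1), by positivity, 2 * 4 ^ (α / 2) * K, by positivity,
    fun δ hδ ξ hξ x M hM hle => ?_⟩
  have hsub : Ω ⊆ Metric.ball ξ (Metric.diam Ω + 1) := fun z hz =>
    Metric.mem_ball.2 ((Metric.dist_le_diam_of_mem hΩb hz hξ).trans_lt (lt_add_one _))
  obtain ⟨h0, h1, h2⟩ := antitoneOn_and_doubling_rpow (p := α / 2) (by linarith) (sq_nonneg δ)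
  have hrad := lintegral_ball_mul_radial_le (by omega) ξ (Metric.diam Ω + 1)
    (W := fun z => ENNReal.ofReal (‖x - z‖ ^ (-((n : ℝ) - 2)))) (by fun_prop)
    (g := fun s => (δ ^ 2 + s ^ 2) ^ (-(α / 2))) (K := 4 ^ (α / 2))
    (by positivity) (by fun_prop) h0 h1 h2
  refine (Real.le_norm_self _).trans ((norm_integral_le_lintegral_norm _).trans
    (ENNReal.toReal_le_of_le_ofReal ?_ ?_))
  · positivity
  calc _ ≤ ∫⁻ z in Metric.ball ξ (Metric.diam Ω + 1), ENNReal.ofReal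
        ‖‖x - z‖ ^ (-((n : ℝ) - 2)) * (δ / (δ ^ 2 + ‖z - ξ‖ ^ 2)) ^ (α / 2)‖ :=
        lintegral_mono_set hsub
    _ = ∫⁻ z in Metric.ball ξ (Metric.diam Ω + 1), ENNReal.ofReal (δ ^ (α / 2)) *
        (ENNReal.ofReal (‖x - z‖ ^ (-((n : ℝ) - 2))) *
          ENNReal.ofReal ((δ ^ 2 + ‖z - ξ‖ ^ 2) ^ (-(α / 2)))) := by
        congr 1 with z
        rw [Real.norm_of_nonneg (by positivity), ← ENNReal.ofReal_mul (by positivity),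
          ← ENNReal.ofReal_mul (by positivity), Real.div_rpow hδ.le (by positivity),
          Real.rpow_neg (by positivity : 0 ≤ δ ^ 2 + ‖z - ξ‖ ^ 2)]
        congr 1; ring
    _ ≤ ENNReal.ofReal (δ ^ (α / 2)) * (ENNReal.ofReal (2 * 4 ^ (α / 2)) *
        (ENNReal.ofReal K * ENNReal.ofReal M)) := by
        rw [lintegral_const_mul _ (by fun_prop)]
        gcongr
        refine hrad.trans ?_
        gcongr
        refine le_trans ?_ (mul_le_mul_right hle _)
        rw [← lintegral_const_mul' _ _ ENNReal.ofReal_ne_top]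
        refine setLIntegral_mono' measurableSet_Ioc fun t ht => ?_
        have ht0 : 0 < t := ht.1
        refine (mul_le_mul_right (h x ξ t ht0) _).trans ?_
        rw [← ENNReal.ofReal_mul (by positivity), ← ENNReal.ofReal_mul hK.le, bubbleKernel]
        refine ENNReal.ofReal_le_ofReal (le_of_eq ?_)
        rw [Real.rpow_sub_one ht0.ne', Real.rpow_natCast]
        ring
    _ = _ := by
        rw [← ENNReal.ofReal_mul hK.le, ← ENNReal.ofReal_mul (by positivity),
          ← ENNReal.ofReal_mul (by positivity)]
        congr 1; ring

lemma setLIntegral_ofReal_const_mul_le {f h : ℝ → ℝ} {s : Set ℝ} (hs : MeasurableSet s) {A M : ℝ}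
    (hA : 0 ≤ A) (hfh : ∀ t ∈ s, h t ≤ A * f t)
    (hf : ∫⁻ t in s, ENNReal.ofReal (f t) ≤ ENNReal.ofReal M) :
    ∫⁻ t in s, ENNReal.ofReal (h t) ≤ ENNReal.ofReal (A * M) := by
  calc _ ≤ ∫⁻ t in s, ENNReal.ofReal A * ENNReal.ofReal (f t) :=
        setLIntegral_mono' hs fun t ht => by
          rw [← ENNReal.ofReal_mul hA]; exact ENNReal.ofReal_le_ofReal (hfh t ht)
    _ ≤ _ := by
        rw [lintegral_const_mul' _ _ ENNReal.ofReal_ne_top, ENNReal.ofReal_mul hA]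
        gcongr

lemma setLIntegral_ofReal_le_of_le {f h : ℝ → ℝ} {s : Set ℝ} (hs : MeasurableSet s) {M : ℝ}
    (hfh : ∀ t ∈ s, h t ≤ f t)
    (hf : ∫⁻ t in s, ENNReal.ofReal (f t) ≤ ENNReal.ofReal M) :
    ∫⁻ t in s, ENNReal.ofReal (h t) ≤ ENNReal.ofReal M :=
  (setLIntegral_mono' hs fun t ht => ENNReal.ofReal_le_ofReal (hfh t ht)).trans hf

lemma lintegral_Ioc_le_add {f : ℝ → ENNReal} {a r b M N : ℝ} (hM : 0 ≤ M) (hN : 0 ≤ N)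
    (h₁ : ∫⁻ t in Set.Ioc a r, f t ≤ ENNReal.ofReal M)
    (h₂ : ∫⁻ t in Set.Ioc r b, f t ≤ ENNReal.ofReal N) :
    ∫⁻ t in Set.Ioc a b, f t ≤ ENNReal.ofReal (M + N) := by
  rw [ENNReal.ofReal_add hM hN]
  exact (lintegral_mono_set Set.Ioc_subset_Ioc_union_Ioc).trans
    ((lintegral_union_le _ _ _).trans (add_le_add h₁ h₂))

lemma lintegral_Ioc_zero_rpow_le {b c : ℝ} (hc : 0 < c) :
    ∫⁻ t in Set.Ioc 0 b, ENNReal.ofReal (t ^ (c - 1)) ≤ ENNReal.ofReal (b ^ c / c) := by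
  refine lintegral_ofReal_deriv_le (f := fun t => t ^ c / c) ?_ (fun t ht => ?_)
    (fun t ht => by have := ht.1; positivity) fun _ => ?_
  · exact ((Real.continuous_rpow_const hc.le).div_const c).continuousOn
  · exact ((Real.hasDerivAt_rpow_const (p := c) (Or.inl ht.1.ne')).div_const c).congr_deriv
      (by field_simp)
  · simp [Real.zero_rpow hc.ne']

lemma lintegral_Ioc_rpow_neg_le {r b c : ℝ} (hc : 0 < c) (hr : 0 < r) :
    ∫⁻ t in Set.Ioc r b, ENNReal.ofReal (t ^ (-c - 1)) ≤ ENNReal.ofReal (r ^ (-c) / c) := by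
  refine lintegral_ofReal_deriv_le (f := fun t => -(t ^ (-c) / c)) ?_ (fun t ht => ?_)
    (fun t ht => by have := hr.trans ht.1; positivity) fun h => ?_
  · exact ((continuousOn_id.rpow_const fun t ht =>
      Or.inl (hr.trans_le ht.1).ne').div_const c).neg
  · exact ((Real.hasDerivAt_rpow_const (p := -c)
      (Or.inl (hr.trans ht.1).ne')).div_const c).neg.congr_deriv (by field_simp)
  · have : 0 ≤ b ^ (-c) / c := by have := hr.trans_le h; positivity
    linarith

lemma lintegral_Ioc_inv_le {r b : ℝ} (hr : 0 < r) :
    ∫⁻ t in Set.Ioc r b, ENNReal.ofReal t⁻¹ ≤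
      ENNReal.ofReal (|Real.log b| + |Real.log r|) := by
  refine lintegral_ofReal_deriv_le (f := Real.log) ?_
    (fun t ht => Real.hasDerivAt_log (hr.trans ht.1).ne')
    (fun t ht => by have := hr.trans ht.1; positivity) fun h => ?_
  · exact Real.continuousOn_log.mono fun t ht => (hr.trans_le ht.1).ne'
  · linarith [le_abs_self (Real.log b), neg_abs_le (Real.log r)]

lemma lintegral_Ioc_mul_rpow_neg_le {δ b c : ℝ} (hδ : 0 < δ) (hc : 0 < c) :
    ∫⁻ t in Set.Ioc 0 b, ENNReal.ofReal (t * (δ ^ 2 + t ^ 2) ^ (-c - 1)) ≤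
      ENNReal.ofReal ((δ ^ 2) ^ (-c) / (2 * c)) := by
  refine lintegral_ofReal_deriv_le (f := fun t => -((δ ^ 2 + t ^ 2) ^ (-c) / (2 * c))) ?_
    (fun t ht => ?_) (fun t ht => by have := ht.1; positivity) fun h => ?_
  · exact (((by fun_prop : Continuous fun t : ℝ => δ ^ 2 + t ^ 2).continuousOn.rpow_const
      fun t _ => Or.inl (by positivity)).div_const _).neg
  · exact ((((hasDerivAt_pow 2 t).const_add (δ ^ 2)).rpow_const (p := -c)
      (Or.inl (by positivity))).div_const (2 * c)).neg.congr_deriv (by push_cast; field_simp)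
  · have : 0 ≤ (δ ^ 2 + b ^ 2) ^ (-c) / (2 * c) := by positivity
    norm_num
    linarith

lemma lintegral_Ioc_mul_inv_le {δ r : ℝ} (hδ : 0 < δ) (hr : 0 < r) :
    ∫⁻ t in Set.Ioc 0 r, ENNReal.ofReal (t * (δ ^ 2 + t ^ 2)⁻¹) ≤
      ENNReal.ofReal (Real.log (2 + r / δ)) := by
  refine lintegral_ofReal_deriv_le (f := fun t => Real.log (δ ^ 2 + t ^ 2) / 2) ?_
    (fun t ht => ?_) (fun t ht => by have := ht.1; positivity) fun h => ?_
  · exact (((by fun_prop : Continuous fun t : ℝ => δ ^ 2 + t ^ 2).log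
      fun t => by positivity).div_const _).continuousOn
  · exact ((((hasDerivAt_pow 2 t).const_add (δ ^ 2)).log
      (by positivity)).div_const 2).congr_deriv (by push_cast; field_simp)
  · have h1 : Real.log (δ ^ 2 + r ^ 2) ≤ Real.log (δ ^ 2 * (2 + r / δ) ^ 2) := by
      refine Real.log_le_log (by positivity) ?_
      have : δ ^ 2 * (2 + r / δ) ^ 2 = (2 * δ + r) ^ 2 := by field_simp
      rw [this]; nlinarith [mul_pos hδ hr]
    rw [Real.log_mul (by positivity) (by positivity), Real.log_pow (n := 2) (x := 2 + r / δ)] at h1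
    push_cast at h1
    rw [zero_pow two_ne_zero, add_zero]
    linarith

section kernel

variable {n : ℕ} {α δ r t : ℝ}

lemma rpow_neg_add_sq_le (hα : 0 < α) (ht : 0 < t) :
    (δ ^ 2 + t ^ 2) ^ (-(α / 2)) ≤ t ^ (-α) := by
  have : t ^ (-α) = (t ^ 2) ^ (-(α / 2)) := by
    rw [← Real.rpow_natCast, ← Real.rpow_mul ht.le]; congr 1; push_cast; ring
  rw [this]
  exact Real.rpow_le_rpow_of_nonpos (by positivity) (by nlinarith [sq_nonneg δ]) (by linarith)

lemma bubbleKernel_le_mul (hn : 3 ≤ n) (ht : 0 < t) :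
    bubbleKernel n α δ r t ≤ t * (δ ^ 2 + t ^ 2) ^ (-(α / 2)) := by
  have hn' : (3 : ℝ) ≤ n := by exact_mod_cast hn
  have e : t ^ ((n : ℝ) - 1) * t ^ (-((n : ℝ) - 2)) = t := by
    rw [← Real.rpow_add ht]; convert Real.rpow_one t using 2; ring
  have h : max r t ^ (-((n : ℝ) - 2)) ≤ t ^ (-((n : ℝ) - 2)) :=
    Real.rpow_le_rpow_of_nonpos ht (le_max_right _ _) (by linarith)
  rw [bubbleKernel]
  gcongr
  calc _ ≤ t ^ ((n : ℝ) - 1) * t ^ (-((n : ℝ) - 2)) := by gcongr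
    _ = t := e

lemma bubbleKernel_le_rpow (hn : 3 ≤ n) (hα : 0 < α) (ht : 0 < t) :
    bubbleKernel n α δ r t ≤ t ^ (1 - α) := by
  refine (bubbleKernel_le_mul hn ht).trans ?_
  rw [sub_eq_add_neg, Real.rpow_add ht, Real.rpow_one]
  gcongr
  exact rpow_neg_add_sq_le hα ht

lemma bubbleKernel_le_const_mul (hn : 3 ≤ n) (hr : 0 < r) (ht : 0 < t) :
    bubbleKernel n α δ r t ≤
      r ^ (-((n : ℝ) - 2)) * (t ^ ((n : ℝ) - 1) * (δ ^ 2 + t ^ 2) ^ (-(α / 2))) := by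
  have hn' : (3 : ℝ) ≤ n := by exact_mod_cast hn
  have h : max r t ^ (-((n : ℝ) - 2)) ≤ r ^ (-((n : ℝ) - 2)) :=
    Real.rpow_le_rpow_of_nonpos hr (le_max_left _ _) (by linarith)
  rw [bubbleKernel, mul_comm (t ^ _), mul_assoc]
  gcongr

lemma bubbleKernel_le_const_mul_rpow (hn : 3 ≤ n) (hα : 0 < α) (hr : 0 < r) (ht : 0 < t) :
    bubbleKernel n α δ r t ≤ r ^ (-((n : ℝ) - 2)) * t ^ ((n : ℝ) - α - 1) := by
  refine (bubbleKernel_le_const_mul hn hr ht).trans ?_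
  rw [show (n : ℝ) - α - 1 = (n - 1) + -α by ring, Real.rpow_add ht]
  gcongr
  exact rpow_neg_add_sq_le hα ht

lemma bubbleKernel_le_const_mul_mul_rpow (hn : 3 ≤ n) (hr : 0 < r) (ht : 0 < t) :
    bubbleKernel n α δ r t ≤
      r ^ (-((n : ℝ) - 2)) * (t * (δ ^ 2 + t ^ 2) ^ (-((α - n) / 2) - 1)) := by
  have hn' : (3 : ℝ) ≤ n := by exact_mod_cast hn
  refine (bubbleKernel_le_const_mul hn hr ht).trans ?_
  have e1 : t ^ ((n : ℝ) - 1) = t * (t ^ 2) ^ (((n : ℝ) - 2) / 2) := by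
    rw [← Real.rpow_natCast t 2, ← Real.rpow_mul ht.le]
    nth_rw 2 [← Real.rpow_one t]
    rw [← Real.rpow_add ht]; congr 1; push_cast; ring
  have h : (t ^ 2) ^ (((n : ℝ) - 2) / 2) ≤ (δ ^ 2 + t ^ 2) ^ (((n : ℝ) - 2) / 2) :=
    Real.rpow_le_rpow (by positivity) (by nlinarith [sq_nonneg δ]) (by linarith)
  rw [show -((α - n) / 2) - 1 = ((n : ℝ) - 2) / 2 + -(α / 2) by ring,
    Real.rpow_add (by positivity), e1, mul_assoc t]
  gcongr

end kernel

lemma rpow_neg_le_two_rpow_mul {a s c : ℝ} (hs : 0 < s) (hsa : s ≤ 2 * a) (hc : 0 ≤ c) :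
    a ^ (-c) ≤ 2 ^ c * s ^ (-c) := by
  have h2 : (2 : ℝ) ^ c = (2⁻¹ : ℝ) ^ (-c) := by
    rw [Real.inv_rpow (by norm_num), Real.rpow_neg (by norm_num), inv_inv]
  rw [h2, ← Real.mul_rpow (by norm_num) hs.le]
  exact Real.rpow_le_rpow_of_nonpos (by positivity) (by linarith) (by linarith)

lemma sq_rpow_neg_half {r : ℝ} (hr : 0 < r) (c : ℝ) : (r ^ 2) ^ (-(c / 2)) = r ^ (-c) := by
  rw [← Real.rpow_natCast, ← Real.rpow_mul hr.le]; congr 1; push_cast; ring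

section bounds

variable {n : ℕ} {α δ r B : ℝ}

lemma lintegral_bubbleKernel_le_sq_rpow (hn : 3 ≤ n) (hα : 2 < α) (hδ : 0 < δ) :
    ∫⁻ t in Set.Ioc 0 B, ENNReal.ofReal (bubbleKernel n α δ r t) ≤
      ENNReal.ofReal ((δ ^ 2) ^ (-((α - 2) / 2)) / (α - 2)) := by
  refine setLIntegral_ofReal_le_of_le measurableSet_Ioc
    (fun t ht => bubbleKernel_le_mul hn ht.1) ?_
  convert lintegral_Ioc_mul_rpow_neg_le (c := (α - 2) / 2) hδ (by linarith) using 6 <;> ring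

lemma lintegral_bubbleKernel_lt_two (hn : 3 ≤ n) (hα : 0 < α) (hα2 : α < 2) :
    ∫⁻ t in Set.Ioc 0 B, ENNReal.ofReal (bubbleKernel n α δ r t) ≤
      ENNReal.ofReal (B ^ (2 - α) / (2 - α)) := by
  refine setLIntegral_ofReal_le_of_le measurableSet_Ioc
    (fun t ht => bubbleKernel_le_rpow hn hα ht.1) ?_
  convert lintegral_Ioc_zero_rpow_le (c := 2 - α) (by linarith) using 5; ring

lemma lintegral_bubbleKernel_two (hn : 3 ≤ n) (hr : 0 < r) :
    ∫⁻ t in Set.Ioc 0 B, ENNReal.ofReal (bubbleKernel n 2 δ r t) ≤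
      ENNReal.ofReal ((1 + |Real.log B|) * (1 + |Real.log r|)) := by
  have hn' : (3 : ℝ) ≤ n := by exact_mod_cast hn
  have hn2 : (0 : ℝ) < n - 2 := by linarith
  have h1 := setLIntegral_ofReal_const_mul_le measurableSet_Ioc (by positivity)
    (fun t ht => bubbleKernel_le_const_mul_rpow (δ := δ) hn two_pos hr ht.1)
    (lintegral_Ioc_zero_rpow_le (b := r) hn2)
  have h2 := setLIntegral_ofReal_le_of_le (s := Set.Ioc r B) measurableSet_Ioc
    (h := bubbleKernel n 2 δ r) (fun t ht => (bubbleKernel_le_rpow hn two_pos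
      (hr.trans ht.1)).trans_eq (by rw [← Real.rpow_neg_one]; norm_num))
    (lintegral_Ioc_inv_le hr)
  refine (lintegral_Ioc_le_add (by positivity) (by positivity) h1 h2).trans
    (ENNReal.ofReal_le_ofReal ?_)
  have e : r ^ (-((n : ℝ) - 2)) * (r ^ ((n : ℝ) - 2) / (n - 2)) ≤ 1 := by
    rw [← mul_div_assoc, ← Real.rpow_add hr, neg_add_cancel, Real.rpow_zero,
      div_le_one hn2]
    linarith
  nlinarith [mul_nonneg (abs_nonneg (Real.log B)) (abs_nonneg (Real.log r))]

lemma lintegral_bubbleKernel_Ioc_tail_le (hn : 3 ≤ n) (hα : 2 < α) (hr : 0 < r) :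
    ∫⁻ t in Set.Ioc r B, ENNReal.ofReal (bubbleKernel n α δ r t) ≤
      ENNReal.ofReal (r ^ (-(α - 2)) / (α - 2)) :=
  setLIntegral_ofReal_le_of_le measurableSet_Ioc
    (fun t ht => (bubbleKernel_le_rpow hn (by linarith) (hr.trans ht.1)).trans_eq
      (by congr 1; ring))
    (lintegral_Ioc_rpow_neg_le (by linarith) hr)

lemma lintegral_bubbleKernel_two_lt_lt (hn : 3 ≤ n) (hα : 2 < α) (hαn : α < n) (hδ : 0 < δ)
    (hr : 0 ≤ r) :
    ∫⁻ t in Set.Ioc 0 B, ENNReal.ofReal (bubbleKernel n α δ r t) ≤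
      ENNReal.ofReal ((1 / (n - α) + 1 / (α - 2)) * (2 ^ ((α - 2) / 2) *
        (δ ^ 2 + r ^ 2) ^ (-((α - 2) / 2)))) := by
  have hα2 : 0 < α - 2 := by linarith
  have hnα : 0 < n - α := by linarith
  rcases le_or_gt r δ with hrδ | hrδ
  · refine (lintegral_bubbleKernel_le_sq_rpow hn hα hδ).trans (ENNReal.ofReal_le_ofReal ?_)
    have := rpow_neg_le_two_rpow_mul (a := δ ^ 2) (s := δ ^ 2 + r ^ 2) (c := (α - 2) / 2)
      (by positivity) (by nlinarith) (by linarith)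
    calc _ = 1 / (α - 2) * (δ ^ 2) ^ (-((α - 2) / 2)) := by ring
      _ ≤ _ := by gcongr; simp [hnα.le]
  · have hr : 0 < r := hδ.trans hrδ
    have h1 := setLIntegral_ofReal_const_mul_le measurableSet_Ioc (by positivity)
      (fun t ht => bubbleKernel_le_const_mul_rpow (δ := δ) hn (by linarith) hr ht.1)
      (lintegral_Ioc_zero_rpow_le (b := r) hnα)
    refine (lintegral_Ioc_le_add (by positivity) (by positivity) h1
      (lintegral_bubbleKernel_Ioc_tail_le hn hα hr)).trans (ENNReal.ofReal_le_ofReal ?_)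
    have := rpow_neg_le_two_rpow_mul (a := r ^ 2) (s := δ ^ 2 + r ^ 2) (c := (α - 2) / 2)
      (by positivity) (by nlinarith) (by linarith)
    have e : r ^ (-((n : ℝ) - 2)) * r ^ (n - α) = r ^ (-(α - 2)) := by
      rw [← Real.rpow_add hr]; congr 1; ring
    calc _ = (1 / (n - α) + 1 / (α - 2)) * (r ^ 2) ^ (-((α - 2) / 2)) := by
          rw [sq_rpow_neg_half hr, ← mul_div_assoc, e]; ring
      _ ≤ _ := by gcongr

lemma lintegral_bubbleKernel_eq (hn : 3 ≤ n) (hδ : 0 < δ) (hr : 0 ≤ r) :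
    ∫⁻ t in Set.Ioc 0 B, ENNReal.ofReal (bubbleKernel n n δ r t) ≤
      ENNReal.ofReal (3 * (2 ^ (((n : ℝ) - 2) / 2) * (δ ^ 2 + r ^ 2) ^ (-(((n : ℝ) - 2) / 2))) *
        Real.log (2 + r / δ)) := by
  have hn' : (3 : ℝ) ≤ n := by exact_mod_cast hn
  have hn2 : (0 : ℝ) < n - 2 := by linarith
  have hL : 1 / 2 ≤ Real.log (2 + r / δ) := by
    have : Real.log 2 ≤ Real.log (2 + r / δ) :=
      Real.log_le_log two_pos (le_add_of_nonneg_right (by positivity))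
    linarith [Real.log_two_gt_d9]
  have hinv : 1 / ((n : ℝ) - 2) ≤ 1 := by rw [div_le_one hn2]; linarith
  rcases le_or_gt r δ with hrδ | hrδ
  · refine (lintegral_bubbleKernel_le_sq_rpow hn (by linarith) hδ).trans
      (ENNReal.ofReal_le_ofReal ?_)
    have := rpow_neg_le_two_rpow_mul (a := δ ^ 2) (s := δ ^ 2 + r ^ 2) (c := ((n : ℝ) - 2) / 2)
      (by positivity) (by nlinarith) (by linarith)
    calc _ = (δ ^ 2) ^ (-(((n : ℝ) - 2) / 2)) * (1 / ((n : ℝ) - 2)) := by ring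
      _ ≤ 2 ^ (((n : ℝ) - 2) / 2) * (δ ^ 2 + r ^ 2) ^ (-(((n : ℝ) - 2) / 2)) *
          (3 * Real.log (2 + r / δ)) := by gcongr; linarith
      _ = _ := by ring
  · have hr : 0 < r := hδ.trans hrδ
    have h1 := setLIntegral_ofReal_const_mul_le measurableSet_Ioc (by positivity)
      (A := r ^ (-((n : ℝ) - 2))) (h := bubbleKernel n n δ r)
      (f := fun t => t * (δ ^ 2 + t ^ 2)⁻¹)
      (fun t ht => (bubbleKernel_le_const_mul_mul_rpow hn hr ht.1).trans_eq
        (by rw [sub_self, zero_div, neg_zero, zero_sub, Real.rpow_neg_one]))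
      (lintegral_Ioc_mul_inv_le hδ hr)
    refine (lintegral_Ioc_le_add (by positivity) (by positivity) h1
      (lintegral_bubbleKernel_Ioc_tail_le hn (by linarith) hr)).trans
      (ENNReal.ofReal_le_ofReal ?_)
    have := rpow_neg_le_two_rpow_mul (a := r ^ 2) (s := δ ^ 2 + r ^ 2) (c := ((n : ℝ) - 2) / 2)
      (by positivity) (by nlinarith) (by linarith)
    calc _ = (r ^ 2) ^ (-(((n : ℝ) - 2) / 2)) *
          (Real.log (2 + r / δ) + 1 / ((n : ℝ) - 2)) := by
          rw [sq_rpow_neg_half hr]; ring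
      _ ≤ 2 ^ (((n : ℝ) - 2) / 2) * (δ ^ 2 + r ^ 2) ^ (-(((n : ℝ) - 2) / 2)) *
          (3 * Real.log (2 + r / δ)) := by gcongr; linarith
      _ = _ := by ring

lemma lintegral_bubbleKernel_lt (hn : 3 ≤ n) (hαn : n < α) (hδ : 0 < δ) (hr : 0 ≤ r) :
    ∫⁻ t in Set.Ioc 0 B, ENNReal.ofReal (bubbleKernel n α δ r t) ≤
      ENNReal.ofReal ((1 / (α - n)) * δ ^ (-(α - n)) * (2 ^ (((n : ℝ) - 2) / 2) *
        (δ ^ 2 + r ^ 2) ^ (-(((n : ℝ) - 2) / 2)))) := by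
  have hn' : (3 : ℝ) ≤ n := by exact_mod_cast hn
  have hα2 : 0 < α - 2 := by linarith
  have hnα : 0 < α - n := by linarith
  rcases le_or_gt r δ with hrδ | hrδ
  · refine (lintegral_bubbleKernel_le_sq_rpow hn (by linarith) hδ).trans
      (ENNReal.ofReal_le_ofReal ?_)
    have := rpow_neg_le_two_rpow_mul (a := δ ^ 2) (s := δ ^ 2 + r ^ 2) (c := ((n : ℝ) - 2) / 2)
      (by positivity) (by nlinarith) (by linarith)
    have e : δ ^ (-(α - 2)) = δ ^ (-(α - n)) * δ ^ (-((n : ℝ) - 2)) := by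
      rw [← Real.rpow_add hδ]; congr 1; ring
    calc _ = 1 / (α - 2) * δ ^ (-(α - n)) * (δ ^ 2) ^ (-(((n : ℝ) - 2) / 2)) := by
          rw [sq_rpow_neg_half hδ, sq_rpow_neg_half hδ, e]; ring
      _ ≤ _ := by gcongr; linarith
  · have hr : 0 < r := hδ.trans hrδ
    have := rpow_neg_le_two_rpow_mul (a := r ^ 2) (s := δ ^ 2 + r ^ 2) (c := ((n : ℝ) - 2) / 2)
      (by positivity) (by nlinarith) (by linarith)
    refine (setLIntegral_ofReal_const_mul_le measurableSet_Ioc (by positivity)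
      (fun t ht => bubbleKernel_le_const_mul_mul_rpow hn hr ht.1)
      (lintegral_Ioc_mul_rpow_neg_le hδ (half_pos hnα))).trans (ENNReal.ofReal_le_ofReal ?_)
    calc _ = 1 / (α - n) * δ ^ (-(α - n)) * (r ^ 2) ^ (-(((n : ℝ) - 2) / 2)) := by
          rw [sq_rpow_neg_half hδ, sq_rpow_neg_half hr]; ring
      _ ≤ _ := by gcongr

end bounds

/-- Riesz-potential type estimates against a bubble profile on a bounded open set. -/
theorem riesz_potential_bubble_estimate (n : ℕ) (hn : 3 ≤ n) (α : ℝ) (hα : 0 < α)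
    (Ω : Set (EuclideanSpace ℝ (Fin n))) (hΩo : IsOpen Ω) (hΩb : Bornology.IsBounded Ω) :
    ∃ C : ℝ, 0 < C ∧ ∀ δ : ℝ, 0 < δ → δ ≤ 1 → ∀ ξ ∈ Ω, ∀ x : EuclideanSpace ℝ (Fin n),
      (α < 2 →
        ∫ z in Ω, ‖x - z‖ ^ (-((n : ℝ) - 2)) * (δ / (δ ^ 2 + ‖z - ξ‖ ^ 2)) ^ (α / 2)
          ≤ C * δ ^ (α / 2)) ∧
      (α = 2 → x ≠ ξ →
        ∫ z in Ω, ‖x - z‖ ^ (-((n : ℝ) - 2)) * (δ / (δ ^ 2 + ‖z - ξ‖ ^ 2)) ^ (α / 2)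
          ≤ C * δ * (1 + |Real.log ‖x - ξ‖|)) ∧
      (2 < α → α < n →
        ∫ z in Ω, ‖x - z‖ ^ (-((n : ℝ) - 2)) * (δ / (δ ^ 2 + ‖z - ξ‖ ^ 2)) ^ (α / 2)
          ≤ C * δ ^ (α / 2) * (δ ^ 2 + ‖x - ξ‖ ^ 2) ^ (-(α - 2) / 2)) ∧
      (α = n →
        ∫ z in Ω, ‖x - z‖ ^ (-((n : ℝ) - 2)) * (δ / (δ ^ 2 + ‖z - ξ‖ ^ 2)) ^ (α / 2)
          ≤ C * δ ^ ((n : ℝ) / 2) * (δ ^ 2 + ‖x - ξ‖ ^ 2) ^ (-((n : ℝ) - 2) / 2) *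
              Real.log (2 + ‖x - ξ‖ / δ)) ∧
      ((n : ℝ) < α →
        ∫ z in Ω, ‖x - z‖ ^ (-((n : ℝ) - 2)) * (δ / (δ ^ 2 + ‖z - ξ‖ ^ 2)) ^ (α / 2)
          ≤ C * δ ^ ((n : ℝ) - α / 2) * (δ ^ 2 + ‖x - ξ‖ ^ 2) ^ (-((n : ℝ) - 2) / 2)) := by
  obtain ⟨B, hB, K, hK, h⟩ := setIntegral_bubble_le hn hα hΩb
  have hn' : (3 : ℝ) ≤ n := by exact_mod_cast hn
  rcases lt_trichotomy α 2 with hα2 | rfl | hα2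
  · have h2 : 0 < 2 - α := by linarith
    refine ⟨K * (B ^ (2 - α) / (2 - α)), by positivity, fun δ hδ _ ξ hξ x =>
      ⟨fun _ => ?_, fun _ => by linarith, fun _ => by linarith, fun _ => by linarith,
        fun _ => by linarith⟩⟩
    refine (h δ hδ ξ hξ x _ (by positivity) (lintegral_bubbleKernel_lt_two hn hα hα2)).trans_eq ?_
    ring
  · refine ⟨K * (1 + |Real.log B|), by positivity, fun δ hδ _ ξ hξ x =>
      ⟨fun _ => by linarith, fun _ hx => ?_, fun _ => by linarith, fun _ => by linarith,
        fun _ => by linarith⟩⟩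
    have hr : 0 < ‖x - ξ‖ := norm_pos_iff.2 (sub_ne_zero.2 hx)
    refine (h δ hδ ξ hξ x _ (by positivity) (lintegral_bubbleKernel_two hn hr)).trans_eq ?_
    rw [div_self two_ne_zero, Real.rpow_one]
    ring
  rcases lt_trichotomy α n with hαn | rfl | hαn
  · have h2 : 0 < α - 2 := by linarith
    have h3 : 0 < n - α := by linarith
    refine ⟨K * ((1 / (n - α) + 1 / (α - 2)) * 2 ^ ((α - 2) / 2)), by positivity,
      fun δ hδ _ ξ hξ x => ⟨fun _ => by linarith, fun _ => by linarith, fun _ _ => ?_,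
        fun _ => by linarith, fun _ => by linarith⟩⟩
    refine (h δ hδ ξ hξ x _ (by positivity)
      (lintegral_bubbleKernel_two_lt_lt hn hα2 hαn hδ (norm_nonneg _))).trans_eq ?_
    rw [neg_div]
    ring
  · refine ⟨K * (3 * 2 ^ (((n : ℝ) - 2) / 2)), by positivity,
      fun δ hδ _ ξ hξ x => ⟨fun _ => by linarith, fun _ => by linarith, fun _ _ => by linarith,
        fun _ => ?_, fun _ => by linarith⟩⟩
    have hL : 0 ≤ Real.log (2 + ‖x - ξ‖ / δ) :=
      Real.log_nonneg (by have : 0 ≤ ‖x - ξ‖ / δ := by positivity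
                          linarith)
    refine (h δ hδ ξ hξ x _ (by positivity)
      (lintegral_bubbleKernel_eq hn hδ (norm_nonneg _))).trans_eq ?_
    rw [neg_div]
    ring
  · have h2 : 0 < α - n := by linarith
    refine ⟨K * ((1 / (α - n)) * 2 ^ (((n : ℝ) - 2) / 2)), by positivity,
      fun δ hδ _ ξ hξ x => ⟨fun _ => by linarith, fun _ => by linarith, fun _ _ => by linarith,
        fun _ => by linarith, fun _ => ?_⟩⟩
    refine (h δ hδ ξ hξ x _ (by positivity)
      (lintegral_bubbleKernel_lt hn hαn hδ (norm_nonneg _))).trans_eq ?_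
    have e : δ ^ ((n : ℝ) - α / 2) = δ ^ (α / 2) * δ ^ (-(α - n)) := by
      rw [← Real.rpow_add hδ]; congr 1; ring
    rw [neg_div, e]
    ring
end

section
/- Let n ≥ 3 be an integer, p := (n+2)/(n−2), and Ω ⊂ ℝⁿ a bounded open set. There exists a constant C = C(n, Ω) > 0 such that for all δ_i, δ_j ∈ (0, 1] and ξ_i, ξ_j ∈ ℝⁿ with d := |ξ_i − ξ_j| ≥ δ_i, one has: ∫_Ω U_{δ_i,ξ_i}^{p−1} U_{δ_j,ξ_j} dx ≤ C δ_i δ_j^{1/2} d^{−1} if n = 3; ∫_Ω U_{δ_i,ξ_i}^{p−1} U_{δ_j,ξ_j} dx ≤ C δ_i² δ_j d^{−2} log(2 + d δ_i^{−1}) if n = 4; and ∫_Ω U_{δ_i,ξ_i}^{p−1} U_{δ_j,ξ_j} dx ≤ C δ_i² δ_j^{(n−2)/2} d^{−2} if n ≥ 5. -/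
open MeasureTheory

open Set Real

/-- Polar coordinates for a radial function supported in `‖x - ξ‖ ∈ s`, where `s ⊆ (0, ∞)`. -/
lemma integrable_and_integral_indicator_norm_sub (k : ℕ) (ξ : EuclideanSpace ℝ (Fin (k + 2)))
    {s : Set ℝ} (hs : MeasurableSet s) (hs0 : s ⊆ Ioi 0) {g w : ℝ → ℝ}
    (hgw : ∀ r ∈ s, r ^ (k + 1) * g r = w r) (hw : IntegrableOn w s) :
    Integrable (fun x : EuclideanSpace ℝ (Fin (k + 2)) => s.indicator g ‖x - ξ‖) ∧
      ∫ x : EuclideanSpace ℝ (Fin (k + 2)), s.indicator g ‖x - ξ‖ =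
        (k + 2 : ℝ) * (volume : Measure (EuclideanSpace ℝ (Fin (k + 2)))).real
          (Metric.ball 0 1) * ∫ r in s, w r := by
  have key : ∀ r : ℝ, r ^ (k + 1) • s.indicator g r = s.indicator w r := by
    intro r
    by_cases hr : r ∈ s
    · simp [hr, hgw r hr]
    · simp [hr]
  have hw' : Integrable (s.indicator w) := (integrable_indicator_iff hs).2 hw
  have hint : Integrable (fun x : EuclideanSpace ℝ (Fin (k + 2)) => s.indicator g ‖x‖) := by
    rw [integrable_fun_norm_addHaar]
    simp only [finrank_euclideanSpace, Fintype.card_fin, Nat.add_succ_sub_one, key]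
    exact hw'.integrableOn
  refine ⟨hint.comp_sub_right ξ, ?_⟩
  rw [integral_sub_right_eq_self
      (fun x : EuclideanSpace ℝ (Fin (k + 2)) => s.indicator g ‖x‖) ξ,
    integral_fun_norm_addHaar]
  simp only [finrank_euclideanSpace, Fintype.card_fin, Nat.add_succ_sub_one, key, nsmul_eq_mul,
    smul_eq_mul]
  rw [setIntegral_indicator hs, inter_eq_right.2 hs0]
  push_cast
  ring

/-- Splitting of the product kernel along the regions near each center and far from both. -/
lemma kernel_le_sum_indicator (k : ℕ) {δ y z R : ℝ} (hδ : 0 < δ) (hy : 0 < y) (hz : 0 < z)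
    (hR : 0 < R) (hyz : 2 * R ≤ y + z) :
    ((δ ^ 2 + y ^ 2) ^ 2)⁻¹ * (z ^ k)⁻¹ ≤
      (R ^ k)⁻¹ * (Ioc 0 R).indicator (fun r => ((δ ^ 2 + r ^ 2) ^ 2)⁻¹) y +
        (R ^ 4)⁻¹ * (Ioc 0 R).indicator (fun r => (r ^ k)⁻¹) z +
        (Ioi R).indicator (fun r => (r ^ (k + 4))⁻¹) y +
        (Ioi R).indicator (fun r => (r ^ (k + 4))⁻¹) z := by
  have h4 : ((δ ^ 2 + y ^ 2) ^ 2)⁻¹ ≤ (y ^ 4)⁻¹ := by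
    have : y ^ 4 ≤ (δ ^ 2 + y ^ 2) ^ 2 := by nlinarith [sq_nonneg δ, sq_nonneg y]
    gcongr
  have hA : 0 ≤ (Ioc 0 R).indicator (fun r => ((δ ^ 2 + r ^ 2) ^ 2)⁻¹) y :=
    indicator_nonneg (fun r _ => by positivity) y
  have hB : 0 ≤ (Ioc 0 R).indicator (fun r : ℝ => (r ^ k)⁻¹) z :=
    indicator_nonneg (fun r hr => by have := hr.1; positivity) z
  have hC : ∀ t, 0 ≤ (Ioi R).indicator (fun r : ℝ => (r ^ (k + 4))⁻¹) t :=
    indicator_nonneg (fun r hr => by have : 0 < r := hR.trans hr; positivity)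
  have hCy := hC y
  have hCz := hC z
  have hRk : 0 ≤ (R ^ k)⁻¹ := by positivity
  have hR4 : 0 ≤ (R ^ 4)⁻¹ := by positivity
  have hA' := mul_nonneg hRk hA
  have hB' := mul_nonneg hR4 hB
  rcases le_or_gt y R with hyR | hyR
  · have hzR : R ≤ z := by linarith
    have : ((δ ^ 2 + y ^ 2) ^ 2)⁻¹ * (z ^ k)⁻¹ ≤
        (R ^ k)⁻¹ * (Ioc 0 R).indicator (fun r => ((δ ^ 2 + r ^ 2) ^ 2)⁻¹) y := by
      rw [indicator_of_mem (show y ∈ Ioc 0 R from ⟨hy, hyR⟩), mul_comm]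
      gcongr
    linarith
  rcases le_or_gt z R with hzR | hzR
  · have : ((δ ^ 2 + y ^ 2) ^ 2)⁻¹ * (z ^ k)⁻¹ ≤
        (R ^ 4)⁻¹ * (Ioc 0 R).indicator (fun r => (r ^ k)⁻¹) z := by
      rw [indicator_of_mem (show z ∈ Ioc 0 R from ⟨hz, hzR⟩)]
      refine mul_le_mul_of_nonneg_right (h4.trans ?_) (by positivity)
      gcongr
    linarith
  have h5 : ((δ ^ 2 + y ^ 2) ^ 2)⁻¹ * (z ^ k)⁻¹ ≤ (y ^ 4)⁻¹ * (z ^ k)⁻¹ :=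
    mul_le_mul_of_nonneg_right h4 (by positivity)
  rcases le_total y z with h | h
  · have : (y ^ 4)⁻¹ * (z ^ k)⁻¹ ≤ (Ioi R).indicator (fun r => (r ^ (k + 4))⁻¹) y := by
      rw [indicator_of_mem (show y ∈ Ioi R from hyR), pow_add, mul_inv, mul_comm]
      gcongr
    linarith
  · have : (y ^ 4)⁻¹ * (z ^ k)⁻¹ ≤ (Ioi R).indicator (fun r => (r ^ (k + 4))⁻¹) z := by
      rw [indicator_of_mem (show z ∈ Ioi R from hzR), pow_add, mul_inv, mul_comm]
      gcongr
    linarith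

lemma setIntegral_pow_three_inv {R : ℝ} (hR : 0 < R) :
    IntegrableOn (fun r : ℝ => r ^ (-3 : ℝ)) (Ioi R) ∧
      ∫ r in Ioi R, r ^ (-3 : ℝ) = (R ^ 2)⁻¹ / 2 := by
  refine ⟨integrableOn_Ioi_rpow_of_lt (by norm_num) hR, ?_⟩
  rw [integral_Ioi_rpow_of_lt (by norm_num) hR]
  have : R ^ (-3 + 1 : ℝ) = (R ^ 2)⁻¹ := by
    rw [show (-3 + 1 : ℝ) = -(2 : ℕ) by norm_num, rpow_neg hR.le, rpow_natCast]
  rw [this]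
  ring

/-- The mass of the kernel `(δ² + r²)⁻²` near its center. -/
noncomputable def coreMass (k : ℕ) (δ R : ℝ) : ℝ :=
  ∫ r in Ioc 0 R, r ^ (k + 1) * ((δ ^ 2 + r ^ 2) ^ 2)⁻¹

lemma integrableOn_coreMass (k : ℕ) {δ : ℝ} (hδ : 0 < δ) (R : ℝ) :
    IntegrableOn (fun r => r ^ (k + 1) * ((δ ^ 2 + r ^ 2) ^ 2)⁻¹) (Ioc 0 R) := by
  refine (Continuous.integrableOn_Icc (a := 0) (b := R) ?_).mono_set Ioc_subset_Icc_self
  exact (continuous_pow _).mul (Continuous.inv₀ (by fun_prop) fun r => by positivity)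

lemma coreMass_le_of_hasDerivAt (k : ℕ) {δ R : ℝ} (hδ : 0 < δ) (hR : 0 < R) {F f : ℝ → ℝ}
    (hf : Continuous f) (hF : ∀ r, HasDerivAt F (f r) r)
    (hle : ∀ r ∈ Ioc 0 R, r ^ (k + 1) * ((δ ^ 2 + r ^ 2) ^ 2)⁻¹ ≤ f r) :
    coreMass k δ R ≤ F R - F 0 := by
  rw [← intervalIntegral.integral_eq_sub_of_hasDerivAt (fun r _ => hF r)
    (hf.intervalIntegrable 0 R), intervalIntegral.integral_of_le hR.le]
  exact setIntegral_mono_on (integrableOn_coreMass k hδ R)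
    (hf.integrableOn_Icc.mono_set Ioc_subset_Icc_self) measurableSet_Ioc hle

lemma coreMass_one_le {δ R : ℝ} (hδ : 0 < δ) (hR : 0 < R) :
    coreMass 1 δ R ≤ 2 * δ⁻¹ := by
  have h := coreMass_le_of_hasDerivAt 1 hδ hR (F := fun r => δ⁻¹ * arctan (r / δ))
    (f := fun r => (δ ^ 2 + r ^ 2)⁻¹)
    (Continuous.inv₀ (by fun_prop) fun r => by positivity)
    (fun r => by
      refine ((((hasDerivAt_id' r).div_const δ).arctan).const_mul δ⁻¹).congr_deriv ?_
      field_simp)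
    (fun r _ => by
      rw [← div_eq_mul_inv, div_le_iff₀ (by positivity)]
      have : (δ ^ 2 + r ^ 2)⁻¹ * (δ ^ 2 + r ^ 2) ^ 2 = δ ^ 2 + r ^ 2 := by field_simp
      rw [this, one_add_one_eq_two]
      nlinarith [sq_nonneg δ])
  refine h.trans ?_
  have h1 : arctan (R / δ) ≤ 2 := by
    linarith [arctan_lt_pi_div_two (R / δ), pi_le_four]
  simp only [zero_div, arctan_zero, mul_zero, sub_zero]
  rw [mul_comm]
  gcongr

lemma coreMass_two_le {δ R : ℝ} (hδ : 0 < δ) (hR : 0 < R) :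
    coreMass 2 δ R ≤ log (2 + 2 * R / δ) := by
  have h := coreMass_le_of_hasDerivAt 2 hδ hR (F := fun r => log (δ ^ 2 + r ^ 2) / 2)
    (f := fun r => r / (δ ^ 2 + r ^ 2))
    (Continuous.div (by fun_prop) (by fun_prop) fun r => by positivity)
    (fun r => by
      have h0 : HasDerivAt (fun r : ℝ => δ ^ 2 + r ^ 2) (2 * r) r := by
        simpa using (hasDerivAt_pow 2 r).const_add (δ ^ 2)
      refine ((h0.log (by positivity)).div_const 2).congr_deriv ?_
      ring)
    (fun r hr => by
      have := hr.1
      rw [← div_eq_mul_inv, div_le_div_iff₀ (by positivity) (by positivity)]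
      have : 0 ≤ r * (δ ^ 2 + r ^ 2) * δ ^ 2 := by positivity
      linear_combination this)
  refine h.trans ?_
  have h1 : log (δ ^ 2 + R ^ 2) ≤ log ((δ * (2 + 2 * R / δ)) ^ 2) := by
    apply log_le_log (by positivity)
    have : δ * (2 + 2 * R / δ) = 2 * δ + 2 * R := by field_simp
    rw [this]
    nlinarith [mul_pos hδ hR]
  rw [log_pow, log_mul (by positivity) (by positivity)] at h1
  have h2 : log (δ ^ 2 + 0 ^ 2) = 2 * log δ := by simp
  push_cast at h1
  simp only [h2]
  linarith

lemma coreMass_add_three_le (k : ℕ) {δ R : ℝ} (hδ : 0 < δ) (hR : 0 < R) :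
    coreMass (k + 3) δ R ≤ R ^ (k + 1) := by
  have h := coreMass_le_of_hasDerivAt (k + 3) hδ hR (F := fun r => R ^ k * r)
    (f := fun _ => R ^ k) continuous_const
    (fun r => by simpa using (hasDerivAt_id r).const_mul (R ^ k))
    (fun r hr => by
      have hr0 := hr.1
      rw [← div_eq_mul_inv, div_le_iff₀ (by positivity), show k + 3 + 1 = k + 4 by ring, pow_add]
      refine mul_le_mul (pow_le_pow_left₀ hr0.le hr.2 k) ?_ (by positivity) (by positivity)
      nlinarith [sq_nonneg δ, sq_nonneg r])
  simpa [pow_succ] using h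

/-- A product of two bubbles is controlled by the singular kernel. -/
lemma bubble_rpow_mul_bubble_le (k : ℕ) (hk : 1 ≤ k) {δi δj : ℝ} (hi : 0 < δi) (hj : 0 < δj)
    (ξi ξj x : EuclideanSpace ℝ (Fin (k + 2))) (hx : x ≠ ξj) :
    bubble (k + 2) δi ξi x ^ (4 / (k : ℝ)) * bubble (k + 2) δj ξj x ≤
      ((((k : ℝ) + 2) * k) ^ ((k : ℝ) / 4)) ^ (4 / (k : ℝ)) *
        (((k : ℝ) + 2) * k) ^ ((k : ℝ) / 4) * δi ^ 2 * δj ^ ((k : ℝ) / 2) *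
        (((δi ^ 2 + ‖x - ξi‖ ^ 2) ^ 2)⁻¹ * (‖x - ξj‖ ^ k)⁻¹) := by
  have hk0 : (0 : ℝ) < k := by exact_mod_cast hk
  have hz : 0 < ‖x - ξj‖ := norm_pos_iff.2 (sub_ne_zero.2 hx)
  have e : (((k + 2 : ℕ) : ℝ) - 2) = k := by push_cast; ring
  unfold bubble
  rw [e]
  push_cast
  set a := (((k : ℝ) + 2) * k) ^ ((k : ℝ) / 4)
  have ha : 0 < a := by positivity
  clear_value a
  have h1 : (a * (δi / (δi ^ 2 + ‖x - ξi‖ ^ 2)) ^ ((k : ℝ) / 2)) ^ (4 / (k : ℝ)) =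
      a ^ (4 / (k : ℝ)) * (δi ^ 2 * ((δi ^ 2 + ‖x - ξi‖ ^ 2) ^ 2)⁻¹) := by
    rw [mul_rpow ha.le (by positivity), ← rpow_mul (by positivity),
      show (k : ℝ) / 2 * (4 / k) = (2 : ℕ) by field_simp; norm_num, rpow_natCast, div_pow,
      div_eq_mul_inv (δi ^ 2)]
  have h2 : (δj / (δj ^ 2 + ‖x - ξj‖ ^ 2)) ^ ((k : ℝ) / 2) ≤
      δj ^ ((k : ℝ) / 2) * (‖x - ξj‖ ^ k)⁻¹ := by
    have : (‖x - ξj‖ ^ k)⁻¹ = ((‖x - ξj‖ ^ 2)⁻¹) ^ ((k : ℝ) / 2) := by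
      rw [inv_rpow (by positivity), ← rpow_natCast _ 2, ← rpow_mul hz.le,
        show ((2 : ℕ) : ℝ) * ((k : ℝ) / 2) = k by push_cast; ring, rpow_natCast]
    rw [this, ← mul_rpow hj.le (by positivity), div_eq_mul_inv]
    gcongr
    nlinarith [sq_nonneg δj]
  rw [h1]
  calc _ ≤ a ^ (4 / (k : ℝ)) * (δi ^ 2 * ((δi ^ 2 + ‖x - ξi‖ ^ 2) ^ 2)⁻¹) *
        (a * (δj ^ ((k : ℝ) / 2) * (‖x - ξj‖ ^ k)⁻¹)) := by gcongr
    _ = _ := by ring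

lemma bubble_nonneg (n : ℕ) (hn : 2 ≤ n) {δ : ℝ} (hδ : 0 < δ)
    (ξ x : EuclideanSpace ℝ (Fin n)) : 0 ≤ bubble n δ ξ x := by
  have : (0 : ℝ) ≤ (n : ℝ) - 2 := by
    have : (2 : ℝ) ≤ n := by exact_mod_cast hn
    linarith
  unfold bubble
  positivity

/-- The interaction integral in terms of the mass of the first kernel near its center. -/
lemma exists_setIntegral_bubble_le (k : ℕ) (hk : 1 ≤ k)
    (Ω : Set (EuclideanSpace ℝ (Fin (k + 2)))) :
    ∃ C : ℝ, 0 < C ∧ ∀ (δi δj R : ℝ) (ξi ξj : EuclideanSpace ℝ (Fin (k + 2))),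
      0 < δi → 0 < δj → 0 < R → 2 * R = ‖ξi - ξj‖ →
        ∫ x in Ω, bubble (k + 2) δi ξi x ^ (4 / (k : ℝ)) * bubble (k + 2) δj ξj x ≤
          C * δi ^ 2 * δj ^ ((k : ℝ) / 2) *
            ((R ^ k)⁻¹ * coreMass k δi R + 3 / 2 * (R ^ 2)⁻¹) := by
  have hk0 : (0 : ℝ) < k := by exact_mod_cast hk
  set K : ℝ := ((((k : ℝ) + 2) * k) ^ ((k : ℝ) / 4)) ^ (4 / (k : ℝ)) *
    (((k : ℝ) + 2) * k) ^ ((k : ℝ) / 4) with hK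
  have hKpos : 0 < K := by positivity
  set v := (volume : Measure (EuclideanSpace ℝ (Fin (k + 2)))).real (Metric.ball 0 1)
  have hv : 0 < v := ENNReal.toReal_pos (Metric.measure_ball_pos _ _ one_pos).ne'
    measure_ball_lt_top.ne
  refine ⟨K * ((k + 2) * v), by positivity, fun δi δj R ξi ξj hi hj hR hd => ?_⟩
  obtain ⟨iA, eA⟩ := integrable_and_integral_indicator_norm_sub k ξi (s := Ioc 0 R)
    measurableSet_Ioc (fun r hr => hr.1) (fun r _ => rfl) (integrableOn_coreMass k hi R)
  obtain ⟨iB, eB⟩ := integrable_and_integral_indicator_norm_sub k ξj (s := Ioc 0 R)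
    (g := fun r => (r ^ k)⁻¹) (w := fun r => r)
    measurableSet_Ioc (fun r hr => hr.1)
    (fun r hr => by have := hr.1; field_simp; ring)
    (continuous_id.integrableOn_Icc.mono_set Ioc_subset_Icc_self)
  have hC := fun ξ => integrable_and_integral_indicator_norm_sub k ξ (s := Ioi R)
    (g := fun r => (r ^ (k + 4))⁻¹) (w := fun r => r ^ (-3 : ℝ))
    measurableSet_Ioi (fun r hr => hR.trans hr)
    (fun r hr => by
      have hr0 : 0 < r := hR.trans hr
      rw [show (-3 : ℝ) = -(3 : ℕ) by norm_num, rpow_neg hr0.le, rpow_natCast]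
      field_simp
      ring) (setIntegral_pow_three_inv hR).1
  obtain ⟨iC, eC⟩ := hC ξi
  obtain ⟨iD, eD⟩ := hC ξj
  rw [(setIntegral_pow_three_inv hR).2] at eC eD
  rw [← intervalIntegral.integral_of_le hR.le, integral_id] at eB
  have iT := (((iA.const_mul (R ^ k)⁻¹).add (iB.const_mul (R ^ 4)⁻¹)).add iC).add iD
  have hne : ∀ ξ : EuclideanSpace ℝ (Fin (k + 2)), ∀ᵐ x, x ≠ ξ := fun ξ =>
    Measure.ae_ne volume ξ
  set T : EuclideanSpace ℝ (Fin (k + 2)) → ℝ := fun x =>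
    (R ^ k)⁻¹ * (Ioc 0 R).indicator (fun r => ((δi ^ 2 + r ^ 2) ^ 2)⁻¹) ‖x - ξi‖ +
        (R ^ 4)⁻¹ * (Ioc 0 R).indicator (fun r => (r ^ k)⁻¹) ‖x - ξj‖ +
        (Ioi R).indicator (fun r => (r ^ (k + 4))⁻¹) ‖x - ξi‖ +
        (Ioi R).indicator (fun r => (r ^ (k + 4))⁻¹) ‖x - ξj‖ with hT
  have iT' : Integrable T := iT
  have hker : ∀ᵐ x, ((δi ^ 2 + ‖x - ξi‖ ^ 2) ^ 2)⁻¹ * (‖x - ξj‖ ^ k)⁻¹ ≤ T x := by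
    filter_upwards [hne ξi, hne ξj] with x hxi hxj
    refine kernel_le_sum_indicator k hi (norm_pos_iff.2 (sub_ne_zero.2 hxi))
      (norm_pos_iff.2 (sub_ne_zero.2 hxj)) hR ?_
    rw [hd, ← norm_sub_rev ξi x]
    exact norm_sub_le_norm_sub_add_norm_sub ξi x ξj
  have hT0 : ∀ᵐ x, 0 ≤ T x := by
    filter_upwards [hker] with x hx
    exact le_trans (by positivity) hx
  have hTint : ∫ x, T x = (k + 2) * v *
      ((R ^ k)⁻¹ * coreMass k δi R + 3 / 2 * (R ^ 2)⁻¹) := by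
    have h1 := integral_add ((iA.const_mul (R ^ k)⁻¹).add (iB.const_mul (R ^ 4)⁻¹)) iC
    have h2 := integral_add (((iA.const_mul (R ^ k)⁻¹).add (iB.const_mul (R ^ 4)⁻¹)).add iC) iD
    have h3 := integral_add (iA.const_mul (R ^ k)⁻¹) (iB.const_mul (R ^ 4)⁻¹)
    simp only [Pi.add_apply] at h1 h2 h3
    rw [hT, h2, h1, h3, integral_const_mul, integral_const_mul, eA, eB, eC, eD, coreMass]
    field_simp
    ring
  calc ∫ x in Ω, bubble (k + 2) δi ξi x ^ (4 / (k : ℝ)) * bubble (k + 2) δj ξj x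
      ≤ ∫ x in Ω, K * δi ^ 2 * δj ^ ((k : ℝ) / 2) * T x := by
        refine integral_mono_of_nonneg (ae_of_all _ fun x => ?_)
          (iT'.const_mul _).integrableOn (ae_restrict_of_ae ?_)
        · exact mul_nonneg (rpow_nonneg (bubble_nonneg _ (by lia) hi _ _) _)
            (bubble_nonneg _ (by lia) hj _ _)
        · filter_upwards [hker, hne ξj] with x hx hxj
          refine (bubble_rpow_mul_bubble_le k hk hi hj ξi ξj x hxj).trans ?_
          rw [← hK]
          gcongr
    _ ≤ ∫ x, K * δi ^ 2 * δj ^ ((k : ℝ) / 2) * T x := by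
        refine setIntegral_le_integral (iT'.const_mul _) ?_
        filter_upwards [hT0] with x hx
        simp only [Pi.zero_apply]
        positivity
    _ = _ := by
        rw [integral_const_mul, hTint]
        ring

/-- Interaction estimate `∫_Ω U_i^{p−1} U_j` when the centers are at distance `≥ δ_i`. -/
theorem bubble_pm1_interaction_estimate (n : ℕ) (hn : 3 ≤ n)
    (Ω : Set (EuclideanSpace ℝ (Fin n))) (hΩo : IsOpen Ω) (hΩb : Bornology.IsBounded Ω) :
    ∃ C : ℝ, 0 < C ∧
      ∀ (δi δj : ℝ) (ξi ξj : EuclideanSpace ℝ (Fin n)),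
        0 < δi → δi ≤ 1 → 0 < δj → δj ≤ 1 → δi ≤ ‖ξi - ξj‖ →
        (n = 3 →
          ∫ x in Ω, bubble n δi ξi x ^ (((n : ℝ) + 2) / ((n : ℝ) - 2) - 1) * bubble n δj ξj x
            ≤ C * δi * δj ^ ((1 : ℝ) / 2) * ‖ξi - ξj‖⁻¹) ∧
        (n = 4 →
          ∫ x in Ω, bubble n δi ξi x ^ (((n : ℝ) + 2) / ((n : ℝ) - 2) - 1) * bubble n δj ξj x
            ≤ C * δi ^ 2 * δj * (‖ξi - ξj‖ ^ 2)⁻¹ * Real.log (2 + ‖ξi - ξj‖ / δi)) ∧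
        (5 ≤ n →
          ∫ x in Ω, bubble n δi ξi x ^ (((n : ℝ) + 2) / ((n : ℝ) - 2) - 1) * bubble n δj ξj x
            ≤ C * δi ^ 2 * δj ^ (((n : ℝ) - 2) / 2) * (‖ξi - ξj‖ ^ 2)⁻¹) := by
  obtain ⟨k, rfl⟩ : ∃ k, n = k + 2 := ⟨n - 2, by lia⟩
  have hk : 1 ≤ k := by lia
  have hk0 : (0 : ℝ) < k := by exact_mod_cast hk
  obtain ⟨C, hC, h⟩ := exists_setIntegral_bubble_le k hk Ω
  have e : (((k + 2 : ℕ) : ℝ) - 2) = k := by push_cast; ring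
  have e' : (((k + 2 : ℕ) : ℝ) + 2) / k - 1 = 4 / k := by push_cast; field_simp; ring
  rw [e, e']
  refine ⟨10 * C, by positivity, fun δi δj ξi ξj hi _ hj _ hd => ?_⟩
  have hd0 : 0 < ‖ξi - ξj‖ := hi.trans_le hd
  have hI := h δi δj (‖ξi - ξj‖ / 2) ξi ξj hi hj (by positivity) (by ring)
  set d := ‖ξi - ξj‖
  have hR : 0 < d / 2 := by positivity
  have hpos : 0 ≤ C * δi ^ 2 * δj ^ ((k : ℝ) / 2) := by positivity
  have hR2 : 3 / 2 * ((d / 2) ^ 2)⁻¹ = 6 * (d ^ 2)⁻¹ := by field_simp; norm_num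
  refine ⟨fun h3 => ?_, fun h4 => ?_, fun h5 => ?_⟩
  · obtain rfl : k = 1 := by lia
    have hM : ((d / 2) ^ 1)⁻¹ * coreMass 1 δi (d / 2) ≤ 4 * (d⁻¹ * δi⁻¹) := by
      calc _ ≤ ((d / 2) ^ 1)⁻¹ * (2 * δi⁻¹) := by
            gcongr
            exact coreMass_one_le hi hR
        _ = _ := by field_simp; norm_num
    have hdd : (d ^ 2)⁻¹ ≤ d⁻¹ * δi⁻¹ := by
      rw [sq, mul_inv]
      gcongr
    refine hI.trans ((mul_le_mul_of_nonneg_left (b := _) (c := 10 * (d⁻¹ * δi⁻¹))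
      (by linarith) hpos).trans_eq ?_)
    push_cast
    field_simp
  · obtain rfl : k = 2 := by lia
    have hlog : 1 ≤ log (2 + d / δi) := by
      rw [le_log_iff_exp_le (by positivity)]
      have : 1 ≤ d / δi := (one_le_div hi).2 hd
      linarith [exp_one_lt_d9]
    have hM : ((d / 2) ^ 2)⁻¹ * coreMass 2 δi (d / 2) ≤
        4 * ((d ^ 2)⁻¹ * log (2 + d / δi)) := by
      calc _ ≤ ((d / 2) ^ 2)⁻¹ * log (2 + 2 * (d / 2) / δi) := by
            gcongr
            exact coreMass_two_le hi hR
        _ = _ := by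
            rw [mul_div_cancel₀ d two_ne_zero]
            field_simp
            ring
    have hdd : (d ^ 2)⁻¹ ≤ (d ^ 2)⁻¹ * log (2 + d / δi) :=
      le_mul_of_one_le_right (by positivity) hlog
    refine hI.trans ((mul_le_mul_of_nonneg_left (b := _)
      (c := 10 * ((d ^ 2)⁻¹ * log (2 + d / δi))) (by linarith) hpos).trans_eq ?_)
    push_cast
    rw [div_self two_ne_zero, rpow_one]
    ring
  · obtain ⟨m, rfl⟩ : ∃ m, k = m + 3 := ⟨k - 3, by lia⟩
    have hM : ((d / 2) ^ (m + 3))⁻¹ * coreMass (m + 3) δi (d / 2) ≤ 4 * (d ^ 2)⁻¹ := by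
      calc _ ≤ ((d / 2) ^ (m + 3))⁻¹ * (d / 2) ^ (m + 1) := by
            gcongr
            exact coreMass_add_three_le m hi hR
        _ = ((d / 2) ^ 2)⁻¹ := by
            rw [show m + 3 = (m + 1) + 2 by ring, pow_add]
            field_simp
        _ = _ := by field_simp; norm_num
    refine hI.trans ((mul_le_mul_of_nonneg_left (b := _)
      (c := 10 * (d ^ 2)⁻¹) (by linarith) hpos).trans_eq ?_)
    ring
end

section
/- Let n ≥ 3 be an integer and Ω ⊂ ℝⁿ a bounded open set. There exists a constant C = C(n, Ω) > 0 such that for all δ_i, δ_j ∈ (0, 1] and ξ_i, ξ_j ∈ ℝⁿ with d := |ξ_i − ξ_j| ≥ max(δ_i, δ_j), one has: ∫_Ω U_{δ_i,ξ_i} U_{δ_j,ξ_j} dx ≤ C (δ_i δ_j)^{1/2} if n = 3; ∫_Ω U_{δ_i,ξ_i} U_{δ_j,ξ_j} dx ≤ C δ_i δ_j (1 + |log d|) if n = 4; and ∫_Ω U_{δ_i,ξ_i} U_{δ_j,ξ_j} dx ≤ C (δ_i δ_j)^{(n−2)/2} d^{−(n−4)} if n ≥ 5. -/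
open MeasureTheory

open Set

/-- Dropping `δ²` in the denominator bounds a bubble by a multiple of the Newtonian kernel. -/
lemma bubble_le_inv_norm_pow (m : ℕ) {δ : ℝ} (hδ : 0 < δ) {ξ x : EuclideanSpace ℝ (Fin (m + 3))}
    (hx : x ≠ ξ) :
    bubble (m + 3) δ ξ x ≤
      (((m + 3 : ℕ) : ℝ) * (((m + 3 : ℕ) : ℝ) - 2)) ^ ((((m + 3 : ℕ) : ℝ) - 2) / 4) *
        δ ^ ((((m + 3 : ℕ) : ℝ) - 2) / 2) * (‖x - ξ‖ ^ (m + 1))⁻¹ := by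
  have hr : 0 < ‖x - ξ‖ := norm_pos_iff.2 (sub_ne_zero.2 hx)
  have hm : (0 : ℝ) ≤ m := Nat.cast_nonneg m
  have hn : (((m + 3 : ℕ) : ℝ) - 2) = m + 1 := by push_cast; ring
  unfold bubble
  rw [mul_assoc, hn]
  gcongr
  calc (δ / (δ ^ 2 + ‖x - ξ‖ ^ 2)) ^ (((m : ℝ) + 1) / 2)
      ≤ (δ / ‖x - ξ‖ ^ 2) ^ (((m : ℝ) + 1) / 2) := by
        gcongr
        nlinarith
    _ = δ ^ (((m : ℝ) + 1) / 2) * (‖x - ξ‖ ^ (m + 1))⁻¹ := by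
        rw [Real.div_rpow hδ.le (by positivity), div_eq_mul_inv, ← Real.rpow_natCast ‖x - ξ‖ 2,
          ← Real.rpow_mul hr.le, ← Real.rpow_natCast ‖x - ξ‖ (m + 1)]
        congr 3
        push_cast
        ring

lemma inv_pow_mul_inv_pow_le_of_le (m : ℕ) {r s d : ℝ} (hr : 0 < r) (hrs : r ≤ s) (hd : 0 < d)
    (h : d ≤ r + s) :
    (r ^ (m + 1))⁻¹ * (s ^ (m + 1))⁻¹ ≤ 3 ^ (m + 1) * (r ^ (m + 2))⁻¹ * ((r + d) ^ m)⁻¹ := by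
  have hs : (r + d) ^ (m + 1) ≤ 3 ^ (m + 1) * s ^ (m + 1) := by
    rw [← mul_pow]
    gcongr
    linarith
  have hs0 : 0 < s := hr.trans_le hrs
  have hle : (r + d) ^ m * r ≤ 3 ^ (m + 1) * s ^ (m + 1) := by
    refine le_trans ?_ hs
    rw [pow_succ]
    gcongr
    linarith
  have : (s ^ (m + 1))⁻¹ ≤ 3 ^ (m + 1) * (r⁻¹ * ((r + d) ^ m)⁻¹) := by
    rw [inv_le_iff_one_le_mul₀ (by positivity)]
    have e : 3 ^ (m + 1) * (r⁻¹ * ((r + d) ^ m)⁻¹) * s ^ (m + 1)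
        = 3 ^ (m + 1) * s ^ (m + 1) / ((r + d) ^ m * r) := by
      field_simp
    rw [e, one_le_div (by positivity)]
    exact hle
  calc (r ^ (m + 1))⁻¹ * (s ^ (m + 1))⁻¹
      ≤ (r ^ (m + 1))⁻¹ * (3 ^ (m + 1) * (r⁻¹ * ((r + d) ^ m)⁻¹)) := by gcongr
    _ = 3 ^ (m + 1) * (r ^ (m + 2))⁻¹ * ((r + d) ^ m)⁻¹ := by
      rw [pow_succ r (m + 1), mul_inv]
      ring

/-- A radial majorant of the product of two Newtonian kernels with poles at distance `d`, truncated
to the radii in `S`. -/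
noncomputable def radialMajorant (m : ℕ) (d : ℝ) (S : Set ℝ) : ℝ → ℝ :=
  S.indicator fun r => 3 ^ (m + 1) * (r ^ (m + 2))⁻¹ * ((r + d) ^ m)⁻¹

lemma radialMajorant_nonneg (m : ℕ) {d r : ℝ} (S : Set ℝ) (hd : 0 < d) (hr : 0 ≤ r) :
    0 ≤ radialMajorant m d S r :=
  indicator_apply_nonneg fun _ => by positivity

lemma inv_pow_mul_inv_pow_le_add_radialMajorant (m : ℕ) {r s d c : ℝ} {S : Set ℝ}
    (hS : ∀ r, 0 < r → r ∉ S → (r ^ (m + 1))⁻¹ * (r ^ (m + 1))⁻¹ ≤ c) (hc : 0 ≤ c)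
    (hr : 0 < r) (hs : 0 < s) (hd : 0 < d) (h : d ≤ r + s) :
    (r ^ (m + 1))⁻¹ * (s ^ (m + 1))⁻¹ ≤
      c + (radialMajorant m d S r + radialMajorant m d S s) := by
  wlog hrs : r ≤ s generalizing r s
  · rw [mul_comm, add_comm (radialMajorant m d S r)]
    exact this hs hr (by linarith) (by linarith)
  have h₁ := radialMajorant_nonneg m S hd hr.le
  have h₂ := radialMajorant_nonneg m S hd hs.le
  by_cases hrS : r ∈ S
  · have h₃ := inv_pow_mul_inv_pow_le_of_le m hr hrs hd h
    have h₄ : radialMajorant m d S r = 3 ^ (m + 1) * (r ^ (m + 2))⁻¹ * ((r + d) ^ m)⁻¹ :=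
      indicator_of_mem hrS _
    linarith
  · have h₃ : (r ^ (m + 1))⁻¹ * (s ^ (m + 1))⁻¹ ≤ (r ^ (m + 1))⁻¹ * (r ^ (m + 1))⁻¹ := by gcongr
    linarith [hS r hr hrS]

lemma pow_smul_radialMajorant (m : ℕ) {d r : ℝ} (S : Set ℝ) (hr : 0 < r) :
    r ^ (Module.finrank ℝ (EuclideanSpace ℝ (Fin (m + 3))) - 1) • radialMajorant m d S r =
      S.indicator (fun r => 3 ^ (m + 1) * ((r + d) ^ m)⁻¹) r := by
  by_cases h : r ∈ S
  · simp only [radialMajorant, h, indicator_of_mem, finrank_euclideanSpace, Fintype.card_fin,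
      smul_eq_mul, show m + 3 - 1 = m + 2 from rfl]
    field_simp
  · simp [radialMajorant, h]

lemma integrable_radialMajorant_norm (m : ℕ) {d : ℝ} {S : Set ℝ} (hSm : MeasurableSet S)
    (hi : IntegrableOn (fun r => ((r + d) ^ m)⁻¹) S) :
    Integrable fun x : EuclideanSpace ℝ (Fin (m + 3)) => radialMajorant m d S ‖x‖ := by
  rw [integrable_fun_norm_addHaar (μ := volume) (f := radialMajorant m d S),
    integrableOn_congr_fun (s := Ioi 0) (g := S.indicator fun r => 3 ^ (m + 1) * ((r + d) ^ m)⁻¹)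
      (fun r hr => pow_smul_radialMajorant m S hr) measurableSet_Ioi]
  exact ((integrable_indicator_iff hSm).2 (hi.const_mul _)).integrableOn

lemma integral_radialMajorant_norm (m : ℕ) {d : ℝ} {S : Set ℝ} (hSm : MeasurableSet S)
    (hS : S ⊆ Ioi 0) :
    ∫ x : EuclideanSpace ℝ (Fin (m + 3)), radialMajorant m d S ‖x‖ =
      (m + 3 : ℕ) * volume.real (Metric.ball (0 : EuclideanSpace ℝ (Fin (m + 3))) 1) * 3 ^ (m + 1) *
        ∫ r in S, ((r + d) ^ m)⁻¹ := by
  rw [integral_fun_norm_addHaar volume (radialMajorant m d S),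
    setIntegral_congr_fun measurableSet_Ioi (fun r hr => pow_smul_radialMajorant m S hr),
    setIntegral_indicator hSm, inter_eq_right.2 hS, integral_const_mul]
  simp only [finrank_euclideanSpace, Fintype.card_fin, nsmul_eq_mul, smul_eq_mul]
  ring

/-- The interaction integral of two bubbles is controlled by a one-dimensional integral. -/
lemma setIntegral_bubble_mul_bubble_le (m : ℕ) {Ω : Set (EuclideanSpace ℝ (Fin (m + 3)))}
    (hΩ : volume Ω ≠ ⊤) {δi δj c : ℝ} {ξi ξj : EuclideanSpace ℝ (Fin (m + 3))}
    (hδi : 0 < δi) (hδj : 0 < δj) (hd : 0 < ‖ξi - ξj‖) {S : Set ℝ} (hSm : MeasurableSet S)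
    (hSpos : S ⊆ Ioi 0) (hc : 0 ≤ c)
    (hS : ∀ r, 0 < r → r ∉ S → (r ^ (m + 1))⁻¹ * (r ^ (m + 1))⁻¹ ≤ c)
    (hi : IntegrableOn (fun r => ((r + ‖ξi - ξj‖) ^ m)⁻¹) S) :
    ∫ x in Ω, bubble (m + 3) δi ξi x * bubble (m + 3) δj ξj x ≤
      ((((m + 3 : ℕ) : ℝ) * (((m + 3 : ℕ) : ℝ) - 2)) ^ ((((m + 3 : ℕ) : ℝ) - 2) / 4)) ^ 2 *
        (δi * δj) ^ ((((m + 3 : ℕ) : ℝ) - 2) / 2) *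
        (c * volume.real Ω + 2 * ((m + 3 : ℕ) *
          volume.real (Metric.ball (0 : EuclideanSpace ℝ (Fin (m + 3))) 1) * 3 ^ (m + 1)) *
          ∫ r in S, ((r + ‖ξi - ξj‖) ^ m)⁻¹) := by
  set d := ‖ξi - ξj‖ with hd_def
  have hn0 : (0 : ℝ) ≤ ((m + 3 : ℕ) : ℝ) - 2 := by push_cast; linarith [m.cast_nonneg (α := ℝ)]
  set A := (((m + 3 : ℕ) : ℝ) * (((m + 3 : ℕ) : ℝ) - 2)) ^ ((((m + 3 : ℕ) : ℝ) - 2) / 4)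
    with hA_def
  have hA : 0 ≤ A := by positivity
  set p := (((m + 3 : ℕ) : ℝ) - 2) / 2 with hp
  have hF := integrable_radialMajorant_norm m hSm hi
  have hFi (ξ) := hF.comp_sub_right ξ
  have hpos (ξ x) : 0 ≤ radialMajorant m d S ‖x - ξ‖ :=
    radialMajorant_nonneg m S hd (norm_nonneg (x - ξ : EuclideanSpace ℝ (Fin (m + 3))))
  have hint (ξ) : ∫ x in Ω, radialMajorant m d S ‖x - ξ‖ ≤
      (m + 3 : ℕ) * volume.real (Metric.ball (0 : EuclideanSpace ℝ (Fin (m + 3))) 1) * 3 ^ (m + 1) *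
        ∫ r in S, ((r + d) ^ m)⁻¹ := by
    rw [← integral_radialMajorant_norm m hSm hSpos]
    refine (setIntegral_le_integral (hFi ξ) (.of_forall (hpos ξ))).trans_eq ?_
    exact integral_sub_right_eq_self (fun x => radialMajorant m d S ‖x‖) ξ
  have hconst : IntegrableOn (fun _ : EuclideanSpace ℝ (Fin (m + 3)) => c) Ω :=
    integrableOn_const hΩ
  have hsum : IntegrableOn
      (fun x => radialMajorant m d S ‖x - ξi‖ + radialMajorant m d S ‖x - ξj‖) Ω :=
    (hFi ξi).integrableOn.add (hFi ξj).integrableOn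
  have hmono : ∫ x in Ω, bubble (m + 3) δi ξi x * bubble (m + 3) δj ξj x ≤
      ∫ x in Ω, A ^ 2 * (δi * δj) ^ p *
        (c + (radialMajorant m d S ‖x - ξi‖ + radialMajorant m d S ‖x - ξj‖)) := by
    refine integral_mono_of_nonneg (.of_forall fun x => ?_) ((hconst.add hsum).const_mul _) ?_
    · simp only [bubble, Pi.zero_apply]
      positivity
    · refine ae_restrict_of_ae ?_
      filter_upwards [Measure.ae_ne volume ξi, Measure.ae_ne volume ξj] with x hxi hxj
      have hri : 0 < ‖x - ξi‖ := norm_pos_iff.2 (sub_ne_zero.2 hxi)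
      have hrj : 0 < ‖x - ξj‖ := norm_pos_iff.2 (sub_ne_zero.2 hxj)
      have htri : d ≤ ‖x - ξi‖ + ‖x - ξj‖ := by
        rw [hd_def, norm_sub_rev x ξi]
        exact norm_sub_le_norm_sub_add_norm_sub ξi x ξj
      have hbj : 0 ≤ bubble (m + 3) δj ξj x := by unfold bubble; positivity
      calc bubble (m + 3) δi ξi x * bubble (m + 3) δj ξj x
          ≤ (A * δi ^ p * (‖x - ξi‖ ^ (m + 1))⁻¹) * (A * δj ^ p * (‖x - ξj‖ ^ (m + 1))⁻¹) :=
            mul_le_mul (bubble_le_inv_norm_pow m hδi hxi) (bubble_le_inv_norm_pow m hδj hxj) hbj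
              (by positivity)
        _ = A ^ 2 * (δi * δj) ^ p * ((‖x - ξi‖ ^ (m + 1))⁻¹ * (‖x - ξj‖ ^ (m + 1))⁻¹) := by
            rw [Real.mul_rpow hδi.le hδj.le]
            ring
        _ ≤ _ := by
            gcongr
            exact inv_pow_mul_inv_pow_le_add_radialMajorant m hS hc hri hrj hd htri
  refine hmono.trans ?_
  rw [integral_const_mul, integral_add hconst hsum,
    integral_add (hFi ξi).integrableOn (hFi ξj).integrableOn, setIntegral_const, smul_eq_mul]
  refine mul_le_mul_of_nonneg_left ?_ (by positivity)
  linarith [hint ξi, hint ξj, mul_comm c (volume.real Ω)]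

lemma setIntegral_Ioo_inv_add_le {d : ℝ} (hd : 0 < d) :
    IntegrableOn (fun r => (r + d)⁻¹) (Ioo 0 1) ∧
      ∫ r in Ioo 0 1, (r + d)⁻¹ ≤ 1 + |Real.log d| := by
  have hcont : ContinuousOn (fun r : ℝ => (r + d)⁻¹) (Icc 0 1) := by
    refine ContinuousOn.inv₀ (by fun_prop) fun r hr => ?_
    linarith [hr.1]
  refine ⟨hcont.integrableOn_Icc.mono_set Ioo_subset_Icc_self, ?_⟩
  rw [← integral_Ioc_eq_integral_Ioo, ← intervalIntegral.integral_of_le zero_le_one,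
    intervalIntegral.integral_comp_add_right (fun r => r⁻¹), zero_add,
    integral_inv_of_pos hd (by linarith), Real.log_div (by linarith) hd.ne']
  have hlog2 : Real.log 2 < 1 := Real.log_two_lt_d9.trans (by norm_num)
  rcases le_total d 1 with h | h
  · have : Real.log (1 + d) ≤ Real.log 2 := Real.log_le_log (by linarith) (by linarith)
    linarith [neg_abs_le (Real.log d)]
  · have : Real.log (1 + d) ≤ Real.log 2 + Real.log d := by
      rw [← Real.log_mul (by norm_num) hd.ne']
      exact Real.log_le_log (by linarith) (by linarith)
    linarith [abs_nonneg (Real.log d)]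

lemma setIntegral_Ioi_inv_add_pow_le {m : ℕ} (hm : 2 ≤ m) {d : ℝ} (hd : 0 < d) :
    IntegrableOn (fun r => ((r + d) ^ m)⁻¹) (Ioi 0) ∧
      ∫ r in Ioi 0, ((r + d) ^ m)⁻¹ ≤ d ^ (-((m : ℝ) - 1)) := by
  have hm' : (2 : ℝ) ≤ m := by exact_mod_cast hm
  have heq : EqOn (fun r : ℝ => ((r + d) ^ m)⁻¹) (fun r => (r + d) ^ (-(m : ℝ))) (Ioi 0) := by
    intro r hr
    have : 0 < r + d := add_pos hr hd
    simp only [Real.rpow_neg this.le, Real.rpow_natCast]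
  refine ⟨(integrableOn_congr_fun heq measurableSet_Ioi).2
    (integrableOn_add_rpow_Ioi_of_lt (by linarith) (by linarith)), ?_⟩
  have hshift := (measurePreserving_add_right volume d).setIntegral_preimage_emb
    (measurableEmbedding_addRight d) (fun r => r ^ (-(m : ℝ))) (Ioi d)
  rw [preimage_add_const_Ioi, sub_self] at hshift
  rw [setIntegral_congr_fun measurableSet_Ioi heq, hshift,
    integral_Ioi_rpow_of_lt (by linarith) hd, show -(m : ℝ) + 1 = -((m : ℝ) - 1) by ring,
    neg_div_neg_eq]
  exact div_le_self (by positivity) (by linarith)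

/-- Interaction estimate `∫_Ω U_i U_j` when the centers are at distance
`≥ max(δ_i, δ_j)`. -/
theorem bubble_product_interaction_estimate (n : ℕ) (hn : 3 ≤ n)
    (Ω : Set (EuclideanSpace ℝ (Fin n))) (hΩo : IsOpen Ω) (hΩb : Bornology.IsBounded Ω) :
    ∃ C : ℝ, 0 < C ∧
      ∀ (δi δj : ℝ) (ξi ξj : EuclideanSpace ℝ (Fin n)),
        0 < δi → δi ≤ 1 → 0 < δj → δj ≤ 1 → max δi δj ≤ ‖ξi - ξj‖ →
        (n = 3 →
          ∫ x in Ω, bubble n δi ξi x * bubble n δj ξj x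
            ≤ C * (δi * δj) ^ ((1 : ℝ) / 2)) ∧
        (n = 4 →
          ∫ x in Ω, bubble n δi ξi x * bubble n δj ξj x
            ≤ C * δi * δj * (1 + |Real.log ‖ξi - ξj‖|)) ∧
        (5 ≤ n →
          ∫ x in Ω, bubble n δi ξi x * bubble n δj ξj x
            ≤ C * (δi * δj) ^ (((n : ℝ) - 2) / 2) * ‖ξi - ξj‖ ^ (-((n : ℝ) - 4))) := by
  obtain ⟨m, rfl⟩ : ∃ m, n = m + 3 := ⟨n - 3, by omega⟩
  have hΩ : volume Ω ≠ ⊤ := hΩb.measure_lt_top.ne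
  set A := ((((m + 3 : ℕ) : ℝ) * (((m + 3 : ℕ) : ℝ) - 2)) ^ ((((m + 3 : ℕ) : ℝ) - 2) / 4)) ^ 2
    with hA
  set B := ((m + 3 : ℕ) *
    volume.real (Metric.ball (0 : EuclideanSpace ℝ (Fin (m + 3))) 1) * 3 ^ (m + 1) : ℝ) with hB
  have hA0 : 0 ≤ A := by positivity
  have hB0 : 0 ≤ B := by positivity
  have hV0 : 0 ≤ volume.real Ω := measureReal_nonneg
  refine ⟨A * (volume.real Ω + 2 * B) + 1, by positivity, ?_⟩
  intro δi δj ξi ξj hi0 _ hj0 _ hmax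
  have hd : 0 < ‖ξi - ξj‖ := hi0.trans_le ((le_max_left _ _).trans hmax)
  have htail (r : ℝ) (hr : 0 < r) (hrS : r ∉ Ioo (0 : ℝ) 1) :
      (r ^ (m + 1))⁻¹ * (r ^ (m + 1))⁻¹ ≤ 1 := by
    have h1 : 1 ≤ r := not_lt.1 fun h => hrS ⟨hr, h⟩
    have h2 : (r ^ (m + 1))⁻¹ ≤ 1 := inv_le_one_of_one_le₀ (one_le_pow₀ h1)
    exact mul_le_one₀ h2 (by positivity) h2
  refine ⟨fun h => ?_, fun h => ?_, fun h => ?_⟩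
  · obtain rfl : m = 0 := by omega
    have key := setIntegral_bubble_mul_bubble_le 0 hΩ hi0 hj0 hd measurableSet_Ioo
      (fun r hr => hr.1) zero_le_one htail (by simp)
    refine key.trans ?_
    rw [← hA, ← hB, show (((0 + 3 : ℕ) : ℝ) - 2) / 2 = 1 / 2 by norm_num]
    have hJ : ∫ r in Ioo (0 : ℝ) 1, ((r + ‖ξi - ξj‖) ^ 0)⁻¹ = 1 := by simp
    rw [hJ, mul_right_comm]
    gcongr
    linarith
  · obtain rfl : m = 1 := by omega
    obtain ⟨hI, hJ⟩ := setIntegral_Ioo_inv_add_le hd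
    have key := setIntegral_bubble_mul_bubble_le 1 hΩ hi0 hj0 hd measurableSet_Ioo
      (fun r hr => hr.1) zero_le_one htail (by simpa using hI)
    refine key.trans ?_
    rw [← hA, ← hB, show (((1 + 3 : ℕ) : ℝ) - 2) / 2 = 1 by norm_num, Real.rpow_one]
    simp only [pow_one]
    set L := 1 + |Real.log ‖ξi - ξj‖|
    have hL : 1 ≤ L := le_add_of_nonneg_right (abs_nonneg _)
    calc A * (δi * δj) * (1 * volume.real Ω + 2 * B * ∫ r in Ioo 0 1, (r + ‖ξi - ξj‖)⁻¹)
        ≤ A * (δi * δj) * (L * volume.real Ω + 2 * B * L) := by gcongr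
      _ = A * (volume.real Ω + 2 * B) * δi * δj * L := by ring
      _ ≤ (A * (volume.real Ω + 2 * B) + 1) * δi * δj * L := by
        gcongr
        linarith
  · obtain ⟨hI, hJ⟩ := setIntegral_Ioi_inv_add_pow_le (m := m) (by omega) hd
    have key := setIntegral_bubble_mul_bubble_le m hΩ hi0 hj0 hd measurableSet_Ioi
      subset_rfl le_rfl (fun r hr hrS => absurd hr hrS) hI
    refine key.trans ?_
    rw [← hA, ← hB, show -(((m + 3 : ℕ) : ℝ) - 4) = -((m : ℝ) - 1) by push_cast; ring]
    set q := (δi * δj) ^ ((((m + 3 : ℕ) : ℝ) - 2) / 2)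
    have hq : 0 ≤ q := by positivity
    set D := ‖ξi - ξj‖ ^ (-((m : ℝ) - 1))
    have hD : 0 ≤ D := by positivity
    calc A * q * (0 * volume.real Ω + 2 * B * ∫ r in Ioi 0, ((r + ‖ξi - ξj‖) ^ m)⁻¹)
        ≤ A * q * (0 * volume.real Ω + 2 * B * D) := by gcongr
      _ = A * (2 * B) * q * D := by ring
      _ ≤ (A * (volume.real Ω + 2 * B) + 1) * q * D := by
        gcongr
        nlinarith [mul_nonneg hA0 hV0]
end

section
/- In dimension n = 6 there is a constant C > 0 with the following property. For all δ, d > 0 with 2δ ≤ d and every ξ ∈ ℝ⁶, writing κ := δ/d and x₁ := (x−ξ)/δ, and defining the weights w₃ⁱⁿ(x) := (δ²/d⁴) (1+|x₁|²)^{−1} for |x₁| ≤ d/δ (and 0 otherwise) and w₃ᵒᵘᵗ(x) := (δ/d³) |x₁|^{−3} for |x₁| ≥ d/δ (and 0 otherwise), one has ∫_{ℝ⁶} (w₃ⁱⁿ(x) + w₃ᵒᵘᵗ(x)) U_{δ,ξ}(x) dx ≤ C δ² κ⁴ (1 + |log κ|). -/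
open MeasureTheory

/-- The Aubin–Talenti bubble in dimension `6`: `U_{δ,ξ}(x) = 24 (δ/(δ²+|x−ξ|²))²`. -/
noncomputable def bubble6 (δ : ℝ) (ξ x : EuclideanSpace ℝ (Fin 6)) : ℝ :=
  24 * (δ / (δ ^ 2 + ‖x - ξ‖ ^ 2)) ^ 2

open Set

theorem setIntegral_Ioc_id_div_sq_add_sq {δ d : ℝ} (hδ : 0 < δ) (hd : 0 < d) :
    IntegrableOn (fun r : ℝ => r / (δ ^ 2 + r ^ 2)) (Ioc 0 d) ∧
      ∫ r in Ioc 0 d, r / (δ ^ 2 + r ^ 2) =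
        Real.log (δ ^ 2 + d ^ 2) / 2 - Real.log (δ ^ 2) / 2 := by
  have hpos : ∀ r : ℝ, δ ^ 2 + r ^ 2 ≠ 0 := fun r => by positivity
  have hcont : Continuous fun r : ℝ => r / (δ ^ 2 + r ^ 2) :=
    continuous_id.div (by fun_prop) hpos
  have hint : IntervalIntegrable (fun r : ℝ => r / (δ ^ 2 + r ^ 2)) volume 0 d :=
    hcont.intervalIntegrable 0 d
  refine ⟨(intervalIntegrable_iff_integrableOn_Ioc_of_le hd.le).1 hint, ?_⟩
  rw [← intervalIntegral.integral_of_le hd.le,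
    intervalIntegral.integral_eq_sub_of_hasDerivAt
      (f := fun r => Real.log (δ ^ 2 + r ^ 2) / 2) (fun r _ => ?_) hint]
  · simp
  · have h := (((hasDerivAt_pow 2 r).const_add (δ ^ 2)).log (hpos r)).div_const 2
    refine h.congr_deriv ?_
    have := hpos r
    push_cast
    field_simp

theorem log_sq_add_sq_sub_le {δ d : ℝ} (hδ : 0 < δ) (hδd : δ ≤ d) :
    Real.log (δ ^ 2 + d ^ 2) / 2 - Real.log (δ ^ 2) / 2 ≤ 1 + |Real.log (δ / d)| := by
  have hd : 0 < d := hδ.trans_le hδd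
  have h1 : Real.log (δ ^ 2 + d ^ 2) ≤ Real.log (2 * d ^ 2) :=
    Real.log_le_log (by positivity) (by nlinarith)
  have h2 : Real.log 2 ≤ 1 := by linarith [Real.log_two_lt_d9]
  have h3 := neg_le_abs (Real.log (δ / d))
  rw [Real.log_mul (by norm_num) (by positivity), Real.log_pow] at h1
  rw [Real.log_div hδ.ne' hd.ne'] at h3 ⊢
  rw [Real.log_pow]
  push_cast at h1 ⊢
  linarith

/-- The integrand as a function of `r = ‖x - ξ‖`. -/
noncomputable def weightedBubbleProfile (δ d r : ℝ) : ℝ :=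
  ((if r / δ ≤ d / δ then δ ^ 2 / d ^ 4 * (1 + (r / δ) ^ 2)⁻¹ else 0) +
    (if d / δ ≤ r / δ then δ / d ^ 3 * ((r / δ) ^ 3)⁻¹ else 0)) *
      (24 * (δ / (δ ^ 2 + r ^ 2)) ^ 2)

theorem weightedBubbleProfile_nonneg {δ d r : ℝ} (hδ : 0 < δ) (hd : 0 < d) (hr : 0 < r) :
    0 ≤ weightedBubbleProfile δ d r := by
  unfold weightedBubbleProfile
  refine mul_nonneg (add_nonneg ?_ ?_) (by positivity) <;> split_ifs <;> positivity

theorem pow_mul_weightedBubbleProfile_le {δ d r : ℝ} (hδ : 0 < δ) (hd : 0 < d) (hr : 0 < r) :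
    r ^ 5 * weightedBubbleProfile δ d r ≤
      (Iic d).indicator (fun r => 24 * δ ^ 6 / d ^ 4 * (r / (δ ^ 2 + r ^ 2))) r +
        (Ici d).indicator (fun r => 24 * δ ^ 6 / d ^ 3 * r ^ (-2 : ℝ)) r := by
  have hin : r ^ 5 * (δ ^ 2 / d ^ 4 * (1 + (r / δ) ^ 2)⁻¹ * (24 * (δ / (δ ^ 2 + r ^ 2)) ^ 2)) ≤
      24 * δ ^ 6 / d ^ 4 * (r / (δ ^ 2 + r ^ 2)) := by
    have e : r ^ 5 * (δ ^ 2 / d ^ 4 * (1 + (r / δ) ^ 2)⁻¹ *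
        (24 * (δ / (δ ^ 2 + r ^ 2)) ^ 2)) =
        24 * δ ^ 6 / d ^ 4 * (r / (δ ^ 2 + r ^ 2)) * (r ^ 2 / (δ ^ 2 + r ^ 2)) ^ 2 := by
      field_simp
    rw [e]
    refine mul_le_of_le_one_right (by positivity) (pow_le_one₀ (by positivity) ?_)
    exact (div_le_one (by positivity)).2 (by nlinarith)
  have hout : r ^ 5 * (δ / d ^ 3 * ((r / δ) ^ 3)⁻¹ * (24 * (δ / (δ ^ 2 + r ^ 2)) ^ 2)) ≤
      24 * δ ^ 6 / d ^ 3 * r ^ (-2 : ℝ) := by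
    have e : r ^ 5 * (δ / d ^ 3 * ((r / δ) ^ 3)⁻¹ * (24 * (δ / (δ ^ 2 + r ^ 2)) ^ 2)) =
        24 * δ ^ 6 / d ^ 3 * r ^ (-2 : ℝ) * (r ^ 2 / (δ ^ 2 + r ^ 2)) ^ 2 := by
      rw [Real.rpow_neg hr.le, Real.rpow_two]
      field_simp
    rw [e]
    refine mul_le_of_le_one_right (by positivity) (pow_le_one₀ (by positivity) ?_)
    exact (div_le_one (by positivity)).2 (by nlinarith)
  unfold weightedBubbleProfile
  rw [add_mul, mul_add]
  simp only [indicator, mem_Iic, mem_Ici, div_le_div_iff_of_pos_right hδ]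
  refine add_le_add ?_ ?_
  · split_ifs
    · exact hin
    · simp
  · split_ifs
    · exact hout
    · simp

theorem setIntegral_Ioi_pow_mul_weightedBubbleProfile_le {δ d : ℝ} (hδ : 0 < δ) (hδd : δ ≤ d) :
    ∫ r in Ioi (0 : ℝ), r ^ 5 * weightedBubbleProfile δ d r ≤
      48 * (δ ^ 2 * (δ / d) ^ 4 * (1 + |Real.log (δ / d)|)) := by
  have hd : 0 < d := hδ.trans_le hδd
  obtain ⟨hi, hI⟩ := setIntegral_Ioc_id_div_sq_add_sq hδ hd
  have hj : IntegrableOn (fun r : ℝ => r ^ (-2 : ℝ)) (Ioi d) :=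
    integrableOn_Ioi_rpow_of_lt (by norm_num) hd
  have hJ : ∫ r in Ioi d, r ^ (-2 : ℝ) = d⁻¹ := by
    rw [integral_Ioi_rpow_of_lt (by norm_num) hd]
    norm_num [Real.rpow_neg_one]
  have hinter₁ : Ioi (0 : ℝ) ∩ Iic d = Ioc 0 d := Ioi_inter_Iic
  have hinter₂ : Ioi (0 : ℝ) ∩ Ici d = Ici d :=
    inter_eq_right.2 fun r (hr : d ≤ r) => hd.trans_le hr
  have hint₁ : IntegrableOn
      ((Iic d).indicator fun r : ℝ => 24 * δ ^ 6 / d ^ 4 * (r / (δ ^ 2 + r ^ 2))) (Ioi 0) := by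
    rw [integrableOn_indicator_iff measurableSet_Iic, inter_comm, hinter₁]
    exact hi.const_mul _
  have hint₂ : IntegrableOn
      ((Ici d).indicator fun r : ℝ => 24 * δ ^ 6 / d ^ 3 * r ^ (-2 : ℝ)) (Ioi 0) := by
    rw [integrableOn_indicator_iff measurableSet_Ici, inter_comm, hinter₂,
      integrableOn_Ici_iff_integrableOn_Ioi]
    exact hj.const_mul _
  calc
    _ ≤ ∫ r in Ioi (0 : ℝ),
        ((Iic d).indicator (fun r => 24 * δ ^ 6 / d ^ 4 * (r / (δ ^ 2 + r ^ 2))) r +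
          (Ici d).indicator (fun r => 24 * δ ^ 6 / d ^ 3 * r ^ (-2 : ℝ)) r) := by
      refine integral_mono_of_nonneg ?_ (hint₁.add hint₂) ?_ <;>
        refine (ae_restrict_iff' measurableSet_Ioi).2 (.of_forall fun r hr => ?_)
      · exact mul_nonneg (pow_nonneg (le_of_lt hr) 5) (weightedBubbleProfile_nonneg hδ hd hr)
      · exact pow_mul_weightedBubbleProfile_le hδ hd hr
    _ = 24 * δ ^ 6 / d ^ 4 * (Real.log (δ ^ 2 + d ^ 2) / 2 - Real.log (δ ^ 2) / 2) +
        24 * δ ^ 6 / d ^ 3 * d⁻¹ := by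
      rw [integral_add hint₁ hint₂, setIntegral_indicator measurableSet_Iic,
        setIntegral_indicator measurableSet_Ici, hinter₁, hinter₂, integral_Ici_eq_integral_Ioi,
        integral_const_mul, integral_const_mul, hI, hJ]
    _ = 24 * (δ ^ 2 * (δ / d) ^ 4) *
        (Real.log (δ ^ 2 + d ^ 2) / 2 - Real.log (δ ^ 2) / 2 + 1) := by
      field_simp
    _ ≤ 24 * (δ ^ 2 * (δ / d) ^ 4) * (2 * (1 + |Real.log (δ / d)|)) := by
      gcongr
      linarith [log_sq_add_sq_sub_le hδ hδd, abs_nonneg (Real.log (δ / d))]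
    _ = _ := by ring

/-- In dimension `6`, with `κ = δ/d` and `x₁ = (x−ξ)/δ`, the weights
`w₃ⁱⁿ = (δ²/d⁴)(1+|x₁|²)⁻¹ 𝟙_{|x₁| ≤ d/δ}` and `w₃ᵒᵘᵗ = (δ/d³)|x₁|⁻³ 𝟙_{|x₁| ≥ d/δ}` satisfy
`∫ (w₃ⁱⁿ + w₃ᵒᵘᵗ) U_{δ,ξ} ≤ C δ² κ⁴ (1 + |log κ|)`. -/
theorem weight_against_bubble_estimate_dim6 :
    ∃ C : ℝ, 0 < C ∧ ∀ (δ d : ℝ), 0 < δ → 0 < d → 2 * δ ≤ d →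
      ∀ ξ : EuclideanSpace ℝ (Fin 6),
        ∫ x : EuclideanSpace ℝ (Fin 6),
            ((if ‖x - ξ‖ / δ ≤ d / δ then
                δ ^ 2 / d ^ 4 * (1 + (‖x - ξ‖ / δ) ^ 2)⁻¹ else 0) +
             (if d / δ ≤ ‖x - ξ‖ / δ then
                δ / d ^ 3 * ((‖x - ξ‖ / δ) ^ 3)⁻¹ else 0)) * bubble6 δ ξ x
          ≤ C * δ ^ 2 * (δ / d) ^ 4 * (1 + |Real.log (δ / d)|) := by
  set V := volume.real (Metric.ball (0 : EuclideanSpace ℝ (Fin 6)) 1)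
  have hV : 0 ≤ V := measureReal_nonneg
  refine ⟨288 * V + 1, by positivity, fun δ d hδ hd hδd ξ => ?_⟩
  change ∫ x, weightedBubbleProfile δ d ‖x - ξ‖ ≤ _
  have hb : 0 ≤ δ ^ 2 * (δ / d) ^ 4 * (1 + |Real.log (δ / d)|) := by positivity
  have h := mul_le_mul_of_nonneg_left
    (setIntegral_Ioi_pow_mul_weightedBubbleProfile_le hδ (show δ ≤ d by linarith)) hV
  rw [integral_sub_right_eq_self (fun x => weightedBubbleProfile δ d ‖x‖) ξ,
    integral_fun_norm_addHaar volume (weightedBubbleProfile δ d)]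
  simp only [finrank_euclideanSpace, Fintype.card_fin, nsmul_eq_mul, smul_eq_mul]
  norm_num only
  linarith
end

section
/- For every integer n ≥ 3 the constant 𝔞_n := p ∫_{ℝⁿ} U(x)^{p−1} Z⁰(x) dx is a (finite) strictly positive real number; that is, the function U^{p−1} Z⁰ is integrable on ℝⁿ and ∫_{ℝⁿ} U^{p−1} Z⁰ dx > 0. -/
open MeasureTheory

/-- The standard bubble `U = U_{1,0}` on `ℝⁿ`. -/
noncomputable def stdBubble (n : ℕ) (x : EuclideanSpace ℝ (Fin n)) : ℝ :=
  ((n : ℝ) * ((n : ℝ) - 2)) ^ (((n : ℝ) - 2) / 4) *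
    (1 / (1 + ‖x‖ ^ 2)) ^ (((n : ℝ) - 2) / 2)

/-- The dilation derivative `Z⁰ = δ ∂_δ U_{δ,0}|_{δ=1}` on `ℝⁿ`. -/
noncomputable def stdZ0 (n : ℕ) (x : EuclideanSpace ℝ (Fin n)) : ℝ :=
  (((n : ℝ) - 2) / 2) * ((n : ℝ) * ((n : ℝ) - 2)) ^ (((n : ℝ) - 2) / 4) *
    ((‖x‖ ^ 2 - 1) / (1 + ‖x‖ ^ 2) ^ ((n : ℝ) / 2))

open Set Filter Topology

/-- `U^{p−1} Z⁰` in closed radial form. -/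
lemma stdBubble_rpow_mul_stdZ0 (n : ℕ) (hn : 3 ≤ n) (x : EuclideanSpace ℝ (Fin n)) :
    stdBubble n x ^ (((n : ℝ) + 2) / ((n : ℝ) - 2) - 1) * stdZ0 n x =
      ((n : ℝ) * ((n : ℝ) - 2)) *
        ((((n : ℝ) - 2) / 2) * ((n : ℝ) * ((n : ℝ) - 2)) ^ (((n : ℝ) - 2) / 4)) *
        ((‖x‖ ^ 2 - 1) * (1 + ‖x‖ ^ 2) ^ (-((n : ℝ) + 4) / 2)) := by
  have h3 : (3 : ℝ) ≤ n := by exact_mod_cast hn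
  have h2 : (0 : ℝ) < (n : ℝ) - 2 := by linarith
  have hc : 0 < (n : ℝ) * ((n : ℝ) - 2) := by positivity
  have hx : 0 < 1 + ‖x‖ ^ 2 := by positivity
  have hU : stdBubble n x ^ (((n : ℝ) + 2) / ((n : ℝ) - 2) - 1) =
      ((n : ℝ) * ((n : ℝ) - 2)) * (1 + ‖x‖ ^ 2) ^ (-2 : ℝ) := by
    have e1 : ((n : ℝ) - 2) / 4 * (((n : ℝ) + 2) / ((n : ℝ) - 2) - 1) = 1 := by
      field_simp
      ring
    have e2 : ((n : ℝ) - 2) / 2 * (((n : ℝ) + 2) / ((n : ℝ) - 2) - 1) = 2 := by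
      field_simp
      ring
    rw [stdBubble, Real.mul_rpow (by positivity) (by positivity), ← Real.rpow_mul hc.le,
      ← Real.rpow_mul (by positivity), e1, e2, Real.rpow_one, one_div,
      Real.inv_rpow hx.le, Real.rpow_neg hx.le]
  have hpow : (1 + ‖x‖ ^ 2) ^ (-((n : ℝ) + 4) / 2) =
      (1 + ‖x‖ ^ 2) ^ (-2 : ℝ) * ((1 + ‖x‖ ^ 2) ^ ((n : ℝ) / 2))⁻¹ := by
    rw [← Real.rpow_neg hx.le, ← Real.rpow_add hx]
    congr 1
    ring
  rw [hU, stdZ0, hpow, div_eq_mul_inv (‖x‖ ^ 2 - 1)]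
  ring

lemma integrable_one_add_norm_sq_rpow (n : ℕ) {a : ℝ} (ha : 0 < a) :
    Integrable (fun x : EuclideanSpace ℝ (Fin n) =>
      (1 + ‖x‖ ^ 2) ^ (-((n : ℝ) + a) / 2)) :=
  integrable_rpow_neg_one_add_norm_sq (by simpa using ha)

lemma one_add_sq_rpow_split (b r : ℝ) :
    (1 + r ^ 2) ^ (-(b + 2) / 2) = (1 + r ^ 2) ^ (-(b + 4) / 2) * (1 + r ^ 2) := by
  rw [← Real.rpow_add_one (by positivity)]
  congr 1
  ring

lemma integrable_radial_divergence (n : ℕ) :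
    Integrable (fun x : EuclideanSpace ℝ (Fin n) =>
      ((n : ℝ) - 2 * ‖x‖ ^ 2) * (1 + ‖x‖ ^ 2) ^ (-((n : ℝ) + 4) / 2)) := by
  have h4 := (integrable_one_add_norm_sq_rpow n (a := 4) (by norm_num)).const_mul ((n : ℝ) + 2)
  have h2 := (integrable_one_add_norm_sq_rpow n (a := 2) (by norm_num)).const_mul 2
  refine (h4.sub h2).congr (Eventually.of_forall fun x => ?_)
  simp only [Pi.sub_apply, one_add_sq_rpow_split]
  ring

lemma hasDerivAt_pow_mul_one_add_sq_rpow {n : ℕ} (hn : n ≠ 0) (r : ℝ) :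
    HasDerivAt (fun r : ℝ => r ^ n * (1 + r ^ 2) ^ (-((n : ℝ) + 2) / 2))
      (r ^ (n - 1) * (((n : ℝ) - 2 * r ^ 2) * (1 + r ^ 2) ^ (-((n : ℝ) + 4) / 2))) r := by
  have hd : HasDerivAt (fun r : ℝ => 1 + r ^ 2) (2 * r) r := by
    simpa using (hasDerivAt_pow 2 r).const_add 1
  have h := (hasDerivAt_pow n r).mul
    (hd.rpow_const (p := -((n : ℝ) + 2) / 2) (Or.inl (by positivity)))
  refine h.congr_deriv ?_
  have he : -((n : ℝ) + 2) / 2 - 1 = -((n : ℝ) + 4) / 2 := by ring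
  rw [he, one_add_sq_rpow_split]
  obtain ⟨m, rfl⟩ := Nat.exists_eq_succ_of_ne_zero hn
  simp only [Nat.succ_eq_add_one, Nat.add_sub_cancel]
  push_cast
  ring

lemma tendsto_pow_mul_one_add_sq_rpow (n : ℕ) :
    Tendsto (fun r : ℝ => r ^ n * (1 + r ^ 2) ^ (-((n : ℝ) + 2) / 2)) atTop (𝓝 0) := by
  have hlim : Tendsto (fun r : ℝ => (1 + r ^ 2)⁻¹) atTop (𝓝 0) :=
    tendsto_inv_atTop_zero.comp
      (tendsto_atTop_add_const_left _ _ (tendsto_pow_atTop two_ne_zero))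
  refine tendsto_of_tendsto_of_tendsto_of_le_of_le' tendsto_const_nhds hlim ?_ ?_
  · filter_upwards [eventually_ge_atTop 0] with r hr
    positivity
  · filter_upwards [eventually_ge_atTop 0] with r hr
    have hp : 0 < 1 + r ^ 2 := by positivity
    have h1 : r ^ n ≤ (1 + r ^ 2) ^ ((n : ℝ) / 2) := by
      calc r ^ n = (r ^ 2) ^ ((n : ℝ) / 2) := by
            rw [← Real.rpow_natCast r 2, ← Real.rpow_mul hr, ← Real.rpow_natCast]
            congr 1
            push_cast
            ring
        _ ≤ _ := Real.rpow_le_rpow (by positivity) (by linarith) (by positivity)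
    calc r ^ n * (1 + r ^ 2) ^ (-((n : ℝ) + 2) / 2)
        ≤ (1 + r ^ 2) ^ ((n : ℝ) / 2) * (1 + r ^ 2) ^ (-((n : ℝ) + 2) / 2) := by gcongr
      _ = (1 + r ^ 2)⁻¹ := by
        rw [← Real.rpow_add hp, ← Real.rpow_neg_one]
        congr 1
        ring

lemma integral_radial_divergence (n : ℕ) (hn : n ≠ 0) :
    ∫ x : EuclideanSpace ℝ (Fin n),
      ((n : ℝ) - 2 * ‖x‖ ^ 2) * (1 + ‖x‖ ^ 2) ^ (-((n : ℝ) + 4) / 2) = 0 := by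
  have : NeZero n := ⟨hn⟩
  let f : ℝ → ℝ := fun r => ((n : ℝ) - 2 * r ^ 2) * (1 + r ^ 2) ^ (-((n : ℝ) + 4) / 2)
  have hint : IntegrableOn (fun r : ℝ => r ^ (n - 1) * f r) (Ioi 0) := by
    simpa using (integrable_fun_norm_addHaar
      (volume : Measure (EuclideanSpace ℝ (Fin n))) (f := f)).1 (integrable_radial_divergence n)
  have hzero : ∫ r in Ioi (0 : ℝ), r ^ (n - 1) * f r = 0 := by
    rw [integral_Ioi_of_hasDerivAt_of_tendsto'
      (fun r _ => hasDerivAt_pow_mul_one_add_sq_rpow hn r) hint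
      (tendsto_pow_mul_one_add_sq_rpow n)]
    simp [hn]
  have hpolar := integral_fun_norm_addHaar (volume : Measure (EuclideanSpace ℝ (Fin n))) f
  simp only [finrank_euclideanSpace, Fintype.card_fin, smul_eq_mul, hzero] at hpolar
  simpa [f] using hpolar

lemma integral_one_add_norm_sq_rpow_pos (n : ℕ) {a : ℝ} (ha : 0 < a) :
    0 < ∫ x : EuclideanSpace ℝ (Fin n), (1 + ‖x‖ ^ 2) ^ (-((n : ℝ) + a) / 2) := by
  have hpos (x : EuclideanSpace ℝ (Fin n)) : 0 < (1 + ‖x‖ ^ 2) ^ (-((n : ℝ) + a) / 2) := by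
    positivity
  rw [integral_pos_iff_support_of_nonneg (fun x => (hpos x).le)
    (integrable_one_add_norm_sq_rpow n ha),
    Function.support_eq_univ (fun x => (hpos x).ne')]
  exact isOpen_univ.measure_pos _ univ_nonempty

/-- For `n ≥ 3`, `U^{p−1} Z⁰` is integrable on `ℝⁿ` and its integral is positive; hence
`𝔞_n = p ∫ U^{p−1} Z⁰ > 0`. -/
theorem integral_bubble_pm1_Z0_pos (n : ℕ) (hn : 3 ≤ n) :
    Integrable (fun x : EuclideanSpace ℝ (Fin n) =>
      stdBubble n x ^ (((n : ℝ) + 2) / ((n : ℝ) - 2) - 1) * stdZ0 n x) ∧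
    0 < ∫ x : EuclideanSpace ℝ (Fin n),
      stdBubble n x ^ (((n : ℝ) + 2) / ((n : ℝ) - 2) - 1) * stdZ0 n x := by
  have h3 : (3 : ℝ) ≤ n := by exact_mod_cast hn
  have h2 : (0 : ℝ) < (n : ℝ) - 2 := by linarith
  have hdecomp (x : EuclideanSpace ℝ (Fin n)) :
      (‖x‖ ^ 2 - 1) * (1 + ‖x‖ ^ 2) ^ (-((n : ℝ) + 4) / 2) =
        (-1 / 2) * (((n : ℝ) - 2 * ‖x‖ ^ 2) * (1 + ‖x‖ ^ 2) ^ (-((n : ℝ) + 4) / 2)) +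
          (((n : ℝ) - 2) / 2) * (1 + ‖x‖ ^ 2) ^ (-((n : ℝ) + 4) / 2) := by
    ring
  have hi1 := (integrable_radial_divergence n).const_mul (-1 / 2)
  have hi2 := (integrable_one_add_norm_sq_rpow n (a := 4) (by norm_num)).const_mul
    (((n : ℝ) - 2) / 2)
  simp only [stdBubble_rpow_mul_stdZ0 n hn, hdecomp]
  refine ⟨(hi1.add hi2).const_mul _, ?_⟩
  rw [integral_const_mul, integral_add hi1 hi2, integral_const_mul, integral_const_mul,
    integral_radial_divergence n (by omega)]
  have hpos := integral_one_add_norm_sq_rpow_pos n (a := 4) (by norm_num)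
  rw [mul_zero, zero_add]
  positivity
end

section
/- For every integer n ≥ 5 the function U · Z⁰ is integrable on ℝⁿ and the constant 𝔟_n := ∫_{ℝⁿ} U(x) Z⁰(x) dx is strictly positive. -/
open MeasureTheory

open Filter Topology

theorem stdBubble_mul_stdZ0 (n : ℕ) (hn : 2 ≤ n) (x : EuclideanSpace ℝ (Fin n)) :
    stdBubble n x * stdZ0 n x =
      (((n : ℝ) - 2) / 2 * (((n : ℝ) * ((n : ℝ) - 2)) ^ (((n : ℝ) - 2) / 4)) ^ 2) *
        (((1 + ‖x‖ ^ 2) ^ (n - 2))⁻¹ - 2 * ((1 + ‖x‖ ^ 2) ^ (n - 1))⁻¹) := by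
  obtain ⟨k, rfl⟩ : ∃ k, n = k + 2 := ⟨n - 2, by omega⟩
  have hpos : 0 < 1 + ‖x‖ ^ 2 := by positivity
  have key : (1 + ‖x‖ ^ 2) ^ ((((k + 2 : ℕ) : ℝ) - 2) / 2) *
      (1 + ‖x‖ ^ 2) ^ (((k + 2 : ℕ) : ℝ) / 2) = (1 + ‖x‖ ^ 2) ^ (k + 1) := by
    rw [← Real.rpow_add hpos, ← Real.rpow_natCast (1 + ‖x‖ ^ 2)]
    congr 1
    push_cast
    ring
  have h₁ : (1 / (1 + ‖x‖ ^ 2)) ^ ((((k + 2 : ℕ) : ℝ) - 2) / 2) *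
      ((‖x‖ ^ 2 - 1) / (1 + ‖x‖ ^ 2) ^ (((k + 2 : ℕ) : ℝ) / 2)) =
      ((1 + ‖x‖ ^ 2) ^ k)⁻¹ - 2 * ((1 + ‖x‖ ^ 2) ^ (k + 1))⁻¹ := by
    rw [one_div, Real.inv_rpow hpos.le, inv_mul_eq_div, div_div, mul_comm, key, pow_succ]
    field_simp
    ring
  rw [show k + 2 - 2 = k by omega, show k + 2 - 1 = k + 1 by omega, ← h₁, stdBubble, stdZ0]
  ring

theorem integrable_inv_one_add_norm_sq_pow {n k : ℕ} (h : n < 2 * k) :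
    Integrable (fun x : EuclideanSpace ℝ (Fin n) => ((1 + ‖x‖ ^ 2) ^ k)⁻¹) := by
  have hr : (Module.finrank ℝ (EuclideanSpace ℝ (Fin n)) : ℝ) < 2 * k := by
    rw [finrank_euclideanSpace_fin]
    exact_mod_cast h
  refine (integrable_rpow_neg_one_add_norm_sq (μ := volume) hr).congr (ae_of_all _ fun x => ?_)
  have hpos : 0 < 1 + ‖x‖ ^ 2 := by positivity
  simp only
  rw [show -(2 * (k : ℝ)) / 2 = -(k : ℝ) by ring, Real.rpow_neg hpos.le, Real.rpow_natCast]

theorem hasDerivAt_pow_div_one_add_sq_pow (m : ℕ) (r : ℝ) :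
    HasDerivAt (fun r : ℝ => r ^ (m + 5) / (1 + r ^ 2) ^ (m + 3))
      (r ^ (m + 4) * ((2 * m + 6) * ((1 + r ^ 2) ^ (m + 4))⁻¹ -
        (m + 1) * ((1 + r ^ 2) ^ (m + 3))⁻¹)) r := by
  have hpos : 0 < 1 + r ^ 2 := by positivity
  have hb : HasDerivAt (fun r : ℝ => 1 + r ^ 2) (2 * r) r := by
    simpa using (hasDerivAt_pow 2 r).const_add 1
  refine ((hasDerivAt_pow (m + 5) r).div (hb.pow (m + 3)) (pow_ne_zero _ hpos.ne')).congr_deriv ?_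
  simp only [show m + 5 - 1 = m + 4 by omega, show m + 3 - 1 = m + 2 by omega, Pi.pow_apply]
  push_cast
  field_simp
  ring

theorem tendsto_pow_div_one_add_sq_pow_atTop (m : ℕ) :
    Tendsto (fun r : ℝ => r ^ (m + 5) / (1 + r ^ 2) ^ (m + 3)) atTop (𝓝 0) := by
  refine squeeze_zero' ?_ ?_ tendsto_inv_atTop_zero
  · filter_upwards [eventually_gt_atTop 0] with r hr
    positivity
  · filter_upwards [eventually_ge_atTop 1] with r hr
    rw [div_le_iff₀ (by positivity), le_inv_mul_iff₀ (by positivity)]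
    calc r * r ^ (m + 5) = r ^ (m + 6) := by ring
      _ ≤ r ^ (2 * (m + 3)) := pow_le_pow_right₀ hr (by omega)
      _ = (r ^ 2) ^ (m + 3) := pow_mul ..
      _ ≤ (1 + r ^ 2) ^ (m + 3) := by gcongr; linarith

/-- The integral over `ℝⁿ`, `n = m + 5`, of the divergence of `x ↦ (1 + |x|²)^{-(n-2)} x` is zero. -/
theorem integral_inv_one_add_norm_sq_pow_relation (m : ℕ) :
    (m + 1 : ℝ) * ∫ x : EuclideanSpace ℝ (Fin (m + 5)), ((1 + ‖x‖ ^ 2) ^ (m + 3))⁻¹ =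
      (2 * m + 6 : ℝ) * ∫ x : EuclideanSpace ℝ (Fin (m + 5)), ((1 + ‖x‖ ^ 2) ^ (m + 4))⁻¹ := by
  have h₃ := (integrable_inv_one_add_norm_sq_pow (n := m + 5) (k := m + 3) (by omega)).const_mul
    (m + 1 : ℝ)
  have h₄ := (integrable_inv_one_add_norm_sq_pow (n := m + 5) (k := m + 4) (by omega)).const_mul
    (2 * m + 6 : ℝ)
  let f : ℝ → ℝ := fun r =>
    (2 * m + 6) * ((1 + r ^ 2) ^ (m + 4))⁻¹ - (m + 1) * ((1 + r ^ 2) ^ (m + 3))⁻¹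
  have hf : Integrable (fun x : EuclideanSpace ℝ (Fin (m + 5)) => f ‖x‖) := h₄.sub h₃
  have hzero : ∫ x : EuclideanSpace ℝ (Fin (m + 5)), f ‖x‖ = 0 := by
    have hint := (integrable_fun_norm_addHaar volume).1 hf
    rw [integral_fun_norm_addHaar]
    simp only [finrank_euclideanSpace_fin, show m + 5 - 1 = m + 4 by omega, smul_eq_mul]
      at hint ⊢
    rw [integral_Ioi_of_hasDerivAt_of_tendsto'
      (fun r _ => hasDerivAt_pow_div_one_add_sq_pow m r) hint
      (tendsto_pow_div_one_add_sq_pow_atTop m)]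
    simp
  have hsub := integral_sub h₄ h₃
  rw [integral_const_mul, integral_const_mul] at hsub
  change ∫ x : EuclideanSpace ℝ (Fin (m + 5)), f ‖x‖ = _ at hsub
  linarith

/-- For `n ≥ 5`, `U · Z⁰` is integrable on `ℝⁿ` and `𝔟_n = ∫ U Z⁰ > 0`. -/
theorem integral_bubble_Z0_pos (n : ℕ) (hn : 5 ≤ n) :
    Integrable (fun x : EuclideanSpace ℝ (Fin n) => stdBubble n x * stdZ0 n x) ∧
    0 < ∫ x : EuclideanSpace ℝ (Fin n), stdBubble n x * stdZ0 n x := by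
  obtain ⟨m, rfl⟩ : ∃ m, n = m + 5 := ⟨n - 5, by omega⟩
  simp only [stdBubble_mul_stdZ0 (m + 5) (by omega), show m + 5 - 2 = m + 3 by omega,
    show m + 5 - 1 = m + 4 by omega]
  have h₃ := integrable_inv_one_add_norm_sq_pow (n := m + 5) (k := m + 3) (by omega)
  have h₄ := integrable_inv_one_add_norm_sq_pow (n := m + 5) (k := m + 4) (by omega)
  refine ⟨(h₃.sub (h₄.const_mul 2)).const_mul _, ?_⟩
  rw [integral_const_mul, integral_sub h₃ (h₄.const_mul 2), integral_const_mul]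
  have hn2 : 0 < ((m + 5 : ℕ) : ℝ) - 2 := by
    push_cast
    linarith [(Nat.cast_nonneg m : (0 : ℝ) ≤ m)]
  refine mul_pos (by positivity) ?_
  have hpos : 0 < ∫ x : EuclideanSpace ℝ (Fin (m + 5)), ((1 + ‖x‖ ^ 2) ^ (m + 4))⁻¹ :=
    integral_pos_of_integrable_nonneg_nonzero (x := 0)
      (by fun_prop (disch := intro x; positivity)) h₄ (fun x => by positivity) (by simp)
  have hrel := integral_inv_one_add_norm_sq_pow_relation m
  refine pos_of_mul_pos_right (a := (m + 1 : ℝ)) ?_ (by positivity)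
  linarith
end
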